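/- There is an absolute constant K > 0 such that the following holds for every odd prime p and every θ ∈ (0,1]: if f : 𝔽_p → [0,1] satisfies 𝔼(f) ≥ θ and Λ(f) ≤ Λ(h) for every h : 𝔽_p → [0,1] with 𝔼(h) ≥ θ, then there exist a function r : 𝔽_p → [0,1] with 𝔼(r) = 𝔼(f) and Λ(r) ≤ Λ(f) + K/p, and a real number L, such that, setting g(n) := r(−n/2) (with −n/2 computed in 𝔽_p) and S := { n ∈ 𝔽_p : (r∗r)(2n) + 2·(r∗g)(−n) ≤ L }, one has Σ_{n ∈ 𝔽_p} |r(n) − 1_S(n)| ≤ K·p·(log p)^{−2/3}. -/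

import Mathlib

noncomputable def Lam (p : ℕ) [NeZero p] (f : ZMod p → ℝ) : ℝ :=
  ((p : ℝ) ^ 2)⁻¹ * ∑ n : ZMod p, ∑ d : ZMod p, f n * f (n + d) * f (n + 2 * d)

noncomputable def Ex (p : ℕ) [NeZero p] (f : ZMod p → ℝ) : ℝ :=
  (p : ℝ)⁻¹ * ∑ n : ZMod p, f n

noncomputable def conv (p : ℕ) [NeZero p] (u v : ZMod p → ℝ) (m : ZMod p) : ℝ :=
  ∑ k : ZMod p, u k * v (m - k)

namespace Roth

open Finset

/-- the standard character of `ZMod p` -/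
noncomputable def ch {p : ℕ} [Fact p.Prime] (x : ZMod p) : ℂ := ZMod.stdAddChar x

section
variable {p : ℕ} [Fact p.Prime]

lemma ch_add (x y : ZMod p) : ch (x + y) = ch x * ch y := AddChar.map_add_eq_mul _ _ _

lemma ch_zero : ch (0 : ZMod p) = 1 := AddChar.map_zero_eq_one _

lemma ch_norm (x : ZMod p) : ‖ch x‖ = 1 := AddChar.norm_apply _ _

lemma ch_neg (x : ZMod p) : ch (-x) = (starRingEnd ℂ) (ch x) := by
  have h : ch (-x) * ch x = 1 := by rw [← ch_add]; simp [ch_zero]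
  have h2 : (starRingEnd ℂ) (ch x) * ch x = 1 := by
    rw [mul_comm, Complex.mul_conj, Complex.normSq_eq_norm_sq, ch_norm]; simp
  have h3 : ch x ≠ 0 := by
    intro h0; have := ch_norm x; rw [h0] at this; simp at this
  exact mul_right_cancel₀ h3 (h.trans h2.symm)

lemma ch_sum (b : ZMod p) : ∑ x : ZMod p, ch (x * b) = if b = 0 then (p : ℂ) else 0 := by
  have := AddChar.sum_mulShift (R := ZMod p) b (ZMod.isPrimitive_stdAddChar p)
  unfold ch
  rw [this]
  split_ifs <;> simp [ZMod.card]

lemma ch_close (N : ℕ) (hN : 0 < N) (x y : ZMod p) (h : x.val * N / p = y.val * N / p) :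
    ‖ch x - ch y‖ ≤ 7 / N := by
  have hp : (0 : ℝ) < p := by exact_mod_cast (Fact.out : p.Prime).pos
  have hN' : (0 : ℝ) < N := by exact_mod_cast hN
  have key : |(x.val : ℝ) * N - y.val * N| ≤ p := by
    have hp' : 0 < p := (Fact.out : p.Prime).pos
    have h1 := Nat.div_add_mod (x.val * N) p
    have h2 := Nat.div_add_mod (y.val * N) p
    have h3 := Nat.mod_lt (x.val * N) hp'
    have h4 := Nat.mod_lt (y.val * N) hp'
    rw [h] at h1
    have h1' : ((p * (y.val * N / p) : ℕ) : ℝ) + ((x.val * N % p : ℕ) : ℝ) = x.val * N := by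
      exact_mod_cast h1
    have h2' : ((p * (y.val * N / p) : ℕ) : ℝ) + ((y.val * N % p : ℕ) : ℝ) = y.val * N := by
      exact_mod_cast h2
    have h3' : ((x.val * N % p : ℕ) : ℝ) ≤ p := by exact_mod_cast h3.le
    have h4' : ((y.val * N % p : ℕ) : ℝ) ≤ p := by exact_mod_cast h4.le
    have h5 : (0 : ℝ) ≤ ((x.val * N % p : ℕ) : ℝ) := by positivity
    have h6 : (0 : ℝ) ≤ ((y.val * N % p : ℕ) : ℝ) := by positivity
    rw [abs_le]; constructor <;> linarith
  unfold ch
  rw [ZMod.stdAddChar_apply, ZMod.stdAddChar_apply, ZMod.toCircle_apply, ZMod.toCircle_apply]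
  have e1 : (2 * (Real.pi : ℂ) * Complex.I * (x.val : ℂ) / (p : ℂ)) =
      (2 * (Real.pi : ℂ) * Complex.I * (y.val : ℂ) / (p : ℂ)) +
      Complex.I * ((2 * Real.pi * (x.val - y.val) / p : ℝ) : ℂ) := by
    push_cast
    have : (p : ℂ) ≠ 0 := by exact_mod_cast hp.ne'
    field_simp
    ring
  have e2 : (2 * (Real.pi : ℂ) * Complex.I * (y.val : ℂ) / (p : ℂ)) =
      ((2 * Real.pi * (y.val) / p : ℝ) : ℂ) * Complex.I := by
    push_cast
    ring
  rw [e1, Complex.exp_add]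
  have : Complex.exp (2 * (Real.pi : ℂ) * Complex.I * (y.val : ℂ) / (p : ℂ)) *
      Complex.exp (Complex.I * ((2 * Real.pi * (x.val - y.val) / p : ℝ) : ℂ)) -
      Complex.exp (2 * (Real.pi : ℂ) * Complex.I * (y.val : ℂ) / (p : ℂ)) =
      Complex.exp (2 * (Real.pi : ℂ) * Complex.I * (y.val : ℂ) / (p : ℂ)) *
      (Complex.exp (Complex.I * ((2 * Real.pi * (x.val - y.val) / p : ℝ) : ℂ)) - 1) := by ring
  rw [this, norm_mul, e2, Complex.norm_exp_ofReal_mul_I, one_mul]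
  refine (Real.norm_exp_I_mul_ofReal_sub_one_le).trans ?_
  rw [Real.norm_eq_abs]
  have e3 : 2 * Real.pi * ((x.val : ℝ) - y.val) / p =
      (2 * Real.pi / (p * N)) * ((x.val : ℝ) * N - y.val * N) := by
    field_simp
  rw [e3, abs_mul, abs_of_pos (by positivity)]
  have hpi : Real.pi < 3.15 := Real.pi_lt_d2
  calc 2 * Real.pi / (p * N) * |(x.val : ℝ) * N - y.val * N|
      ≤ 2 * Real.pi / (p * N) * p := by gcongr
    _ = 2 * Real.pi / N := by field_simp
    _ ≤ 7 / N := by gcongr; linarith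

/-- Bohr sets -/
noncomputable def bohr (Γ : Finset (ZMod p)) (ρ : ℝ) : Finset (ZMod p) :=
  univ.filter (fun x => ∀ γ ∈ Γ, ‖ch (γ * x) - 1‖ ≤ ρ)

lemma mem_bohr {Γ : Finset (ZMod p)} {ρ : ℝ} {x : ZMod p} :
    x ∈ bohr Γ ρ ↔ ∀ γ ∈ Γ, ‖ch (γ * x) - 1‖ ≤ ρ := by simp [bohr]

lemma bohr_zero {Γ : Finset (ZMod p)} {ρ : ℝ} (h : 0 ≤ ρ) : (0 : ZMod p) ∈ bohr Γ ρ := by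
  rw [mem_bohr]; intro γ _; simp [ch_zero, h]

lemma bohr_mono {Γ : Finset (ZMod p)} {ρ σ : ℝ} (h : ρ ≤ σ) : bohr Γ ρ ⊆ bohr Γ σ := by
  intro x hx; rw [mem_bohr] at *; intro γ hγ; exact (hx γ hγ).trans h

lemma bohr_anti {Γ Γ' : Finset (ZMod p)} {ρ : ℝ} (h : Γ ⊆ Γ') : bohr Γ' ρ ⊆ bohr Γ ρ := by
  intro x hx; rw [mem_bohr] at *; intro γ hγ; exact hx γ (h hγ)

lemma bohr_neg {Γ : Finset (ZMod p)} {ρ : ℝ} {x : ZMod p} (h : x ∈ bohr Γ ρ) :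
    -x ∈ bohr Γ ρ := by
  rw [mem_bohr] at *; intro γ hγ
  rw [mul_neg, ch_neg]
  have : (starRingEnd ℂ) (ch (γ * x)) - 1 = (starRingEnd ℂ) (ch (γ * x) - 1) := by simp
  rw [this, Complex.norm_conj]; exact h γ hγ

lemma ch_mul_sub_one (z w : ℂ) (hz : ‖z‖ = 1) : ‖z * w - 1‖ ≤ ‖z - 1‖ + ‖w - 1‖ := by
  have : z * w - 1 = z * (w - 1) + (z - 1) := by ring
  rw [this]
  refine (norm_add_le _ _).trans ?_
  rw [norm_mul, hz]; linarith

lemma bohr_add {Γ : Finset (ZMod p)} {ρ σ : ℝ} {x y : ZMod p} (hx : x ∈ bohr Γ ρ)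
    (hy : y ∈ bohr Γ σ) : x + y ∈ bohr Γ (ρ + σ) := by
  rw [mem_bohr] at *; intro γ hγ
  rw [mul_add, ch_add]
  refine (ch_mul_sub_one _ _ (ch_norm _)).trans ?_
  exact add_le_add (hx γ hγ) (hy γ hγ)

lemma bohr_sub {Γ : Finset (ZMod p)} {ρ σ : ℝ} {x y : ZMod p} (hx : x ∈ bohr Γ ρ)
    (hy : y ∈ bohr Γ σ) : x - y ∈ bohr Γ (ρ + σ) := by
  rw [sub_eq_add_neg]; exact bohr_add hx (bohr_neg hy)

lemma bohr_card (Γ : Finset (ZMod p)) (ρ : ℝ) (h0 : 0 < ρ) (h1 : ρ ≤ 1) (d : ℕ)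
    (hd : Γ.card ≤ d) : (ρ / 8) ^ d * p ≤ ((bohr Γ ρ).card : ℝ) := by
  classical
  set N := ⌈7 / ρ⌉₊ with hNdef
  have hN1 : 7 / ρ ≤ N := Nat.le_ceil _
  have hN2 : (N : ℝ) ≤ 8 / ρ := by
    have := Nat.ceil_lt_add_one (a := 7 / ρ) (by positivity)
    have h2 : 1 ≤ 1 / ρ := by rw [le_div_iff₀ h0]; linarith
    have : (8 : ℝ) / ρ = 7 / ρ + 1 / ρ := by ring
    linarith
  have hNpos : (0 : ℝ) < N := lt_of_lt_of_le (by positivity) hN1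
  have hNpos' : 0 < N := by exact_mod_cast hNpos
  have hp : 0 < p := (Fact.out : p.Prime).pos
  -- the cell map
  let cell : ZMod p → (Γ → Fin N) := fun x γ =>
    ⟨(γ.1 * x).val * N / p, by
      rw [Nat.div_lt_iff_lt_mul hp, mul_comm]
      exact Nat.mul_lt_mul_of_pos_left (ZMod.val_lt _) hNpos'⟩
  have hfib : ∀ c : Γ → Fin N, ((univ.filter (fun x => cell x = c)).card : ℝ) ≤ (bohr Γ ρ).card := by
    intro c
    rcases (univ.filter (fun x => cell x = c)).eq_empty_or_nonempty with h | ⟨x0, hx0⟩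
    · rw [h]; simp
    · have hx0' : cell x0 = c := by simpa using hx0
      have : (univ.filter (fun x => cell x = c)).card ≤ (bohr Γ ρ).card := by
        apply Finset.card_le_card_of_injOn (fun x => x - x0)
        · intro x hx
          have hx' : cell x = c := by simpa using hx
          simp only [Finset.mem_coe]
          rw [mem_bohr]
          intro γ hγ
          have e : (γ * x).val * N / p = (γ * x0).val * N / p := by
            have := congrArg (fun f => (f ⟨γ, hγ⟩ : Fin N).val) (hx'.trans hx0'.symm)
            simpa [cell] using this
          have hc := ch_close N hNpos' _ _ e
          have e2 : ch (γ * x) = ch (γ * (x - x0)) * ch (γ * x0) := by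
            rw [← ch_add]; congr 1; ring
          have e3 : ‖ch (γ * x) - ch (γ * x0)‖ = ‖ch (γ * (x - x0)) - 1‖ := by
            rw [e2]
            have : ch (γ * (x - x0)) * ch (γ * x0) - ch (γ * x0) =
              (ch (γ * (x - x0)) - 1) * ch (γ * x0) := by ring
            rw [this, norm_mul, ch_norm, mul_one]
          rw [← e3]
          refine hc.trans ?_
          rw [div_le_iff₀ hNpos]
          rw [div_le_iff₀ h0] at hN1
          linarith
        · intro a _ b _ hab
          simpa using hab
      exact_mod_cast this
  have hsum : (p : ℝ) ≤ (N : ℝ) ^ Γ.card * (bohr Γ ρ).card := by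
    have h1 : (Finset.univ : Finset (ZMod p)).card =
        ∑ c : Γ → Fin N, (univ.filter (fun x => cell x = c)).card :=
      Finset.card_eq_sum_card_fiberwise (f := cell) (t := univ) (by simp)
    rw [Finset.card_univ, ZMod.card] at h1
    have h2 : (p : ℝ) = ∑ c : Γ → Fin N, ((univ.filter (fun x => cell x = c)).card : ℝ) := by
      exact_mod_cast h1
    rw [h2]
    refine (Finset.sum_le_sum (fun c _ => hfib c)).trans ?_
    rw [Finset.sum_const, nsmul_eq_mul]
    simp
  have h8 : ρ / 8 * N ≤ 1 := by
    rw [le_div_iff₀ h0] at hN2; linarith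
  have hpow : (ρ / 8) ^ d ≤ (ρ / 8) ^ Γ.card :=
    pow_le_pow_of_le_one (by positivity) (by linarith) hd
  calc (ρ / 8) ^ d * p ≤ (ρ / 8) ^ Γ.card * ((N : ℝ) ^ Γ.card * (bohr Γ ρ).card) := by gcongr
    _ = (ρ / 8 * N) ^ Γ.card * (bohr Γ ρ).card := by rw [mul_pow]; ring
    _ ≤ 1 * (bohr Γ ρ).card := by
        gcongr
        exact pow_le_one₀ (by positivity) h8
    _ = _ := one_mul _

lemma bohr_card_pos {Γ : Finset (ZMod p)} {ρ : ℝ} (h0 : 0 ≤ ρ) : (0 : ℝ) < (bohr Γ ρ).card := by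
  have : 0 < (bohr Γ ρ).card := Finset.card_pos.mpr ⟨0, bohr_zero h0⟩
  exact_mod_cast this

/-- nearly invariant radius -/
lemma bohr_reg (Γ : Finset (ZMod p)) (r c : ℝ) (h0 : 0 < r) (h1 : r ≤ 1) (hc : 0 < c) (d n : ℕ)
    (hn : 0 < n) (hd : Γ.card ≤ d) (hbig : (16 / r) ^ d < (1 + c) ^ n) :
    ∃ ρ, r / 2 ≤ ρ ∧ ρ ≤ r ∧
      ((bohr Γ (ρ + r / (2 * n))).card : ℝ) ≤ (1 + c) * (bohr Γ ρ).card := by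
  by_contra hcon
  push Not at hcon
  have hn' : (0 : ℝ) < n := by exact_mod_cast hn
  have step : ∀ j : ℕ, j ≤ n →
      (1 + c) ^ j * ((bohr Γ (r / 2)).card : ℝ) ≤ (bohr Γ (r / 2 + j * (r / (2 * n)))).card := by
    intro j
    induction j with
    | zero => intro _; simp
    | succ j ih =>
      intro hj
      have ih' := ih (by omega)
      have hj' : (j : ℝ) ≤ n := by exact_mod_cast (by omega : j ≤ n)
      have hle : (j : ℝ) * (r / (2 * n)) ≤ r / 2 := by
        calc (j : ℝ) * (r / (2 * n)) ≤ n * (r / (2 * n)) := by gcongr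
          _ = r / 2 := by field_simp
      have := hcon (r / 2 + j * (r / (2 * n))) (by
        have : 0 ≤ (j : ℝ) * (r / (2 * n)) := by positivity
        linarith) (by linarith)
      rw [pow_succ]
      have e : r / 2 + ((j + 1 : ℕ) : ℝ) * (r / (2 * n)) =
        r / 2 + j * (r / (2 * n)) + r / (2 * n) := by push_cast; ring
      rw [e]
      calc (1 + c) ^ j * (1 + c) * ((bohr Γ (r / 2)).card : ℝ)
          = (1 + c) * ((1 + c) ^ j * ((bohr Γ (r / 2)).card : ℝ)) := by ring
        _ ≤ (1 + c) * (bohr Γ (r / 2 + j * (r / (2 * n)))).card := by gcongr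
        _ ≤ _ := this.le
  have h2 := step n le_rfl
  have h3 := bohr_card Γ (r / 2) (by positivity) (by linarith) d hd
  have hp : (0 : ℝ) < p := by exact_mod_cast (Fact.out : p.Prime).pos
  have h4 : ((bohr Γ (r / 2 + n * (r / (2 * n)))).card : ℝ) ≤ p := by
    have := Finset.card_le_univ (bohr Γ (r / 2 + n * (r / (2 * n))))
    rw [ZMod.card] at this
    exact_mod_cast this
  have h5 : (1 + c) ^ n * ((r / 2 / 8) ^ d * p) ≤ p := by
    refine le_trans ?_ (h2.trans h4)
    gcongr
  have h6 : (16 / r) ^ d * ((r / 2 / 8) ^ d * p) = p := by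
    rw [← mul_assoc, ← mul_pow]
    have : 16 / r * (r / 2 / 8) = 1 := by field_simp; norm_num
    rw [this]; simp
  have h7 : (16 / r) ^ d * ((r / 2 / 8) ^ d * p) < (1 + c) ^ n * ((r / 2 / 8) ^ d * p) := by
    gcongr
  linarith

end
end Roth

namespace Roth

open Finset

section
variable {p : ℕ} [Fact p.Prime]

/-- Fourier sums of sets -/
noncomputable def ft (S : Finset (ZMod p)) (γ : ZMod p) : ℂ := ∑ x ∈ S, ch (γ * x)

lemma ft_norm_le (S : Finset (ZMod p)) (γ : ZMod p) : ‖ft S γ‖ ≤ S.card := by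
  unfold ft
  refine (norm_sum_le _ _).trans ?_
  simp [ch_norm]

lemma ft_zero (S : Finset (ZMod p)) : ft S 0 = S.card := by
  simp [ft, ch_zero]

lemma bohr_shift {Γ : Finset (ZMod p)} {ρ κ c : ℝ} {t : ZMod p}
    (hreg : ((bohr Γ (ρ + κ)).card : ℝ) ≤ (1 + c) * (bohr Γ ρ).card) (hκ : 0 ≤ κ)
    (ht : t ∈ bohr Γ κ) :
    (((bohr Γ ρ).filter (fun x => x + t ∉ bohr Γ ρ)).card : ℝ) ≤ c * (bohr Γ ρ).card := by
  classical
  have h1 : ((bohr Γ ρ).filter (fun x => x + t ∉ bohr Γ ρ)).card ≤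
      (bohr Γ (ρ + κ) \ bohr Γ ρ).card := by
    apply Finset.card_le_card_of_injOn (fun x => x + t)
    · intro x hx
      have hx' := Finset.mem_filter.mp (Finset.mem_coe.mp hx)
      simp only [Finset.mem_coe, Finset.mem_sdiff]
      exact ⟨bohr_add hx'.1 ht, hx'.2⟩
    · intro a _ b _ hab; simpa using hab
  have h2 : (bohr Γ (ρ + κ) \ bohr Γ ρ).card + (bohr Γ ρ).card = (bohr Γ (ρ + κ)).card :=
    Finset.card_sdiff_add_card_eq_card (bohr_mono (by linarith))
  have h2' : ((bohr Γ (ρ + κ) \ bohr Γ ρ).card : ℝ) + (bohr Γ ρ).card =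
      (bohr Γ (ρ + κ)).card := by exact_mod_cast h2
  have h1' : (((bohr Γ ρ).filter (fun x => x + t ∉ bohr Γ ρ)).card : ℝ) ≤
      (bohr Γ (ρ + κ) \ bohr Γ ρ).card := by exact_mod_cast h1
  linarith

lemma bohr_ft_shift {Γ : Finset (ZMod p)} {ρ κ c : ℝ} {t : ZMod p}
    (hreg : ((bohr Γ (ρ + κ)).card : ℝ) ≤ (1 + c) * (bohr Γ ρ).card) (hκ : 0 ≤ κ)
    (ht : t ∈ bohr Γ κ) (η : ZMod p) :
    ‖ch (η * t) - 1‖ * ‖ft (bohr Γ ρ) η‖ ≤ 2 * c * (bohr Γ ρ).card := by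
  classical
  set B := bohr Γ ρ with hB
  have e1 : (ch (η * t) - 1) * ft B η = ∑ x ∈ B, ch (η * (x + t)) - ∑ x ∈ B, ch (η * x) := by
    unfold ft
    rw [sub_mul, one_mul, Finset.mul_sum]
    congr 1
    apply Finset.sum_congr rfl; intro x _
    rw [← ch_add]; congr 1; ring
  have e2 : ∑ x ∈ B, ch (η * (x + t)) = ∑ x ∈ B.filter (fun x => x + t ∈ B), ch (η * (x + t)) +
      ∑ x ∈ B.filter (fun x => x + t ∉ B), ch (η * (x + t)) :=
    (Finset.sum_filter_add_sum_filter_not _ _ _).symm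
  have e3 : ∑ x ∈ B, ch (η * x) = ∑ x ∈ B.filter (fun x => x - t ∈ B), ch (η * x) +
      ∑ x ∈ B.filter (fun x => x - t ∉ B), ch (η * x) :=
    (Finset.sum_filter_add_sum_filter_not _ _ _).symm
  have e4 : ∑ x ∈ B.filter (fun x => x + t ∈ B), ch (η * (x + t)) =
      ∑ x ∈ B.filter (fun x => x - t ∈ B), ch (η * x) := by
    apply Finset.sum_bij (fun x _ => x + t)
    · intro x hx
      rw [Finset.mem_filter] at hx ⊢
      refine ⟨hx.2, ?_⟩
      simpa using hx.1
    · intro a _ b _ hab; simpa using hab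
    · intro b hb
      rw [Finset.mem_filter] at hb
      refine ⟨b - t, ?_, by simp⟩
      rw [Finset.mem_filter]
      refine ⟨hb.2, ?_⟩
      simpa using hb.1
    · intro x _; rfl
  rw [← norm_mul, e1, e2, e3, e4, add_sub_add_left_eq_sub]
  have b1 := bohr_shift hreg hκ ht
  have b2 := bohr_shift hreg hκ (bohr_neg ht)
  simp only [← sub_eq_add_neg] at b2
  have n1 : ‖∑ x ∈ B.filter (fun x => x + t ∉ B), ch (η * (x + t))‖ ≤
      (B.filter (fun x => x + t ∉ B)).card := by
    refine (norm_sum_le _ _).trans ?_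
    simp [ch_norm]
  have n2 : ‖∑ x ∈ B.filter (fun x => x - t ∉ B), ch (η * x)‖ ≤
      (B.filter (fun x => x - t ∉ B)).card := by
    refine (norm_sum_le _ _).trans ?_
    simp [ch_norm]
  refine (norm_sub_le _ _).trans ?_
  rw [← hB] at b1 b2
  linarith

lemma smooth {ι : Type*} [Fintype ι] (Γ : Finset (ZMod p)) (R1 : ℝ) (hR1 : 0 ≤ R1)
    (lam : ι → ZMod p) (m : ℕ) : ∀ (R : ℝ) (P : ZMod p → ℝ) (c : ι → ℂ), (∀ x, 0 ≤ P x) →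
    (∀ x, (P x : ℂ) = ∑ i, c i * ch (lam i * x)) →
    ∑ x ∈ bohr Γ R, P x ≤ (bohr Γ (R + m * R1)).card *
      ∑ i, ‖c i‖ * (‖ft (bohr Γ R1) (lam i)‖ / (bohr Γ R1).card) ^ m := by
  classical
  induction m with
  | zero =>
    intro R P c hP hc
    simp only [Nat.cast_zero, zero_mul, add_zero, pow_zero, mul_one]
    have : ∀ x ∈ bohr Γ R, P x ≤ ∑ i, ‖c i‖ := by
      intro x _
      have h1 : P x = ‖(P x : ℂ)‖ := by
        rw [Complex.norm_real, Real.norm_of_nonneg (hP x)]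
      rw [h1, hc]
      refine (norm_sum_le _ _).trans ?_
      apply Finset.sum_le_sum; intro i _
      rw [norm_mul, ch_norm, mul_one]
    refine (Finset.sum_le_sum this).trans ?_
    rw [Finset.sum_const, nsmul_eq_mul]
  | succ m ih =>
    intro R P c hP hc
    set B1 := bohr Γ R1 with hB1
    have hpos : (0 : ℝ) < B1.card := bohr_card_pos hR1
    have step : ∑ x ∈ bohr Γ R, P x ≤
        ∑ z ∈ bohr Γ (R + R1), (∑ y ∈ B1, P (z + y)) / B1.card := by
      rw [← Finset.sum_div, le_div_iff₀ hpos, Finset.sum_comm]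
      have : (∑ x ∈ bohr Γ R, P x) * B1.card = ∑ y ∈ B1, ∑ x ∈ bohr Γ R, P x := by
        rw [Finset.sum_const, nsmul_eq_mul]; ring
      rw [this]
      apply Finset.sum_le_sum
      intro y hy
      have e : ∑ x ∈ bohr Γ R, P x = ∑ x ∈ (bohr Γ R).image (fun x => x - y), P (x + y) := by
        rw [Finset.sum_image (by intro a _ b _ hab; simpa using hab)]
        simp
      rw [e]
      apply Finset.sum_le_sum_of_subset_of_nonneg
      · intro z hz
        rw [Finset.mem_image] at hz
        obtain ⟨x, hx, rfl⟩ := hz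
        exact bohr_sub hx hy
      · intro z _ _; exact hP _
    have ih' := ih (R + R1) (fun z => (∑ y ∈ B1, P (z + y)) / B1.card)
      (fun i => c i * (ft B1 (lam i) / B1.card))
      (fun z => div_nonneg (Finset.sum_nonneg (fun y _ => hP _)) hpos.le) (by
        intro z
        push_cast
        simp_rw [hc]
        rw [Finset.sum_comm, Finset.sum_div]
        apply Finset.sum_congr rfl
        intro i _
        unfold ft
        rw [← Finset.mul_sum]
        have : ∑ y ∈ B1, ch (lam i * (z + y)) = ch (lam i * z) * ∑ y ∈ B1, ch (lam i * y) := by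
          rw [Finset.mul_sum]; apply Finset.sum_congr rfl; intro y _
          rw [← ch_add]; congr 1; ring
        rw [this]; ring)
    refine step.trans (ih'.trans (le_of_eq ?_))
    have e : R + R1 + m * R1 = R + ((m + 1 : ℕ) : ℝ) * R1 := by push_cast; ring
    rw [e]
    congr 1
    apply Finset.sum_congr rfl
    intro i _
    rw [norm_mul, norm_div, pow_succ]
    simp
    ring

/-- dissociativity relative to a Bohr set -/
def Dissoc (B1 Λ : Finset (ZMod p)) : Prop :=
  ∀ ω : ZMod p → SignType, (∃ l ∈ Λ, ω l ≠ 0) →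
    ‖ft B1 (∑ l ∈ Λ, ((ω l : ℤ) : ZMod p) * l)‖ < (B1.card : ℝ) / 2

lemma Dissoc.subset {B1 Λ Λ' : Finset (ZMod p)} (h : Dissoc B1 Λ) (hs : Λ' ⊆ Λ) :
    Dissoc B1 Λ' := by
  classical
  intro ω hω
  have := h (fun l => if l ∈ Λ' then ω l else 0) (by
    obtain ⟨l, hl, hl'⟩ := hω
    exact ⟨l, hs hl, by simp [hl, hl']⟩)
  convert this using 3
  rw [← Finset.sum_subset hs]
  · apply Finset.sum_congr rfl; intro l hl; simp [hl]
  · intro l _ hl; simp [hl]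

lemma exp_le_lin (t : ℝ) (h : |t| ≤ 1 / 8) : Real.exp (t - 1 / 32) ≤ 1 + t := by
  rw [abs_le] at h
  have h1 : Real.exp (t - 2 * t ^ 2) ≤ 1 + t := by
    have hu : |t - 2 * t ^ 2| ≤ 1 := by rw [abs_le]; constructor <;> nlinarith
    have := Real.abs_exp_sub_one_sub_id_le hu
    rw [abs_le] at this
    have h2 : (t - 2 * t ^ 2) ^ 2 ≤ 2 * t ^ 2 := by
      have : (t - 2 * t ^ 2) ^ 2 = t ^ 2 * (1 - 2 * t) ^ 2 := by ring
      rw [this]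
      have h3 : (1 - 2 * t) ^ 2 ≤ 2 := by nlinarith
      nlinarith [sq_nonneg t]
    linarith
  refine le_trans (Real.exp_le_exp.mpr ?_) h1
  nlinarith

lemma dissoc_card (Γ : Finset (ZMod p)) (R κ R1 δ : ℝ) (X Λ : Finset (ZMod p))
    (hXB : X ⊆ bohr Γ R) (hδ : 0 < δ) (hX : δ * (bohr Γ R).card ≤ X.card) (hXpos : 0 < X.card)
    (hreg : ((bohr Γ (R + κ)).card : ℝ) ≤ 2 * (bohr Γ R).card) (hR1 : 0 ≤ R1) (m : ℕ)
    (hmκ : m * R1 ≤ κ) (hm : 4 / δ < Real.exp (m / 32))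
    (hspec : ∀ l ∈ Λ, (X.card : ℝ) / 2 ≤ ‖ft X l‖) (hdis : Dissoc (bohr Γ R1) Λ)
    (hcard : Λ.card = m) : False := by
  classical
  set B1 := bohr Γ R1 with hB1
  have hB1pos : (0 : ℝ) < B1.card := bohr_card_pos hR1
  have hXpos' : (0 : ℝ) < X.card := by exact_mod_cast hXpos
  have hne : ∀ l ∈ Λ, ‖ft X l‖ ≠ 0 := by
    intro l hl h0
    have := hspec l hl
    rw [h0] at this; linarith
  -- phases
  let cc : ZMod p → ℂ := fun l => (starRingEnd ℂ) (ft X l) / ‖ft X l‖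
  have hcc : ∀ l ∈ Λ, ‖cc l‖ = 1 := by
    intro l hl
    simp only [cc]
    rw [norm_div, Complex.norm_conj, Complex.norm_real, norm_norm, div_self (hne l hl)]
  have hccft : ∀ l ∈ Λ, cc l * ft X l = ‖ft X l‖ := by
    intro l hl
    simp only [cc]
    rw [div_mul_eq_mul_div, mul_comm, Complex.mul_conj, Complex.normSq_eq_norm_sq]
    have : (‖ft X l‖ : ℂ) ≠ 0 := by exact_mod_cast hne l hl
    push_cast
    field_simp
  let y : ZMod p → ZMod p → ℝ := fun l x => (cc l * ch (l * x)).re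
  have hy : ∀ l ∈ Λ, ∀ x, |y l x| ≤ 1 := by
    intro l hl x
    refine (Complex.abs_re_le_norm _).trans ?_
    rw [norm_mul, hcc l hl, ch_norm, mul_one]
  let P : ZMod p → ℝ := fun x => ∏ l : Λ, (1 + y l x / 8)
  have hPnn : ∀ x, 0 ≤ P x := by
    intro x
    apply Finset.prod_nonneg
    intro l _
    have := hy l l.2 x
    rw [abs_le] at this; linarith
  let co : ZMod p → SignType → ℂ := fun l s =>
    if s = 0 then 1 else if s = 1 then cc l / 16 else (starRingEnd ℂ) (cc l) / 16
  have hfac : ∀ (l x : ZMod p), ((1 + y l x / 8 : ℝ) : ℂ) =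
      ∑ s : SignType, co l s * ch (((s : ℤ) : ZMod p) * l * x) := by
    intro l x
    have hu : (Finset.univ : Finset SignType) = {0, -1, 1} := rfl
    rw [hu]
    rw [Finset.sum_insert (by decide), Finset.sum_insert (by decide), Finset.sum_singleton]
    have e0 : co l 0 = 1 := by simp [co]
    have e1 : co l 1 = cc l / 16 := by simp [co]
    have e2 : co l (-1) = (starRingEnd ℂ) (cc l) / 16 := by
      simp [co]
    rw [e0, e1, e2]
    have f0 : ch ((((0 : SignType) : ℤ) : ZMod p) * l * x) = 1 := by simp [ch_zero]
    have f1 : ch ((((1 : SignType) : ℤ) : ZMod p) * l * x) = ch (l * x) := by simp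
    have f2 : ch ((((-1 : SignType) : ℤ) : ZMod p) * l * x) = (starRingEnd ℂ) (ch (l * x)) := by
      rw [← ch_neg]; simp
    rw [f0, f1, f2]
    have : (((cc l * ch (l * x)).re : ℝ) : ℂ) =
      (cc l * ch (l * x) + (starRingEnd ℂ) (cc l * ch (l * x))) / 2 := Complex.re_eq_add_conj _
    simp only [y]
    push_cast
    rw [this, map_mul]
    ring
  have hPexp : ∀ x, (P x : ℂ) = ∑ ω : Λ → SignType, (∏ l : Λ, co l (ω l)) *
      ch ((∑ l : Λ, ((ω l : ℤ) : ZMod p) * (l : ZMod p)) * x) := by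
    intro x
    simp only [P]
    rw [Complex.ofReal_prod]
    simp_rw [hfac]
    rw [Finset.prod_univ_sum]
    simp only [Fintype.piFinset_univ]
    apply Finset.sum_congr rfl
    intro ω _
    rw [Finset.prod_mul_distrib]
    congr 1
    rw [Finset.sum_mul]
    have hprod : ∀ (S : Finset Λ) (g : Λ → ZMod p), ∏ l ∈ S, ch (g l) = ch (∑ l ∈ S, g l) := by
      intro S g
      induction S using Finset.induction_on with
      | empty => simp [ch_zero]
      | insert a S ha ih => rw [Finset.prod_insert ha, Finset.sum_insert ha, ch_add, ih]
    exact hprod _ _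
  have hsm := smooth Γ R1 hR1 (fun ω : Λ → SignType => ∑ l : Λ, ((ω l : ℤ) : ZMod p) * (l : ZMod p))
    m R P (fun ω => ∏ l : Λ, co l (ω l)) hPnn hPexp
  -- bound of the coefficient sum
  have hterm : ∀ ω : Λ → SignType, ‖∏ l : Λ, co l (ω l)‖ *
      (‖ft B1 (∑ l : Λ, ((ω l : ℤ) : ZMod p) * (l : ZMod p))‖ / B1.card) ^ m ≤
      (if ω = 0 then 1 else 0) + ‖∏ l : Λ, co l (ω l)‖ * (1 / 2) ^ m := by
    intro ω
    by_cases h : ω = 0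
    · subst h
      simp only [if_true]
      have : ‖∏ l : Λ, co l ((0 : Λ → SignType) l)‖ = 1 := by simp [co]
      rw [this, one_mul]
      have h2 : (‖ft B1 (∑ l : Λ, (((0 : Λ → SignType) l : ℤ) : ZMod p) * (l : ZMod p))‖ /
          B1.card) ^ m ≤ 1 := by
        apply pow_le_one₀ (by positivity)
        rw [div_le_one hB1pos]
        exact ft_norm_le _ _
      have : (0 : ℝ) ≤ 1 * (1 / 2) ^ m := by positivity
      linarith
    · simp only [h, if_false, zero_add]
      obtain ⟨l0, hl0⟩ : ∃ l0, ω l0 ≠ 0 := by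
        by_contra hc; push Not at hc; exact h (funext hc)
      have := hdis (fun l => if hl : l ∈ Λ then ω ⟨l, hl⟩ else 0) ⟨l0, l0.2, by simp [hl0]⟩
      have e : ∑ l ∈ Λ, (((if hl : l ∈ Λ then ω ⟨l, hl⟩ else 0 : SignType) : ℤ) : ZMod p) * l =
          ∑ l : Λ, ((ω l : ℤ) : ZMod p) * (l : ZMod p) := by
        rw [← Finset.sum_coe_sort Λ]
        apply Finset.sum_congr rfl
        intro l _
        simp
      rw [e] at this
      have h3 : ‖ft B1 (∑ l : Λ, ((ω l : ℤ) : ZMod p) * (l : ZMod p))‖ / B1.card ≤ 1 / 2 := by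
        rw [div_le_iff₀ hB1pos]; linarith
      exact mul_le_mul_of_nonneg_left (pow_le_pow_left₀ (by positivity) h3 m) (norm_nonneg _)
  have hcoef : ∑ ω : Λ → SignType, ‖∏ l : Λ, co l (ω l)‖ ≤ 2 ^ m := by
    have e : ∑ ω : Λ → SignType, ‖∏ l : Λ, co l (ω l)‖ = ∏ l : Λ, ∑ s : SignType, ‖co l s‖ := by
      rw [Finset.prod_univ_sum]
      simp only [Fintype.piFinset_univ]
      apply Finset.sum_congr rfl; intro ω _
      rw [norm_prod]
    rw [e]
    have : ∀ l : Λ, ∑ s : SignType, ‖co l s‖ ≤ 2 := by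
      intro l
      have hu : (Finset.univ : Finset SignType) = {0, -1, 1} := rfl
      rw [hu]
      rw [Finset.sum_insert (by decide), Finset.sum_insert (by decide), Finset.sum_singleton]
      simp [co, hcc l l.2]
      norm_num
    calc ∏ l : Λ, ∑ s : SignType, ‖co l s‖ ≤ ∏ l : Λ, (2 : ℝ) :=
          Finset.prod_le_prod (fun l _ => by positivity) (fun l _ => this l)
      _ = 2 ^ m := by simp [hcard]
  have hup : ∑ x ∈ bohr Γ R, P x ≤ 4 * (bohr Γ R).card := by
    refine hsm.trans ?_
    have h1 : ∑ ω : Λ → SignType, ‖∏ l : Λ, co l (ω l)‖ *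
      (‖ft B1 (∑ l : Λ, ((ω l : ℤ) : ZMod p) * (l : ZMod p))‖ / B1.card) ^ m ≤ 2 := by
      refine (Finset.sum_le_sum (fun ω _ => hterm ω)).trans ?_
      rw [Finset.sum_add_distrib, ← Finset.sum_mul]
      have : ∑ ω : Λ → SignType, (if ω = 0 then (1 : ℝ) else 0) = 1 := by simp
      rw [this]
      have : (∑ ω : Λ → SignType, ‖∏ l : Λ, co l (ω l)‖) * (1 / 2 : ℝ) ^ m ≤ 1 := by
        calc _ ≤ (2 : ℝ) ^ m * (1 / 2 : ℝ) ^ m := by gcongr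
          _ = 1 := by rw [← mul_pow]; norm_num
      linarith
    have h2 : ((bohr Γ (R + m * R1)).card : ℝ) ≤ 2 * (bohr Γ R).card := by
      refine le_trans ?_ hreg
      exact_mod_cast Finset.card_le_card (bohr_mono (by linarith))
    calc _ ≤ (2 * (bohr Γ R).card : ℝ) * 2 := by gcongr
      _ = _ := by ring
  -- lower bound
  have hlow : X.card * Real.exp (m / 32) ≤ ∑ x ∈ X, P x := by
    have hP1 : ∀ x, Real.exp (∑ l : Λ, (y l x / 8 - 1 / 32)) ≤ P x := by
      intro x
      rw [Real.exp_sum]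
      apply Finset.prod_le_prod (fun l _ => (Real.exp_pos _).le)
      intro l _
      apply exp_le_lin
      have := hy l l.2 x
      rw [abs_div, abs_of_pos (by norm_num : (0 : ℝ) < 8)]
      linarith
    have hmean : X.card * ((m : ℝ) / 32) ≤ ∑ x ∈ X, ∑ l : Λ, (y l x / 8 - 1 / 32) := by
      rw [Finset.sum_comm]
      have : ∀ l : Λ, (X.card : ℝ) / 32 ≤ ∑ x ∈ X, (y l x / 8 - 1 / 32) := by
        intro l
        have h1 : ∑ x ∈ X, y l x = ‖ft X l‖ := by
          have : ((∑ x ∈ X, y l x : ℝ)) = (cc l * ft X l).re := by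
            unfold ft
            rw [Finset.mul_sum, Complex.re_sum]
          rw [this, hccft l l.2, Complex.ofReal_re]
        rw [Finset.sum_sub_distrib, ← Finset.sum_div, h1]
        have := hspec l l.2
        simp
        linarith
      calc (X.card : ℝ) * ((m : ℝ) / 32) = ∑ l : Λ, (X.card : ℝ) / 32 := by
            simp [hcard]; ring
        _ ≤ _ := Finset.sum_le_sum (fun l _ => this l)
    have hjen : ∀ x, Real.exp (m / 32) * (1 + (∑ l : Λ, (y l x / 8 - 1 / 32) - m / 32)) ≤ P x := by
      intro x
      refine le_trans ?_ (hP1 x)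
      have : Real.exp (∑ l : Λ, (y l x / 8 - 1 / 32)) = Real.exp (m / 32) *
          Real.exp (∑ l : Λ, (y l x / 8 - 1 / 32) - m / 32) := by
        rw [← Real.exp_add]; congr 1; ring
      rw [this]
      gcongr
      rw [add_comm]; exact Real.add_one_le_exp _
    refine le_trans ?_ (Finset.sum_le_sum (fun x _ => hjen x))
    rw [← Finset.mul_sum, Finset.sum_add_distrib, Finset.sum_sub_distrib, Finset.sum_const,
      Finset.sum_const, nsmul_eq_mul, nsmul_eq_mul, mul_comm (X.card : ℝ) (Real.exp _)]
    gcongr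
    linarith
  have hle : ∑ x ∈ X, P x ≤ ∑ x ∈ bohr Γ R, P x :=
    Finset.sum_le_sum_of_subset_of_nonneg hXB (fun x _ _ => hPnn x)
  have h1 : (4 : ℝ) * (bohr Γ R).card ≤ 4 / δ * X.card := by
    rw [div_mul_eq_mul_div, le_div_iff₀ hδ]; linarith
  have h2 : X.card * (4 / δ) < X.card * Real.exp (m / 32) := by gcongr
  linarith

lemma chang (Γ : Finset (ZMod p)) (R κ R1 δ : ℝ) (X : Finset (ZMod p))
    (hXB : X ⊆ bohr Γ R) (hδ : 0 < δ) (hX : δ * (bohr Γ R).card ≤ X.card) (hXpos : 0 < X.card)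
    (hreg : ((bohr Γ (R + κ)).card : ℝ) ≤ 2 * (bohr Γ R).card) (hR1 : 0 ≤ R1) (m : ℕ)
    (hmκ : m * R1 ≤ κ) (hm : 4 / δ < Real.exp (m / 32)) :
    ∃ Λ : Finset (ZMod p), Λ.card ≤ m ∧ ∀ γ, (X.card : ℝ) / 2 ≤ ‖ft X γ‖ →
      ∃ η, ((bohr Γ R1).card : ℝ) / 2 ≤ ‖ft (bohr Γ R1) η‖ ∧
        ∀ (t : ZMod p) (σ : ℝ), 0 ≤ σ → (∀ l ∈ Λ, ‖ch (l * t) - 1‖ ≤ σ) →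
          ‖ch (γ * t) - 1‖ ≤ ‖ch (η * t) - 1‖ + m * σ := by
  classical
  set B1 := bohr Γ R1 with hB1
  let 𝒮 : Finset (Finset (ZMod p)) := univ.filter
    (fun Λ => (∀ l ∈ Λ, (X.card : ℝ) / 2 ≤ ‖ft X l‖) ∧ Dissoc B1 Λ)
  have hne : 𝒮.Nonempty := ⟨∅, by
    simp only [𝒮, Finset.mem_filter]
    refine ⟨mem_univ _, by simp, ?_⟩
    rintro ω ⟨l, hl, _⟩; simp at hl⟩
  obtain ⟨Λ, hΛ, hmax⟩ := Finset.exists_max_image 𝒮 Finset.card hne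
  simp only [𝒮, Finset.mem_filter, Finset.mem_univ, true_and] at hΛ hmax
  have hcard : Λ.card ≤ m := by
    by_contra hlt
    push Not at hlt
    obtain ⟨Λ', hs, hc⟩ := Finset.exists_subset_card_eq hlt.le
    exact dissoc_card Γ R κ R1 δ X Λ' hXB hδ hX hXpos hreg hR1 m hmκ hm
      (fun l hl => hΛ.1 l (hs hl)) (hΛ.2.subset hs) hc
  refine ⟨Λ, hcard, ?_⟩
  have hsum : ∀ (ω : ZMod p → SignType) (t : ZMod p) (σ : ℝ) (S : Finset (ZMod p)), 0 ≤ σ →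
      (∀ l ∈ S, ‖ch (l * t) - 1‖ ≤ σ) →
      ‖ch ((∑ l ∈ S, ((ω l : ℤ) : ZMod p) * l) * t) - 1‖ ≤ S.card * σ := by
    intro ω t σ S hσ
    induction S using Finset.induction_on with
    | empty => intro _; simp [ch_zero]
    | insert a S ha ih =>
      intro h
      rw [Finset.sum_insert ha, add_mul, ch_add, Finset.card_insert_of_notMem ha]
      refine (ch_mul_sub_one _ _ (ch_norm _)).trans ?_
      have h1 := ih (fun l hl => h l (Finset.mem_insert_of_mem hl))
      have h2 := h a (Finset.mem_insert_self _ _)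
      have h3 : ‖ch (((ω a : ℤ) : ZMod p) * a * t) - 1‖ ≤ σ := by
        rcases SignType.trichotomy (ω a) with h | h | h
        · rw [h]
          have : ch (((((-1 : SignType)) : ℤ) : ZMod p) * a * t) = ch (-(a * t)) := by simp
          rw [this, ch_neg]
          have e : (starRingEnd ℂ) (ch (a * t)) - 1 = (starRingEnd ℂ) (ch (a * t) - 1) := by simp
          rw [e, Complex.norm_conj]; exact h2
        · rw [h]; simpa [ch_zero] using hσ
        · rw [h]; simpa using h2
      rw [Nat.cast_add, Nat.cast_one, add_mul, one_mul]
      linarith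
  have hB1pos : (0 : ℝ) < B1.card := bohr_card_pos hR1
  intro γ hγ
  by_cases hmem : γ ∈ Λ
  · refine ⟨0, ?_, ?_⟩
    · rw [ft_zero]; simp
    · intro t σ hσ h
      have h1 := h γ hmem
      have h2 : (1 : ℝ) ≤ m := by
        have : 0 < Λ.card := Finset.card_pos.mpr ⟨γ, hmem⟩
        exact_mod_cast (by omega : 1 ≤ m)
      simp only [zero_mul, ch_zero, sub_self, norm_zero, zero_add]
      nlinarith
  · have hnot : ¬ Dissoc B1 (insert γ Λ) := by
      intro hd
      have := hmax (insert γ Λ) ⟨by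
        intro l hl
        rcases Finset.mem_insert.mp hl with h | h
        · rw [h]; exact hγ
        · exact hΛ.1 l h, hd⟩
      rw [Finset.card_insert_of_notMem hmem] at this
      omega
    unfold Dissoc at hnot
    push Not at hnot
    obtain ⟨ω, ⟨l0, hl0, hl0'⟩, hω⟩ := hnot
    rw [Finset.sum_insert hmem] at hω
    have hγ0 : ω γ ≠ 0 := by
      intro h0
      rw [h0] at hω
      have h1 : l0 ∈ Λ := by
        rcases Finset.mem_insert.mp hl0 with h | h
        · exact absurd h0 (h ▸ hl0')
        · exact h
      have := hΛ.2 ω ⟨l0, h1, hl0'⟩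
      simp only [SignType.coe_zero, Int.cast_zero, zero_mul, zero_add] at hω
      linarith
    refine ⟨_, hω, ?_⟩
    intro t σ hσ h
    set η := ((ω γ : ℤ) : ZMod p) * γ + ∑ l ∈ Λ, ((ω l : ℤ) : ZMod p) * l with hη
    have hS := hsum ω t σ Λ hσ h
    have hS' : ‖ch (-((∑ l ∈ Λ, ((ω l : ℤ) : ZMod p) * l) * t)) - 1‖ ≤ Λ.card * σ := by
      rw [ch_neg]
      have e : (starRingEnd ℂ) (ch ((∑ l ∈ Λ, ((ω l : ℤ) : ZMod p) * l) * t)) - 1 =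
        (starRingEnd ℂ) (ch ((∑ l ∈ Λ, ((ω l : ℤ) : ZMod p) * l) * t) - 1) := by simp
      rw [e, Complex.norm_conj]; exact hS
    have hcm : (Λ.card : ℝ) * σ ≤ m * σ := by
      have : (Λ.card : ℝ) ≤ m := by exact_mod_cast hcard
      gcongr
    have hωγ : ‖ch (((ω γ : ℤ) : ZMod p) * γ * t) - 1‖ ≤ ‖ch (η * t) - 1‖ + m * σ := by
      have e : ((ω γ : ℤ) : ZMod p) * γ * t =
        η * t + -((∑ l ∈ Λ, ((ω l : ℤ) : ZMod p) * l) * t) := by rw [hη]; ring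
      rw [e, ch_add]
      refine (ch_mul_sub_one _ _ (ch_norm _)).trans ?_
      linarith
    refine le_trans (le_of_eq ?_) hωγ
    rcases SignType.trichotomy (ω γ) with h | h | h
    · rw [h]
      have : ch (((((-1 : SignType)) : ℤ) : ZMod p) * γ * t) = ch (-(γ * t)) := by simp
      rw [this, ch_neg]
      have e : (starRingEnd ℂ) (ch (γ * t)) - 1 = (starRingEnd ℂ) (ch (γ * t) - 1) := by simp
      rw [e, Complex.norm_conj]
    · exact absurd h hγ0
    · rw [h]; simp

end
end Roth

namespace Roth

open Finset

section
variable {ι : Type*}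

lemma mgf_bound (A : Finset ι) (Y : ι → ℝ) (hY : ∀ a, Y a = 0 ∨ Y a = 1)
    (ψ : ℝ) (hψ0 : 0 ≤ ψ) (hA : 0 < A.card)
    (hψ : ∑ a ∈ A, Y a = ψ * A.card) (lam : ℝ) (hl : |lam| ≤ 1) (k : ℕ) :
    ∑ a ∈ Fintype.piFinset (fun _ : Fin k => A), Real.exp (lam * (∑ i, Y (a i) - k * ψ)) ≤
      (A.card : ℝ) ^ k * Real.exp (k * ψ * lam ^ 2) := by
  have h1 : ∀ a : Fin k → ι, Real.exp (lam * (∑ i, Y (a i) - k * ψ)) =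
      (∏ i, Real.exp (lam * Y (a i))) * Real.exp (-(lam * (k * ψ))) := by
    intro a
    rw [← Real.exp_sum, ← Real.exp_add, ← Finset.mul_sum]
    congr 1; ring
  simp_rw [h1]
  rw [← Finset.sum_mul]
  have h2 := Finset.prod_univ_sum (fun _ : Fin k => A) (fun _ a => Real.exp (lam * Y a))
  rw [← h2]
  have h3 : ∑ a ∈ A, Real.exp (lam * Y a) = A.card * (1 + ψ * (Real.exp lam - 1)) := by
    have : ∀ a ∈ A, Real.exp (lam * Y a) = 1 + Y a * (Real.exp lam - 1) := by
      intro a _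
      rcases hY a with h | h <;> rw [h] <;> simp
    rw [Finset.sum_congr rfl this, Finset.sum_add_distrib, ← Finset.sum_mul, hψ]
    simp; ring
  rw [h3, Finset.prod_const, Finset.card_univ, Fintype.card_fin, mul_pow, mul_assoc]
  apply mul_le_mul_of_nonneg_left _ (by positivity)
  have h4 := (abs_le.mp (Real.abs_exp_sub_one_sub_id_le hl)).2
  have h5 : 1 + ψ * (Real.exp lam - 1) ≤ Real.exp (ψ * (lam + lam ^ 2)) := by
    have := Real.add_one_le_exp (ψ * (lam + lam ^ 2))
    nlinarith
  have h6 : 0 ≤ 1 + ψ * (Real.exp lam - 1) := by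
    have : (0 : ℝ) < A.card := by positivity
    have h7 : 0 ≤ ∑ a ∈ A, Real.exp (lam * Y a) := Finset.sum_nonneg (fun _ _ => (Real.exp_pos _).le)
    rw [h3] at h7
    exact nonneg_of_mul_nonneg_right h7 this
  calc (1 + ψ * (Real.exp lam - 1)) ^ k * Real.exp (-(lam * (k * ψ)))
      ≤ (Real.exp (ψ * (lam + lam ^ 2))) ^ k * Real.exp (-(lam * (k * ψ))) := by
        gcongr
    _ = Real.exp (k * ψ * lam ^ 2) := by
        rw [← Real.exp_nat_mul, ← Real.exp_add]; congr 1; ring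


lemma chernoff (A : Finset ι) (Y : ι → ℝ) (hY : ∀ a, Y a = 0 ∨ Y a = 1)
    (ψ : ℝ) (hψ0 : 0 ≤ ψ) (hA : 0 < A.card)
    (hψ : ∑ a ∈ A, Y a = ψ * A.card) (α ε : ℝ) (hε0 : 0 < ε) (hε1 : ε ≤ 1) (k : ℕ) :
    (((Fintype.piFinset (fun _ : Fin k => A)).filter
      (fun a => ε * (ψ + α) * k < |∑ i, Y (a i) - k * ψ|)).card : ℝ) ≤
      2 * Real.exp (-(k * ε ^ 2 * α)) * (A.card : ℝ) ^ k := by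
  have hp := mgf_bound A Y hY ψ hψ0 hA hψ ε (by rw [abs_of_pos hε0]; exact hε1) k
  have hm := mgf_bound A Y hY ψ hψ0 hA hψ (-ε) (by rw [abs_neg, abs_of_pos hε0]; exact hε1) k
  set T := Fintype.piFinset (fun _ : Fin k => A) with hT
  set E := Real.exp (ε * (ε * (ψ + α) * k)) with hE
  have h1 : (((T.filter (fun a => ε * (ψ + α) * k < |∑ i, Y (a i) - k * ψ|)).card : ℝ)) * E ≤
      ∑ a ∈ T, (Real.exp (ε * (∑ i, Y (a i) - k * ψ)) + Real.exp (-ε * (∑ i, Y (a i) - k * ψ))) := by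
    rw [← nsmul_eq_mul, ← Finset.sum_const]
    refine le_trans (Finset.sum_le_sum ?_) (Finset.sum_le_sum_of_subset_of_nonneg
      (Finset.filter_subset _ _) ?_)
    · intro a ha
      have ha' := (Finset.mem_filter.mp ha).2
      rcases lt_abs.mp ha' with h | h
      · have : E ≤ Real.exp (ε * (∑ i, Y (a i) - k * ψ)) := by
          rw [hE]; apply Real.exp_le_exp.mpr; nlinarith
        have h2 := Real.exp_pos (-ε * (∑ i, Y (a i) - k * ψ))
        linarith
      · have : E ≤ Real.exp (-ε * (∑ i, Y (a i) - k * ψ)) := by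
          rw [hE]; apply Real.exp_le_exp.mpr; nlinarith
        have h2 := Real.exp_pos (ε * (∑ i, Y (a i) - k * ψ))
        linarith
    · intro a _ _; positivity
  rw [Finset.sum_add_distrib] at h1
  have h2 : (-ε) ^ 2 = ε ^ 2 := by ring
  rw [h2] at hm
  have h3 : Real.exp (k * ψ * ε ^ 2) = Real.exp (-(k * ε ^ 2 * α)) * E := by
    rw [hE, ← Real.exp_add]; congr 1; ring
  rw [h3] at hp hm
  have hEpos : 0 < E := Real.exp_pos _
  refine le_of_mul_le_mul_right ?_ hEpos
  linarith

end

section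
variable {p : ℕ} [Fact p.Prime]

/-- density of solutions with midpoint `b` -/
noncomputable def psi (A : Finset (ZMod p)) (b : ZMod p) : ℝ :=
  (∑ a ∈ A, (if 2 * b - a ∈ A then (1 : ℝ) else 0)) / A.card

lemma psi_nonneg (A : Finset (ZMod p)) (b : ZMod p) : 0 ≤ psi A b := by
  unfold psi
  positivity

lemma psi_le_one (A : Finset (ZMod p)) (b : ZMod p) : psi A b ≤ 1 := by
  unfold psi
  apply div_le_one_of_le₀ _ (by positivity)
  calc _ ≤ ∑ a ∈ A, (1 : ℝ) := by
        apply Finset.sum_le_sum; intro a _; split_ifs <;> norm_num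
    _ = _ := by simp

/-- Croot Sisask -/
lemma croot_sisask (A1 D B W : Finset (ZMod p)) (hA : 0 < A1.card) (hD : 0 < D.card)
    (hW : ∀ a ∈ A1, ∀ s ∈ B, a + 2 * s ∈ W) (hB : 0 < B.card)
    (α ε η : ℝ) (hε0 : 0 < ε) (hε1 : ε ≤ 1) (k : ℕ) (hk : 0 < k)
    (hη : 4 * Real.exp (-(k * ε ^ 2 * α)) ≤ η) (β : ℝ) (hβ0 : 0 ≤ β)
    (hβ : β * W.card ≤ A1.card) :
    ∃ (X : Finset (ZMod p)) (G : ZMod p → ℝ) (E : ZMod p → Finset (ZMod p)), X ⊆ B ∧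
      (1 / 2) * β ^ k * B.card ≤ X.card ∧ 0 < X.card ∧
      ∀ s ∈ X, ((E s).card : ℝ) ≤ η * D.card ∧
        ∀ b ∈ D, b ∉ E s → |G (b + s) - psi A1 b| ≤ ε * (psi A1 b + α) := by
  classical
  set T := Fintype.piFinset (fun _ : Fin k => A1) with hT
  have hTc : (T.card : ℝ) = (A1.card : ℝ) ^ k := by
    rw [hT, Fintype.card_piFinset]; simp
  let Y : ZMod p → ZMod p → ℝ := fun b a => if 2 * b - a ∈ A1 then 1 else 0
  have hA' : (0 : ℝ) < A1.card := by exact_mod_cast hA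
  have hD' : (0 : ℝ) < D.card := by exact_mod_cast hD
  have hB' : (0 : ℝ) < B.card := by exact_mod_cast hB
  have hk' : (0 : ℝ) < k := by exact_mod_cast hk
  let bad : (Fin k → ZMod p) → ZMod p → Prop := fun a b =>
    ε * (psi A1 b + α) * k < |∑ i, Y b (a i) - k * psi A1 b|
  have hch : ∀ b, ((T.filter (fun a => bad a b)).card : ℝ) ≤
      2 * Real.exp (-(k * ε ^ 2 * α)) * (A1.card : ℝ) ^ k := by
    intro b
    apply chernoff A1 (Y b) _ (psi A1 b) (psi_nonneg _ _) hA _ α ε hε0 hε1 k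
    · intro a; simp only [Y]; split_ifs <;> simp
    · unfold psi; field_simp; rfl
  have hηpos : 0 < η := lt_of_lt_of_le (by positivity) hη
  set Gd := T.filter (fun a => ((D.filter (fun b => bad a b)).card : ℝ) ≤ η * D.card) with hGd
  have hGcard : (1 / 2) * (A1.card : ℝ) ^ k ≤ Gd.card := by
    set Bd := T.filter (fun a => ¬ ((D.filter (fun b => bad a b)).card : ℝ) ≤ η * D.card) with hBd
    have h1 : (Gd.card : ℝ) + Bd.card = (A1.card : ℝ) ^ k := by
      rw [← hTc]
      exact_mod_cast Finset.card_filter_add_card_filter_not _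
    have h2 : (Bd.card : ℝ) * (η * D.card) ≤ D.card * (2 * Real.exp (-(k * ε ^ 2 * α)) * (A1.card : ℝ) ^ k) := by
      calc (Bd.card : ℝ) * (η * D.card) = ∑ a ∈ Bd, η * D.card := by simp
        _ ≤ ∑ a ∈ Bd, ((D.filter (fun b => bad a b)).card : ℝ) := by
            apply Finset.sum_le_sum; intro a ha
            have := (Finset.mem_filter.mp ha).2
            exact (not_le.mp this).le
        _ ≤ ∑ a ∈ T, ((D.filter (fun b => bad a b)).card : ℝ) := by
            apply Finset.sum_le_sum_of_subset_of_nonneg (Finset.filter_subset _ _)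
            intros; positivity
        _ = ∑ b ∈ D, ((T.filter (fun a => bad a b)).card : ℝ) := by
            have := Finset.sum_card_bipartiteAbove_eq_sum_card_bipartiteBelow (s := T) (t := D) bad
            simp only [Finset.bipartiteAbove, Finset.bipartiteBelow] at this
            exact_mod_cast this
        _ ≤ ∑ b ∈ D, 2 * Real.exp (-(k * ε ^ 2 * α)) * (A1.card : ℝ) ^ k :=
            Finset.sum_le_sum (fun b _ => hch b)
        _ = _ := by simp
    have h3 : (Bd.card : ℝ) ≤ (1 / 2) * (A1.card : ℝ) ^ k := by
      refine le_of_mul_le_mul_right ?_ (mul_pos hηpos hD')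
      have h4 : 0 ≤ (D.card : ℝ) * (A1.card : ℝ) ^ k := by positivity
      nlinarith
    linarith
  -- pigeonhole over shifts
  set Wk := Fintype.piFinset (fun _ : Fin k => W) with hWk
  have hWc : (Wk.card : ℝ) = (W.card : ℝ) ^ k := by
    rw [hWk, Fintype.card_piFinset]; simp
  let X : (Fin k → ZMod p) → Finset (ZMod p) := fun w => B.filter (fun s => (fun i => w i - 2 * s) ∈ Gd)
  have hsum : (Gd.card : ℝ) * B.card ≤ ∑ w ∈ Wk, ((X w).card : ℝ) := by
    have h := Finset.sum_card_bipartiteAbove_eq_sum_card_bipartiteBelow (s := Wk) (t := B)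
      (fun w s => (fun i => w i - 2 * s) ∈ Gd)
    simp only [Finset.bipartiteAbove, Finset.bipartiteBelow] at h
    have h' : ∑ w ∈ Wk, ((X w).card : ℝ) =
      ∑ s ∈ B, ((Wk.filter (fun w => (fun i => w i - 2 * s) ∈ Gd)).card : ℝ) := by exact_mod_cast h
    rw [h']
    calc (Gd.card : ℝ) * B.card = ∑ s ∈ B, (Gd.card : ℝ) := by simp; ring
      _ ≤ _ := by
        apply Finset.sum_le_sum; intro s hs
        have : Gd.card ≤ (Wk.filter (fun w => (fun i => w i - 2 * s) ∈ Gd)).card := by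
          apply Finset.card_le_card_of_injOn (fun a i => a i + 2 * s)
          · intro a ha
            have ha : a ∈ Gd := ha
            simp only [Finset.coe_filter, Set.mem_ofPred_eq, add_sub_cancel_right]
            refine ⟨?_, ha⟩
            rw [hWk, Fintype.mem_piFinset]
            intro i
            exact hW _ (Fintype.mem_piFinset.mp (Finset.mem_filter.mp ha).1 i) s hs
          · intro a _ a' _ h
            funext i
            have := congrFun h i
            simpa using this
        exact_mod_cast this
  have hWpos : 0 < W.card := by
    obtain ⟨a, ha⟩ := Finset.card_pos.mp hA
    obtain ⟨s, hs⟩ := Finset.card_pos.mp hB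
    exact Finset.card_pos.mpr ⟨_, hW a ha s hs⟩
  have hWpos' : (0 : ℝ) < W.card := by exact_mod_cast hWpos
  have hWkne : Wk.Nonempty := by
    rw [← Finset.card_pos]
    have : (0 : ℝ) < Wk.card := by rw [hWc]; positivity
    exact_mod_cast this
  obtain ⟨w, hw, hwX⟩ := Finset.exists_le_of_sum_le (f := fun _ => (Gd.card : ℝ) * B.card / Wk.card)
    (g := fun w => ((X w).card : ℝ)) hWkne (by
      rw [Finset.sum_const, nsmul_eq_mul]
      have : (0 : ℝ) < Wk.card := by rw [hWc]; positivity
      rw [mul_div_cancel₀ _ this.ne']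
      exact hsum)
  have hXc : (1 / 2) * (A1.card : ℝ) ^ k * B.card / (W.card : ℝ) ^ k ≤ (X w).card := by
    refine le_trans ?_ hwX
    rw [← hWc]
    gcongr
  refine ⟨X w, fun x => (∑ i, Y x (w i)) / k, fun s => D.filter (fun b => bad (fun i => w i - 2 * s) b),
    Finset.filter_subset _ _, ?_, ?_, ?_⟩
  · refine le_trans ?_ hXc
    rw [le_div_iff₀ (by positivity)]
    have : (β * W.card) ^ k ≤ (A1.card : ℝ) ^ k := pow_le_pow_left₀ (by positivity) hβ k
    rw [mul_pow] at this
    nlinarith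
  · have : (0 : ℝ) < (X w).card := lt_of_lt_of_le (by positivity) hXc
    exact_mod_cast this
  · intro s hs
    have hsG := (Finset.mem_filter.mp hs).2
    refine ⟨(Finset.mem_filter.mp hsG).2, ?_⟩
    intro b hb hbE
    have hnb : ¬ bad (fun i => w i - 2 * s) b := by
      intro h; exact hbE (Finset.mem_filter.mpr ⟨hb, h⟩)
    have hnb := not_lt.mp hnb
    have e : ∀ i, Y (b + s) (w i) = Y b (w i - 2 * s) := by
      intro i; simp only [Y]
      have : 2 * (b + s) - w i = 2 * b - (w i - 2 * s) := by ring
      rw [this]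
    simp only [e]
    have e2 : (∑ i, Y b (w i - 2 * s)) / k - psi A1 b =
      (∑ i, Y b (w i - 2 * s) - k * psi A1 b) / k := by field_simp
    rw [e2, abs_div, abs_of_pos hk', div_le_iff₀ hk']
    exact hnb

end
end Roth

namespace Roth

open Finset

section
variable {p : ℕ} [Fact p.Prime]

/-- averaging operator over `X - X` -/
noncomputable def avg (X : Finset (ZMod p)) (g : ZMod p → ℝ) (b : ZMod p) : ℝ :=
  (∑ s ∈ X, ∑ t ∈ X, g (b + s - t)) / (X.card : ℝ) ^ 2

lemma avg_lin (X : Finset (ZMod p)) (c : ℝ) (g e : ZMod p → ℝ) :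
    avg X (fun b => c * g b + e b) = fun b => c * avg X g b + avg X e b := by
  funext b
  unfold avg
  simp only [Finset.sum_add_distrib, ← Finset.mul_sum]
  ring

lemma avg_iter_lin (X : Finset (ZMod p)) (c : ℝ) (j : ℕ) (g e : ZMod p → ℝ) :
    (avg X)^[j] (fun b => c * g b + e b) = fun b => c * (avg X)^[j] g b + (avg X)^[j] e b := by
  induction j generalizing g e with
  | zero => rfl
  | succ j ih =>
    simp only [Function.iterate_succ, Function.comp]
    rw [avg_lin, ih]

lemma avg_const (X : Finset (ZMod p)) (hX : 0 < X.card) (c : ℝ) :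
    avg X (fun _ => c) = fun _ => c := by
  funext b
  unfold avg
  have : (X.card : ℝ) ≠ 0 := by positivity
  simp only [Finset.sum_const, nsmul_eq_mul]
  field_simp

lemma avg_iter_const (X : Finset (ZMod p)) (hX : 0 < X.card) (c : ℝ) (j : ℕ) :
    (avg X)^[j] (fun _ => c) = fun _ => c := by
  induction j with
  | zero => rfl
  | succ j ih => rw [Function.iterate_succ, Function.comp, avg_const X hX, ih]

lemma avg_sum (X : Finset (ZMod p)) (hX : 0 < X.card) (g : ZMod p → ℝ) :
    ∑ b, avg X g b = ∑ b, g b := by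
  unfold avg
  rw [← Finset.sum_div, Finset.sum_comm]
  have : ∀ s ∈ X, ∑ b, ∑ t ∈ X, g (b + s - t) = X.card * ∑ b, g b := by
    intro s _
    rw [Finset.sum_comm]
    have : ∀ t ∈ X, ∑ b, g (b + s - t) = ∑ b, g b := by
      intro t _
      have := Equiv.sum_comp (Equiv.addRight (s - t)) g
      rw [← this]
      apply Finset.sum_congr rfl; intro b _; simp [add_sub_assoc]
    rw [Finset.sum_congr rfl this]; simp
  rw [Finset.sum_congr rfl this]
  have : (X.card : ℝ) ≠ 0 := by positivity
  simp only [Finset.sum_const, nsmul_eq_mul]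
  field_simp

lemma avg_iter_sum (X : Finset (ZMod p)) (hX : 0 < X.card) (g : ZMod p → ℝ) (j : ℕ) :
    ∑ b, (avg X)^[j] g b = ∑ b, g b := by
  induction j generalizing g with
  | zero => rfl
  | succ j ih => rw [Function.iterate_succ, Function.comp, ih, avg_sum X hX]

lemma avg_iter_mono (X : Finset (ZMod p)) (D : ℕ → Finset (ZMod p))
    (hD : ∀ j, ∀ b ∈ D j, ∀ s ∈ X, ∀ t ∈ X, b + s - t ∈ D (j + 1)) (j i : ℕ) (g h : ZMod p → ℝ)
    (hgh : ∀ b ∈ D (i + j), g b ≤ h b) : ∀ b ∈ D i, (avg X)^[j] g b ≤ (avg X)^[j] h b := by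
  induction j generalizing i g h with
  | zero => simpa using hgh
  | succ j ih =>
    intro b hb
    simp only [Function.iterate_succ, Function.comp]
    apply ih i _ _ _ b hb
    intro b hb
    unfold avg
    apply div_le_div_of_nonneg_right _ (by positivity)
    apply Finset.sum_le_sum; intro s hs
    apply Finset.sum_le_sum; intro t ht
    exact hgh _ (hD _ b hb s hs t ht)

lemma avg_iter_nonneg (X : Finset (ZMod p)) (hX : 0 < X.card) (j : ℕ) (g : ZMod p → ℝ)
    (hg : ∀ b, 0 ≤ g b) (b : ZMod p) : 0 ≤ (avg X)^[j] g b := by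
  have := avg_iter_mono X (fun _ => univ) (by simp) j 0 (fun _ => 0) g (fun b _ => hg b) b (by simp)
  rwa [avg_iter_const X hX] at this

/-- iterated smoothing barely increases the average over `A2` -/
lemma avg_iter_upper (A1 A2 X : Finset (ZMod p)) (hX : 0 < X.card) (D : ℕ → Finset (ZMod p))
    (hD : ∀ j, ∀ b ∈ D j, ∀ s ∈ X, ∀ t ∈ X, b + s - t ∈ D (j + 1)) (l : ℕ)
    (hDl : ∀ j ≤ l, D j ⊆ D l) (hA2 : A2 ⊆ D 0) (α ε η : ℝ) (hα0 : 0 ≤ α) (hα1 : α ≤ 1)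
    (hε0 : 0 < ε) (hε1 : ε ≤ 1 / 3) (G : ZMod p → ℝ) (E : ZMod p → Finset (ZMod p))
    (hE : ∀ s ∈ X, ((E s).card : ℝ) ≤ η * (D l).card ∧
        ∀ b ∈ D l, b ∉ E s → |G (b + s) - psi A1 b| ≤ ε * (psi A1 b + α)) (hη : 0 ≤ η) :
    ∑ b ∈ A2, (avg X)^[l] (psi A1) b ≤
      (1 + 3 * ε) ^ l * (∑ b ∈ A2, psi A1 b + α * A2.card + l * (4 * η * (D l).card))
        - α * A2.card := by
  set M : ZMod p → ℝ := fun b => psi A1 b + α with hM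
  have hXr : (0 : ℝ) < X.card := by exact_mod_cast hX
  have hM0 : ∀ b, 0 ≤ M b := fun b => add_nonneg (psi_nonneg _ _) hα0
  have hM2 : ∀ b, M b ≤ 2 := fun b => by have := psi_le_one A1 b; simp only [hM]; linarith
  let err : ZMod p → ℝ := fun b => (∑ s ∈ X, ∑ t ∈ X,
    ((if b ∈ E s then (2 : ℝ) else 0) + (if b + s - t ∈ E t then (2 : ℝ) else 0))) / (X.card : ℝ) ^ 2
  have herr0 : ∀ b, 0 ≤ err b := by
    intro b; simp only [err]; positivity
  have herrsum : ∑ b, err b ≤ 4 * η * (D l).card := by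
    simp only [err]
    rw [← Finset.sum_div, div_le_iff₀ (by positivity), Finset.sum_comm]
    calc _ ≤ ∑ s ∈ X, ∑ t ∈ X, (4 * η * (D l).card) := by
          apply Finset.sum_le_sum; intro s hs
          rw [Finset.sum_comm]
          apply Finset.sum_le_sum; intro t ht
          rw [Finset.sum_add_distrib]
          have h1 : ∑ b, (if b ∈ E s then (2 : ℝ) else 0) = 2 * (E s).card := by
            rw [Finset.sum_ite_mem]; simp; ring
          have h2 : ∑ b, (if b + s - t ∈ E t then (2 : ℝ) else 0) = 2 * (E t).card := by
            have := Equiv.sum_comp (Equiv.addRight (s - t)) (fun b => if b ∈ E t then (2 : ℝ) else 0)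
            have h1 : ∑ b, (if b ∈ E t then (2 : ℝ) else 0) = 2 * (E t).card := by
              rw [Finset.sum_ite_mem]; simp; ring
            rw [← h1, ← this]
            apply Finset.sum_congr rfl; intro b _
            rw [add_sub_assoc]; rfl
          rw [h1, h2]
          have := (hE s hs).1; have := (hE t ht).1
          linarith
      _ = _ := by simp only [Finset.sum_const, nsmul_eq_mul]; ring
  have hstep : ∀ b, b ∈ D l → (∀ s ∈ X, ∀ t ∈ X, b + s - t ∈ D l) →
      avg X M b ≤ (1 + 3 * ε) * M b + err b := by
    intro b hb hbD
    have key : ∀ s ∈ X, ∀ t ∈ X, M (b + s - t) ≤ (1 + 3 * ε) * M b +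
      ((if b ∈ E s then (2 : ℝ) else 0) + (if b + s - t ∈ E t then (2 : ℝ) else 0)) := by
      intro s hs t ht
      have hpos : 0 ≤ (1 + 3 * ε) * M b := mul_nonneg (by positivity) (hM0 b)
      by_cases h1 : b ∈ E s
      · rw [if_pos h1]
        have h3 := hM2 (b + s - t)
        have : (0 : ℝ) ≤ (if b + s - t ∈ E t then (2 : ℝ) else 0) := by split_ifs <;> norm_num
        linarith
      by_cases h2 : b + s - t ∈ E t
      · rw [if_pos h2, if_neg h1]
        have h3 := hM2 (b + s - t)
        linarith
      rw [if_neg h1, if_neg h2]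
      have h3 := abs_le.mp ((hE s hs).2 b hb h1)
      have h4 := abs_le.mp ((hE t ht).2 _ (hbD s hs t ht) h2)
      rw [sub_add_cancel] at h4
      have h5 : (1 - ε) * M (b + s - t) ≤ (1 + ε) * M b := by
        simp only [hM]; linarith [h3.2, h4.1]
      have h6 : (1 + ε) ≤ (1 - ε) * (1 + 3 * ε) := by nlinarith
      have h7 : (1 + ε) * M b ≤ (1 - ε) * ((1 + 3 * ε) * M b) := by
        rw [← mul_assoc]; exact mul_le_mul_of_nonneg_right h6 (hM0 b)
      have h8 : M (b + s - t) ≤ (1 + 3 * ε) * M b :=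
        le_of_mul_le_mul_left (h5.trans h7) (by linarith)
      linarith
    have : avg X M b ≤ (∑ s ∈ X, ∑ t ∈ X, ((1 + 3 * ε) * M b +
      ((if b ∈ E s then (2 : ℝ) else 0) + (if b + s - t ∈ E t then (2 : ℝ) else 0)))) /
        (X.card : ℝ) ^ 2 := by
      unfold avg
      apply div_le_div_of_nonneg_right _ (by positivity)
      apply Finset.sum_le_sum; intro s hs
      apply Finset.sum_le_sum; intro t ht
      exact key s hs t ht
    refine this.trans (le_of_eq ?_)
    simp only [err]
    have e : ∑ s ∈ X, ∑ t ∈ X, ((1 + 3 * ε) * M b +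
      ((if b ∈ E s then (2 : ℝ) else 0) + (if b + s - t ∈ E t then (2 : ℝ) else 0))) =
      (1 + 3 * ε) * M b * (X.card : ℝ) ^ 2 + ∑ s ∈ X, ∑ t ∈ X,
      ((if b ∈ E s then (2 : ℝ) else 0) + (if b + s - t ∈ E t then (2 : ℝ) else 0)) := by
      simp only [Finset.sum_add_distrib, Finset.sum_const, nsmul_eq_mul]
      ring
    rw [e, add_div, mul_div_cancel_right₀ _ (by positivity)]
  have hind : ∀ j ≤ l, ∑ b ∈ A2, (avg X)^[j] M b ≤
      (1 + 3 * ε) ^ j * (∑ b ∈ A2, M b + j * (4 * η * (D l).card)) := by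
    intro j
    induction j with
    | zero => intro _; simp
    | succ j ih =>
      intro hj
      have ih := ih (by omega)
      have h1 : ∀ b ∈ D 0, (avg X)^[j] (avg X M) b ≤
          (avg X)^[j] (fun b => (1 + 3 * ε) * M b + err b) b := by
        apply avg_iter_mono X D hD j 0
        intro b hb
        rw [zero_add] at hb
        apply hstep b (hDl j (by omega) hb)
        intro s hs t ht
        exact hDl (j + 1) hj (hD j b hb s hs t ht)
      rw [avg_iter_lin] at h1
      have h2 : ∑ b ∈ A2, (avg X)^[j] err b ≤ 4 * η * (D l).card := by
        refine le_trans ?_ herrsum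
        rw [← avg_iter_sum X hX err j]
        apply Finset.sum_le_sum_of_subset_of_nonneg (Finset.subset_univ _)
        intro b _ _
        exact avg_iter_nonneg X hX j err herr0 b
      have h3 : ∑ b ∈ A2, (avg X)^[j + 1] M b ≤
          (1 + 3 * ε) * ∑ b ∈ A2, (avg X)^[j] M b + ∑ b ∈ A2, (avg X)^[j] err b := by
        rw [Finset.mul_sum, ← Finset.sum_add_distrib]
        apply Finset.sum_le_sum
        intro b hb
        rw [Function.iterate_succ]
        exact h1 b (hA2 hb)
      have h4 : (1 : ℝ) ≤ (1 + 3 * ε) ^ (j + 1) := one_le_pow₀ (by linarith)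
      have h5 : 0 ≤ 4 * η * (D l).card := by positivity
      have h6 : (1 + 3 * ε) * ∑ b ∈ A2, (avg X)^[j] M b ≤ (1 + 3 * ε) *
        ((1 + 3 * ε) ^ j * (∑ b ∈ A2, M b + j * (4 * η * (D l).card))) :=
        mul_le_mul_of_nonneg_left ih (by positivity)
      rw [← mul_assoc, ← pow_succ'] at h6
      push_cast
      nlinarith
  have hfin := hind l le_rfl
  have e1 : (avg X)^[l] M = fun b => (avg X)^[l] (psi A1) b + α := by
    have := avg_iter_lin X 1 l (psi A1) (fun _ => α)
    rw [avg_iter_const X hX] at this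
    simpa [hM] using this
  rw [e1] at hfin
  simp only [hM, Finset.sum_add_distrib, Finset.sum_const, nsmul_eq_mul] at hfin
  have e2 : (A2.card : ℝ) * α = α * A2.card := mul_comm _ _
  rw [e2] at hfin
  linarith

/-- Parseval -/
lemma parseval (A : Finset (ZMod p)) : ∑ γ, ‖ft A γ‖ ^ 2 = p * A.card := by
  have h : ∀ γ, ((‖ft A γ‖ ^ 2 : ℝ) : ℂ) = ∑ a ∈ A, ∑ a' ∈ A, ch (γ * (a - a')) := by
    intro γ
    have : ((‖ft A γ‖ ^ 2 : ℝ) : ℂ) = ft A γ * (starRingEnd ℂ) (ft A γ) := by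
      rw [Complex.mul_conj, Complex.normSq_eq_norm_sq]
    rw [this]
    unfold ft
    rw [map_sum, Finset.sum_mul_sum]
    apply Finset.sum_congr rfl; intro a _
    apply Finset.sum_congr rfl; intro a' _
    rw [← ch_neg, ← ch_add]; congr 1; ring
  have : ((∑ γ, ‖ft A γ‖ ^ 2 : ℝ) : ℂ) = ((p * A.card : ℝ) : ℂ) := by
    rw [Complex.ofReal_sum]
    simp_rw [h]
    rw [Finset.sum_comm]
    have : ∀ a ∈ A, ∑ γ, ∑ a' ∈ A, ch (γ * (a - a')) = (p : ℂ) := by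
      intro a ha
      rw [Finset.sum_comm]
      simp_rw [ch_sum, sub_eq_zero]
      simp [ha]
    rw [Finset.sum_congr rfl this]
    simp; ring
  exact_mod_cast this

lemma psi_fourier (A : Finset (ZMod p)) (b : ZMod p) :
    (psi A b : ℂ) = ∑ γ, (ft A γ ^ 2 / (p * A.card)) * ch (-(2 * γ) * b) := by
  have hp : (p : ℂ) ≠ 0 := by exact_mod_cast (Fact.out : p.Prime).ne_zero
  have h : ∀ γ, ft A γ ^ 2 * ch (-(2 * γ) * b) = ∑ a ∈ A, ∑ a' ∈ A, ch (γ * (a + a' - 2 * b)) := by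
    intro γ
    unfold ft
    rw [sq, Finset.sum_mul_sum, Finset.sum_mul]
    apply Finset.sum_congr rfl; intro a _
    rw [Finset.sum_mul]
    apply Finset.sum_congr rfl; intro a' _
    rw [← ch_add, ← ch_add]; congr 1; ring
  have h2 : ∑ γ, ft A γ ^ 2 * ch (-(2 * γ) * b) =
      p * ∑ a ∈ A, (if 2 * b - a ∈ A then (1 : ℂ) else 0) := by
    simp_rw [h]
    rw [Finset.sum_comm, Finset.mul_sum]
    apply Finset.sum_congr rfl; intro a _
    rw [Finset.sum_comm]
    simp_rw [ch_sum]
    have : ∀ a', (a + a' - 2 * b = 0) ↔ (a' = 2 * b - a) := by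
      intro a'; constructor
      · intro h; linear_combination h
      · intro h; rw [h]; ring
    simp_rw [this]
    rw [Finset.sum_ite_eq']
    simp
  have h3 : (psi A b : ℂ) = (∑ a ∈ A, (if 2 * b - a ∈ A then (1 : ℂ) else 0)) / A.card := by
    unfold psi
    push_cast
    congr 1
    apply Finset.sum_congr rfl; intro a _
    split_ifs <;> simp
  rw [h3]
  have : ∀ γ, (ft A γ ^ 2 / (p * A.card)) * ch (-(2 * γ) * b) =
    (ft A γ ^ 2 * ch (-(2 * γ) * b)) / (p * A.card) := by intro γ; ring
  simp_rw [this]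
  rw [← Finset.sum_div, h2, mul_div_mul_left _ _ hp]

lemma avg_fourier (X : Finset (ZMod p)) (g : ZMod p → ℝ) (c : ZMod p → ℂ)
    (hg : ∀ b, (g b : ℂ) = ∑ γ, c γ * ch (-(2 * γ) * b)) (b : ZMod p) :
    (avg X g b : ℂ) = ∑ γ, (c γ * (((‖ft X (-(2 * γ))‖ / X.card) ^ 2 : ℝ) : ℂ)) * ch (-(2 * γ) * b) := by
  unfold avg
  push_cast
  simp_rw [hg]
  have : ∀ γ, ∑ s ∈ X, ∑ t ∈ X, c γ * ch (-(2 * γ) * (b + s - t)) =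
      c γ * ((‖ft X (-(2 * γ))‖ : ℂ) ^ 2) * ch (-(2 * γ) * b) := by
    intro γ
    have : ((‖ft X (-(2 * γ))‖ : ℂ) ^ 2) = ft X (-(2 * γ)) * (starRingEnd ℂ) (ft X (-(2 * γ))) := by
      rw [Complex.mul_conj, Complex.normSq_eq_norm_sq]; push_cast; rfl
    rw [this]
    unfold ft
    rw [map_sum, Finset.sum_mul_sum, Finset.mul_sum, Finset.sum_mul]
    apply Finset.sum_congr rfl; intro a _
    rw [Finset.mul_sum, Finset.sum_mul]
    apply Finset.sum_congr rfl; intro a' _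
    rw [← ch_neg, mul_assoc, ← ch_add, ← ch_add]; congr 2; ring
  have e : ∑ s ∈ X, ∑ t ∈ X, ∑ γ, c γ * ch (-(2 * γ) * (b + s - t)) =
      ∑ γ, ∑ s ∈ X, ∑ t ∈ X, c γ * ch (-(2 * γ) * (b + s - t)) := by
    rw [Finset.sum_comm (s := univ)]
    apply Finset.sum_congr rfl; intro s _
    rw [Finset.sum_comm]
  rw [e]
  simp_rw [this]
  rw [Finset.sum_div]
  apply Finset.sum_congr rfl; intro γ _
  ring

lemma avg_iter_fourier (X : Finset (ZMod p)) (j : ℕ) (g : ZMod p → ℝ) (c : ZMod p → ℂ)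
    (hg : ∀ b, (g b : ℂ) = ∑ γ, c γ * ch (-(2 * γ) * b)) (b : ZMod p) :
    ((avg X)^[j] g b : ℂ) = ∑ γ, (c γ * (((‖ft X (-(2 * γ))‖ / X.card) ^ (2 * j) : ℝ) : ℂ)) *
      ch (-(2 * γ) * b) := by
  induction j generalizing g c with
  | zero => simp [hg]
  | succ j ih =>
    rw [Function.iterate_succ, Function.comp, ih (avg X g) _ (avg_fourier X g c hg)]
    apply Finset.sum_congr rfl; intro γ _
    rw [mul_assoc (c γ), ← Complex.ofReal_mul, ← pow_add]
    congr 4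
    ring

lemma avg_shift (A X : Finset (ZMod p)) (hA : 0 < A.card) (l : ℕ) (τ : ℝ) (t : ZMod p)
    (hsup : ∀ γ, (‖ft X γ‖ / X.card) ^ (2 * l) * ‖ch (γ * t) - 1‖ ≤ τ) (b : ZMod p) :
    |(avg X)^[l] (psi A) (b + t) - (avg X)^[l] (psi A) b| ≤ τ := by
  have hp : (0 : ℝ) < p := by exact_mod_cast (Fact.out : p.Prime).pos
  have hA' : (0 : ℝ) < A.card := by exact_mod_cast hA
  have h := avg_iter_fourier X l (psi A) _ (psi_fourier A)
  rw [← Real.norm_eq_abs, ← Complex.norm_real, Complex.ofReal_sub, h, h, ← Finset.sum_sub_distrib]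
  refine (norm_sum_le _ _).trans ?_
  have : ∀ γ, ‖ft A γ ^ 2 / (p * A.card) * (((‖ft X (-(2 * γ))‖ / X.card) ^ (2 * l) : ℝ) : ℂ) *
      ch (-(2 * γ) * (b + t)) - ft A γ ^ 2 / (p * A.card) *
      (((‖ft X (-(2 * γ))‖ / X.card) ^ (2 * l) : ℝ) : ℂ) * ch (-(2 * γ) * b)‖ ≤
      ‖ft A γ‖ ^ 2 * (τ / (p * A.card)) := by
    intro γ
    rw [mul_add, ch_add]
    have e : ft A γ ^ 2 / (p * A.card) * (((‖ft X (-(2 * γ))‖ / X.card) ^ (2 * l) : ℝ) : ℂ) *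
      (ch (-(2 * γ) * b) * ch (-(2 * γ) * t)) - ft A γ ^ 2 / (p * A.card) *
      (((‖ft X (-(2 * γ))‖ / X.card) ^ (2 * l) : ℝ) : ℂ) * ch (-(2 * γ) * b) =
      ft A γ ^ 2 / (p * A.card) * ((((‖ft X (-(2 * γ))‖ / X.card) ^ (2 * l) : ℝ) : ℂ) *
      (ch (-(2 * γ) * t) - 1)) * ch (-(2 * γ) * b) := by ring
    rw [e, norm_mul, ch_norm, mul_one, norm_mul, norm_mul, Complex.norm_real, norm_div, norm_pow,
      Real.norm_of_nonneg (by positivity), norm_mul, Complex.norm_natCast, Complex.norm_natCast]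
    have := hsup (-(2 * γ))
    calc ‖ft A γ‖ ^ 2 / (p * A.card) * ((‖ft X (-(2 * γ))‖ / X.card) ^ (2 * l) *
          ‖ch (-(2 * γ) * t) - 1‖) ≤ ‖ft A γ‖ ^ 2 / (p * A.card) * τ := by gcongr
      _ = _ := by ring
  refine (Finset.sum_le_sum (fun γ _ => this γ)).trans ?_
  rw [← Finset.sum_mul, parseval, mul_div_cancel₀ _ (by positivity)]

end
end Roth

namespace Roth

open Finset

section
variable {p : ℕ} [Fact p.Prime]

lemma avg_iter_shift (X : Finset (ZMod p)) (j : ℕ) (g : ZMod p → ℝ) (t : ZMod p) :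
    (avg X)^[j] (fun b => g (b + t)) = fun b => (avg X)^[j] g (b + t) := by
  induction j generalizing g with
  | zero => rfl
  | succ j ih =>
    simp only [Function.iterate_succ, Function.comp]
    rw [← ih]
    congr 1
    funext b
    unfold avg
    congr 1
    apply Finset.sum_congr rfl; intro s _
    apply Finset.sum_congr rfl; intro u _
    exact congrArg g (by ring)

lemma avg_iter_finsum {κ : Type*} (I : Finset κ) (X : Finset (ZMod p)) (hX : 0 < X.card) (j : ℕ)
    (g : κ → ZMod p → ℝ) :
    (avg X)^[j] (fun b => ∑ i ∈ I, g i b) = fun b => ∑ i ∈ I, (avg X)^[j] (g i) b := by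
  classical
  induction I using Finset.induction_on with
  | empty => simp [avg_iter_const X hX]
  | insert a I ha ih =>
    have := avg_iter_lin X 1 j (g a) (fun b => ∑ i ∈ I, g i b)
    simp only [one_mul] at this
    simp only [Finset.sum_insert ha]
    rw [this, ih]

lemma psi_lower (A T U : Finset (ZMod p)) (hT : 0 < T.card) (hA : 0 < A.card) (H : ℝ)
    (hH : ∀ z, ((T.filter (fun t => z + 2 * t ∈ A)).card : ℝ) ≤ H * T.card) (b : ZMod p)
    (hU1 : ∀ w, ∀ t ∈ T, w + 2 * t ∈ A → w ∈ U)
    (hU2 : ∀ w, ∀ t ∈ T, 2 * b - w + 2 * t ∈ A → w ∈ U) :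
    (T.card : ℝ) ^ 2 * (2 * H - H ^ 2 * (U.card / A.card)) ≤
      ∑ i ∈ T ×ˢ T, psi A (b + (i.1 + i.2)) := by
  have hT' : (0 : ℝ) < T.card := by exact_mod_cast hT
  have hA' : (0 : ℝ) < A.card := by exact_mod_cast hA
  let h : ZMod p → ℝ := fun z => ∑ t ∈ T, (if z + 2 * t ∈ A then (1 : ℝ) else 0)
  have hh : ∀ z, h z ≤ H * T.card := by
    intro z
    have := hH z
    simp only [h]
    rwa [Finset.sum_boole]
  have hpt : ∀ x y : ℝ, x ≤ H * T.card → y ≤ H * T.card →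
    (H * T.card) * x + (H * T.card) * y - (H * T.card) ^ 2 ≤ x * y := by
    intro x y hx hy; nlinarith [mul_nonneg (sub_nonneg.mpr hx) (sub_nonneg.mpr hy)]
  have s1 : ∀ t : ZMod p, ∑ w, (if w + 2 * t ∈ A then (1 : ℝ) else 0) = A.card := by
    intro t
    have := Equiv.sum_comp (Equiv.addRight (2 * t)) (fun w => if w ∈ A then (1 : ℝ) else 0)
    have h2 : ∑ w, (if w ∈ A then (1 : ℝ) else 0) = A.card := by
      rw [Finset.sum_ite_mem]; simp
    rw [← h2, ← this]; rfl
  have s2 : ∀ t : ZMod p, ∑ w, (if 2 * b - w + 2 * t ∈ A then (1 : ℝ) else 0) = A.card := by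
    intro t
    rw [← s1 t]
    exact Equiv.sum_comp (Equiv.subLeft (2 * b)) (fun w => if w + 2 * t ∈ A then (1 : ℝ) else 0)
  have e1 : ∑ w ∈ U, h w = T.card * A.card := by
    rw [Finset.sum_subset (Finset.subset_univ U)]
    · simp only [h]
      rw [Finset.sum_comm]
      simp [s1]
    · intro w _ hw
      apply Finset.sum_eq_zero; intro t ht
      rw [if_neg]; intro hc; exact hw (hU1 w t ht hc)
  have e2 : ∑ w ∈ U, h (2 * b - w) = T.card * A.card := by
    rw [Finset.sum_subset (Finset.subset_univ U)]
    · simp only [h]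
      rw [Finset.sum_comm]
      simp [s2]
    · intro w _ hw
      apply Finset.sum_eq_zero; intro t ht
      rw [if_neg]; intro hc; exact hw (hU2 w t ht hc)
  have e3 : ∑ w ∈ U, h w * h (2 * b - w) ≤ A.card * ∑ i ∈ T ×ˢ T, psi A (b + (i.1 + i.2)) := by
    calc ∑ w ∈ U, h w * h (2 * b - w) ≤ ∑ w, h w * h (2 * b - w) := by
          apply Finset.sum_le_sum_of_subset_of_nonneg (Finset.subset_univ _)
          intro w _ _; simp only [h]; positivity
      _ = ∑ w, ∑ t ∈ T, ∑ u ∈ T, (if w + 2 * t ∈ A then (1 : ℝ) else 0) *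
            (if 2 * b - w + 2 * u ∈ A then (1 : ℝ) else 0) := by
          simp only [h, Finset.sum_mul_sum]
      _ = ∑ t ∈ T, ∑ u ∈ T, ∑ w, (if w + 2 * t ∈ A then (1 : ℝ) else 0) *
            (if 2 * b - w + 2 * u ∈ A then (1 : ℝ) else 0) := by
          rw [Finset.sum_comm]
          apply Finset.sum_congr rfl; intro t _
          rw [Finset.sum_comm]
      _ = ∑ t ∈ T, ∑ u ∈ T, A.card * psi A (b + (t + u)) := by
          apply Finset.sum_congr rfl; intro t _
          apply Finset.sum_congr rfl; intro u _
          unfold psi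
          rw [mul_div_cancel₀ _ hA'.ne']
          have := Equiv.sum_comp (Equiv.addRight (2 * t)) (fun a => (if a ∈ A then (1 : ℝ) else 0) *
            (if 2 * (b + (t + u)) - a ∈ A then (1 : ℝ) else 0))
          have e : ∑ a ∈ A, (if 2 * (b + (t + u)) - a ∈ A then (1 : ℝ) else 0) =
            ∑ a, (if a ∈ A then (1 : ℝ) else 0) *
            (if 2 * (b + (t + u)) - a ∈ A then (1 : ℝ) else 0) := by
            simp only [ite_mul, one_mul, zero_mul]
            rw [Finset.sum_ite_mem, Finset.univ_inter]
          rw [e, ← this]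
          apply Finset.sum_congr rfl; intro w _
          have e' : 2 * (b + (t + u)) - (w + 2 * t) = 2 * b - w + 2 * u := by ring
          rw [← e']; rfl
      _ = _ := by
          rw [Finset.sum_product, Finset.mul_sum]
          apply Finset.sum_congr rfl; intro t _
          rw [Finset.mul_sum]
  have e4 : ∑ w ∈ U, ((H * T.card) * h w + (H * T.card) * h (2 * b - w) - (H * T.card) ^ 2) ≤
      ∑ w ∈ U, h w * h (2 * b - w) := Finset.sum_le_sum (fun w _ => hpt _ _ (hh _) (hh _))
  rw [Finset.sum_sub_distrib, Finset.sum_add_distrib, ← Finset.mul_sum, ← Finset.mul_sum, e1, e2,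
    Finset.sum_const, nsmul_eq_mul] at e4
  refine le_of_mul_le_mul_left ?_ hA'
  refine le_trans (le_of_eq ?_) (e4.trans e3)
  field_simp
  ring

lemma avg_lower (A1 X T U : Finset (ZMod p)) (hX : 0 < X.card) (hT : 0 < T.card) (hA : 0 < A1.card)
    (D : ℕ → Finset (ZMod p))
    (hD : ∀ j, ∀ b ∈ D j, ∀ s ∈ X, ∀ t ∈ X, b + s - t ∈ D (j + 1)) (l : ℕ) (H τ : ℝ)
    (hH : ∀ z, ((T.filter (fun t => z + 2 * t ∈ A1)).card : ℝ) ≤ H * T.card)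
    (hU1 : ∀ w, ∀ t ∈ T, w + 2 * t ∈ A1 → w ∈ U)
    (hU2 : ∀ b ∈ D l, ∀ w, ∀ t ∈ T, 2 * b - w + 2 * t ∈ A1 → w ∈ U)
    (hτ : ∀ t ∈ T, ∀ u ∈ T, ∀ γ,
      (‖ft X γ‖ / X.card) ^ (2 * l) * ‖ch (γ * (t + u)) - 1‖ ≤ τ) :
    ∀ b ∈ D 0, 2 * H - H ^ 2 * (U.card / A1.card) ≤ (avg X)^[l] (psi A1) b + τ := by
  intro b hb
  have hT' : (0 : ℝ) < T.card := by exact_mod_cast hT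
  have h1 := avg_iter_mono X D hD l 0
    (fun _ => (T.card : ℝ) ^ 2 * (2 * H - H ^ 2 * (U.card / A1.card)))
    (fun b => ∑ i ∈ T ×ˢ T, psi A1 (b + (i.1 + i.2))) (by
      intro b hb
      rw [zero_add] at hb
      exact psi_lower A1 T U hT hA H hH b hU1 (hU2 b hb)) b hb
  rw [avg_iter_const X hX] at h1
  have h2 := avg_iter_finsum (T ×ˢ T) X hX l (fun i b => psi A1 (b + (i.1 + i.2)))
  rw [h2] at h1
  have h3 : ∑ i ∈ T ×ˢ T, (avg X)^[l] (fun b => psi A1 (b + (i.1 + i.2))) b ≤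
      ∑ i ∈ T ×ˢ T, ((avg X)^[l] (psi A1) b + τ) := by
    apply Finset.sum_le_sum
    intro i hi
    rw [avg_iter_shift]
    have hi' := Finset.mem_product.mp hi
    have := (abs_le.mp (avg_shift A1 X hA l τ (i.1 + i.2) (hτ i.1 hi'.1 i.2 hi'.2) b)).2
    linarith
  rw [Finset.sum_const, nsmul_eq_mul, Finset.card_product] at h3
  push_cast at h3
  refine le_of_mul_le_mul_left ?_ (by positivity : (0 : ℝ) < (T.card : ℝ) ^ 2)
  nlinarith [h1.trans h3]

lemma shift_dens (A Γ S : Finset (ZMod p)) (ρ κ c : ℝ) (hκ : 0 ≤ κ)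
    (hreg : ((bohr Γ (ρ + κ)).card : ℝ) ≤ (1 + c) * (bohr Γ ρ).card) (hS : S ⊆ bohr Γ κ) (x : ZMod p) :
    (S.card : ℝ) * (((bohr Γ ρ).filter (fun b => x + b ∈ A)).card - c * (bohr Γ ρ).card) ≤
      ∑ b ∈ bohr Γ ρ, ((S.filter (fun t => x + b + t ∈ A)).card : ℝ) := by
  set B := bohr Γ ρ with hB
  have h := Finset.sum_card_bipartiteAbove_eq_sum_card_bipartiteBelow (s := B) (t := S)
      (fun b t => x + b + t ∈ A)
  simp only [Finset.bipartiteAbove, Finset.bipartiteBelow] at h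
  have h' : ∑ b ∈ B, ((S.filter (fun t => x + b + t ∈ A)).card : ℝ) =
    ∑ t ∈ S, ((B.filter (fun b => x + b + t ∈ A)).card : ℝ) := by exact_mod_cast h
  rw [h', ← nsmul_eq_mul, ← Finset.sum_const]
  apply Finset.sum_le_sum
  intro t ht
  have h1 := bohr_shift hreg hκ (bohr_neg (hS ht))
  have h2 : (B.filter (fun b => x + b ∈ A)).card ≤ (B.filter (fun b => x + b + t ∈ A)).card +
      (B.filter (fun b => b + -t ∉ B)).card := by
    have : (B.filter (fun b => x + b ∈ A)) ⊆
      ((B.filter (fun b => x + b + t ∈ A)).image (fun b => b + t)) ∪ (B.filter (fun b => b + -t ∉ B)) := by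
      intro b hb
      have hb' := Finset.mem_filter.mp hb
      by_cases hc : b + -t ∈ B
      · apply Finset.mem_union_left
        rw [Finset.mem_image]
        refine ⟨b + -t, Finset.mem_filter.mpr ⟨hc, ?_⟩, by ring⟩
        have : x + (b + -t) + t = x + b := by ring
        rw [this]; exact hb'.2
      · apply Finset.mem_union_right
        exact Finset.mem_filter.mpr ⟨hb'.1, hc⟩
    refine (Finset.card_le_card this).trans ((Finset.card_union_le _ _).trans ?_)
    exact Nat.add_le_add_right Finset.card_image_le _
  have h2' : ((B.filter (fun b => x + b ∈ A)).card : ℝ) ≤ (B.filter (fun b => x + b + t ∈ A)).card +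
      (B.filter (fun b => b + -t ∉ B)).card := by exact_mod_cast h2
  linarith

lemma bohr_half (hp2 : (2 : ZMod p) ≠ 0) (Γ : Finset (ZMod p)) (ρ : ℝ) :
    bohr (Γ.image (fun γ => γ / 2)) ρ = (bohr Γ ρ).image (fun t => 2 * t) := by
  ext x
  rw [mem_bohr, Finset.mem_image]
  constructor
  · intro h
    refine ⟨x / 2, ?_, by field_simp⟩
    rw [mem_bohr]; intro γ hγ
    have := h (γ / 2) (Finset.mem_image_of_mem _ hγ)
    rwa [show γ * (x / 2) = γ / 2 * x by ring]
  · rintro ⟨t, ht, rfl⟩ γ hγ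
    obtain ⟨δ, hδ, rfl⟩ := Finset.mem_image.mp hγ
    rw [mem_bohr] at ht
    have := ht δ hδ
    rwa [show δ / 2 * (2 * t) = δ * t by field_simp]

lemma bohr_half_card (hp2 : (2 : ZMod p) ≠ 0) (Γ : Finset (ZMod p)) (ρ : ℝ) :
    (bohr (Γ.image (fun γ => γ / 2)) ρ).card = (bohr Γ ρ).card := by
  rw [bohr_half hp2]
  apply Finset.card_image_of_injective
  intro a b h
  exact mul_left_cancel₀ hp2 h

end
end Roth

namespace Roth

open Finset

section
variable {p : ℕ} [Fact p.Prime]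

lemma reg_of (Γ : Finset (ZMod p)) (r c r0 : ℝ) (h00 : 0 < r0) (h0 : r0 ≤ r) (h1 : r ≤ 1) (hc : 0 < c)
    (d n e : ℕ) (hn : 0 < n) (hd : Γ.card ≤ d) (hde : d ≤ e) (hbig : (16 / r0) ^ e < (1 + c) ^ n) :
    ∃ ρ, r / 2 ≤ ρ ∧ ρ ≤ r ∧
      ((bohr Γ (ρ + r / (2 * n))).card : ℝ) ≤ (1 + c) * (bohr Γ ρ).card := by
  apply bohr_reg Γ r c (by linarith) h1 hc d n hn hd
  refine lt_of_le_of_lt ?_ hbig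
  have h2 : 16 / r ≤ 16 / r0 := by gcongr
  have h3 : 1 ≤ 16 / r := by rw [le_div_iff₀ (by linarith)]; linarith
  calc (16 / r) ^ d ≤ (16 / r) ^ e := pow_le_pow_right₀ h3 hde
    _ ≤ _ := by gcongr

lemma pow_bound (l : ℕ) (hl : 0 < l) : (1 + 3 * (1 / (64 * (l : ℝ)))) ^ l ≤ 1.05 := by
  have hl' : (0 : ℝ) < l := by exact_mod_cast hl
  have h1 : 1 + 3 * (1 / (64 * (l : ℝ))) ≤ Real.exp (3 / (64 * l)) := by
    have := Real.add_one_le_exp (3 / (64 * (l : ℝ)))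
    have e : 3 * (1 / (64 * (l : ℝ))) = 3 / (64 * l) := by ring
    linarith
  have h2 : (1 + 3 * (1 / (64 * (l : ℝ)))) ^ l ≤ Real.exp (3 / (64 * l)) ^ l := by gcongr
  rw [← Real.exp_nat_mul] at h2
  have e : (l : ℝ) * (3 / (64 * l)) = 3 / 64 := by field_simp
  rw [e] at h2
  refine h2.trans ?_
  have h3 := Real.add_one_le_exp (-(3 / 64) : ℝ)
  rw [Real.exp_neg] at h3
  have h4 : Real.exp (3 / 64) ≤ (61 / 64)⁻¹ := by
    rw [le_inv_comm₀ (Real.exp_pos _) (by norm_num)]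
    linarith
  refine h4.trans (by norm_num)

set_option maxHeartbeats 2000000 in
lemma core (A1 A2 Γ : Finset (ZMod p)) (α0 c0 α : ℝ) (l k m n d : ℕ)
    (ρ' κ' ρ'' κ'' κ5 : ℝ) (hα0 : 0 < α0) (hα : α0 ≤ α) (hα1 : α ≤ 1) (hc0 : c0 = α0 / 1000)
    (hl : 0 < l) (hk : 0 < k) (hm0 : 0 < m) (hn0 : 0 < n) (h4l : 20 ≤ α0 * 4 ^ l)
    (hη : 4 * Real.exp (-(k * (1 / (64 * (l : ℝ))) ^ 2 * α0)) ≤ α0 ^ 2 / (220 * l))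
    (hm : 4 / ((1 / 2) * (α0 / 4) ^ k) < Real.exp (m / 32))
    (hΓ : Γ.card ≤ d) (hA1 : A1 ⊆ bohr Γ ρ') (hA2 : A2 ⊆ bohr Γ ρ'')
    (hreg' : ((bohr Γ (ρ' + κ')).card : ℝ) ≤ (1 + c0) * (bohr Γ ρ').card)
    (hreg'' : ((bohr Γ (ρ'' + κ'')).card : ℝ) ≤ (1 + c0) * (bohr Γ ρ'').card)
    (hρ' : 0 < ρ') (hρ'' : 0 < ρ'') (hκ'' : 0 < κ'') (h8 : 8 * ρ'' ≤ κ') (h8' : 8 * κ'' ≤ κ')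
    (hκ1 : κ' ≤ 1)
    (hd1 : 0.89 * α * (bohr Γ ρ').card ≤ A1.card) (hd2 : 0.89 * α * (bohr Γ ρ'').card ≤ A2.card)
    (hψ : ∑ b ∈ A2, psi A1 b ≤ α / 4 * A2.card)
    (hκ5 : κ5 = κ'' * c0 / (32 * l * m ^ 2 * n ^ 3))
    (hbig : (16 / κ5) ^ (d + m) < (1 + c0) ^ n) :
    ∃ (Γ' : Finset (ZMod p)) (ρ5 : ℝ) (z : ZMod p), Γ'.card ≤ d + m ∧ κ5 ≤ ρ5 ∧ ρ5 ≤ 1 ∧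
      ((bohr Γ' (ρ5 + κ5)).card : ℝ) ≤ (1 + c0) * (bohr Γ' ρ5).card ∧
      1.1 * α * (bohr Γ' ρ5).card ≤
        (((bohr Γ' ρ5).filter (fun t => z + 2 * t ∈ A1)).card : ℝ) := by
  have hl' : (1 : ℝ) ≤ l := by exact_mod_cast hl
  have hm' : (1 : ℝ) ≤ m := by exact_mod_cast hm0
  have hn' : (1 : ℝ) ≤ n := by exact_mod_cast hn0
  have hc0pos : 0 < c0 := by rw [hc0]; positivity
  have hc01 : c0 ≤ 1 / 1000 := by rw [hc0]; linarith
  have hαpos : 0 < α := by linarith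
  have hκ5pos : 0 < κ5 := by rw [hκ5]; positivity
  have hκ''1 : κ'' ≤ 1 := by linarith
  have hB'pos : (0 : ℝ) < (bohr Γ ρ').card := bohr_card_pos hρ'.le
  have hB''pos : (0 : ℝ) < (bohr Γ ρ'').card := bohr_card_pos hρ''.le
  have hA1pos' : (0 : ℝ) < A1.card := lt_of_lt_of_le (by positivity) hd1
  have hA1pos : 0 < A1.card := by exact_mod_cast hA1pos'
  have hA2pos' : (0 : ℝ) < A2.card := lt_of_lt_of_le (by positivity) hd2
  have one_le_l2 : (1 : ℝ) ≤ 2 * l := by linarith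
  -- radius R
  set rR := κ'' / (2 * l) with hrR
  set κR := rR / (2 * n) with hκR
  set r1 := κR / m with hr1
  set κ1 := r1 / (2 * n) with hκ1d
  set r5 := κ1 * c0 / (2 * m) with hr5
  have e5 : κ5 = r5 / (2 * n) := by
    rw [hκ5, hr5, hκ1d, hr1, hκR, hrR]; field_simp; ring
  have hrRpos : 0 < rR := by rw [hrR]; positivity
  have hκRpos : 0 < κR := by rw [hκR]; positivity
  have hr1pos : 0 < r1 := by rw [hr1]; positivity
  have hκ1pos : 0 < κ1 := by rw [hκ1d]; positivity
  have hr5pos : 0 < r5 := by rw [hr5]; positivity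
  have i1 : rR ≤ κ'' / 2 := by
    rw [hrR]; apply div_le_div_of_nonneg_left hκ''.le (by norm_num); linarith
  have i2 : κR ≤ rR := by rw [hκR]; apply div_le_self hrRpos.le; linarith
  have i3 : r1 ≤ κR := by rw [hr1]; apply div_le_self hκRpos.le; linarith
  have i4 : κ1 ≤ r1 := by rw [hκ1d]; apply div_le_self hr1pos.le; linarith
  have i5 : r5 ≤ κ1 * c0 / 2 := by
    rw [hr5]; apply div_le_div_of_nonneg_left (by positivity) (by norm_num); linarith
  have i6 : κ5 ≤ r5 / 2 := by
    rw [e5]; apply div_le_div_of_nonneg_left hr5pos.le (by norm_num); linarith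
  have i5' : r5 ≤ κ1 / 2 := by
    have : κ1 * c0 ≤ κ1 * 1 := mul_le_mul_of_nonneg_left (by linarith) hκ1pos.le
    linarith
  obtain ⟨R, hR1, hR2, hRreg⟩ := reg_of Γ rR c0 κ5 hκ5pos (by linarith) (by linarith) hc0pos d n (d + m)
    hn0 hΓ (by omega) hbig
  rw [← hκR] at hRreg
  have hRpos : 0 < R := by linarith
  obtain ⟨R1, hR11, hR12, hR1reg⟩ := reg_of Γ r1 c0 κ5 hκ5pos (by linarith) (by linarith) hc0pos d n
    (d + m) hn0 hΓ (by omega) hbig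
  rw [← hκ1d] at hR1reg
  have hR1pos : 0 < R1 := by linarith
  -- Croot Sisask
  let D : ℕ → Finset (ZMod p) := fun j => bohr Γ (ρ'' + 2 * j * R)
  have hlR : 2 * l * R ≤ κ'' := by
    have : 2 * l * R ≤ 2 * l * rR := by gcongr
    rw [hrR] at this
    have e : 2 * (l : ℝ) * (κ'' / (2 * l)) = κ'' := by field_simp
    linarith
  have hDpos : 0 < (D l).card := by
    have : (0 : ℝ) < (D l).card := bohr_card_pos (by positivity)
    exact_mod_cast this
  have hDcard : ((D l).card : ℝ) ≤ (1 + c0) * (bohr Γ ρ'').card := by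
    refine le_trans ?_ hreg''
    exact_mod_cast Finset.card_le_card (bohr_mono (by linarith))
  have hBR : 0 < (bohr Γ R).card := by
    have : (0 : ℝ) < (bohr Γ R).card := bohr_card_pos hRpos.le
    exact_mod_cast this
  set ε : ℝ := 1 / (64 * (l : ℝ)) with hε
  set η : ℝ := α0 ^ 2 / (220 * l) with hηd
  have hε0 : 0 < ε := by rw [hε]; positivity
  have hε1 : ε ≤ 1 / 64 := by
    rw [hε]; apply div_le_div_of_nonneg_left (by norm_num) (by norm_num); linarith
  obtain ⟨X, G, E, hXB, hXcard, hXpos, hXE⟩ := croot_sisask A1 (D l) (bohr Γ R) (bohr Γ (ρ' + κ'))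
    hA1pos hDpos (by
      intro a ha s hs
      rw [two_mul]
      refine bohr_mono ?_ (bohr_add (hA1 ha) (bohr_add hs hs))
      linarith) hBR α ε η hε0 (by linarith) k hk (by
        refine le_trans ?_ hη
        gcongr) (α0 / 4) (by positivity) (by
        calc α0 / 4 * ((bohr Γ (ρ' + κ')).card : ℝ) ≤ α0 / 4 * ((1 + c0) * (bohr Γ ρ').card) := by gcongr
          _ ≤ 0.89 * α * (bohr Γ ρ').card := by
            rw [← mul_assoc]
            apply mul_le_mul_of_nonneg_right _ hB'pos.le
            have : α0 / 4 * (1 + c0) ≤ α / 4 * 2 := by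
              apply mul_le_mul <;> linarith
            linarith
          _ ≤ _ := hd1)
  have hDstep : ∀ j, ∀ b ∈ D j, ∀ s ∈ X, ∀ t ∈ X, b + s - t ∈ D (j + 1) := by
    intro j b hb s hs t ht
    have := bohr_sub (bohr_add hb (hXB hs)) (hXB ht)
    refine bohr_mono (le_of_eq ?_) this
    push_cast; ring
  have hup := avg_iter_upper A1 A2 X hXpos D hDstep l (by
      intro j hj
      apply bohr_mono
      have : (j : ℝ) ≤ l := by exact_mod_cast hj
      have : 2 * (j : ℝ) * R ≤ 2 * l * R := by gcongr
      linarith) (by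
      simp only [D]; simpa using hA2) α ε η hαpos.le hα1 hε0 (by linarith) G E hXE (by positivity)
  -- Chang
  obtain ⟨Λ, hΛcard, hΛ⟩ := chang Γ R κR R1 ((1 / 2) * (α0 / 4) ^ k) X hXB (by positivity) hXcard hXpos
    (hRreg.trans (by gcongr; linarith)) hR1pos.le m (by
      have : (m : ℝ) * R1 ≤ m * r1 := by gcongr
      rw [hr1, mul_div_cancel₀ _ (by positivity)] at this
      exact this) hm
  classical
  have hΓ'card : (Γ ∪ Λ).card ≤ d + m := (Finset.card_union_le _ _).trans (by omega)
  obtain ⟨ρ5, hρ51, hρ52, hρ5reg⟩ := reg_of (Γ ∪ Λ) r5 c0 κ5 hκ5pos (by linarith) (by linarith) hc0pos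
    (d + m) n (d + m) hn0 hΓ'card le_rfl hbig
  rw [← e5] at hρ5reg
  by_contra hcon
  push Not at hcon
  have hnoinc := fun z => hcon (Γ ∪ Λ) ρ5 z hΓ'card (by linarith) (by linarith) hρ5reg
  set T := bohr (Γ ∪ Λ) ρ5 with hT
  have hTsub : T ⊆ bohr Γ ρ5 := bohr_anti Finset.subset_union_left
  have hTpos : 0 < T.card := by
    have : (0 : ℝ) < T.card := bohr_card_pos (by linarith)
    exact_mod_cast this
  have hXr : (0 : ℝ) < X.card := by exact_mod_cast hXpos
  have hm2 : (m : ℝ) * (2 * ρ5) ≤ c0 := by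
    have h1 : (m : ℝ) * (2 * ρ5) ≤ m * (2 * r5) := by gcongr
    have h2 : (m : ℝ) * (2 * r5) = κ1 * c0 := by rw [hr5]; field_simp
    have h3 : κ1 * c0 ≤ 1 * c0 := mul_le_mul_of_nonneg_right (by linarith) hc0pos.le
    linarith
  have hτ : ∀ t ∈ T, ∀ u ∈ T, ∀ γ,
      (‖ft X γ‖ / X.card) ^ (2 * l) * ‖ch (γ * (t + u)) - 1‖ ≤ 0.1 * α := by
    intro t ht u hu γ
    by_cases hγ : (X.card : ℝ) / 2 ≤ ‖ft X γ‖
    · obtain ⟨ζ, hζ1, hζ2⟩ := hΛ γ hγ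
      have htu : t + u ∈ bohr (Γ ∪ Λ) (2 * ρ5) := by
        have := bohr_add ht hu
        rwa [← two_mul] at this
      have htuΓ : t + u ∈ bohr Γ κ1 :=
        bohr_mono (by linarith) (bohr_anti Finset.subset_union_left htu)
      have h1 := hζ2 (t + u) (2 * ρ5) (by linarith) (fun l hl =>
        (mem_bohr.mp htu) l (Finset.mem_union_right _ hl))
      have h2 := bohr_ft_shift hR1reg hκ1pos.le htuΓ ζ
      have hB1 : (0 : ℝ) < (bohr Γ R1).card := bohr_card_pos hR1pos.le
      have h3 : ‖ch (ζ * (t + u)) - 1‖ ≤ 4 * c0 := by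
        have : ‖ch (ζ * (t + u)) - 1‖ * ((bohr Γ R1).card / 2) ≤ 2 * c0 * (bohr Γ R1).card :=
          le_trans (by gcongr) h2
        refine le_of_mul_le_mul_right ?_ (half_pos hB1)
        linarith
      have h4 : (‖ft X γ‖ / X.card) ^ (2 * l) ≤ 1 := by
        apply pow_le_one₀ (by positivity)
        rw [div_le_one hXr]; exact ft_norm_le _ _
      calc _ ≤ 1 * ‖ch (γ * (t + u)) - 1‖ := by gcongr
        _ ≤ 0.1 * α := by rw [hc0] at h3 hm2; linarith
    · push Not at hγ
      have h1 : ‖ft X γ‖ / X.card ≤ 1 / 2 := by rw [div_le_iff₀ hXr]; linarith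
      have h2 : (‖ft X γ‖ / X.card) ^ (2 * l) ≤ (1 / 4) ^ l := by
        rw [pow_mul]
        apply pow_le_pow_left₀ (by positivity)
        have h0 : 0 ≤ ‖ft X γ‖ / X.card := by positivity
        have := mul_le_mul h1 h1 h0 (by norm_num)
        rw [sq]; linarith
      have h3 : ‖ch (γ * (t + u)) - 1‖ ≤ 2 := by
        refine (norm_sub_le _ _).trans ?_
        rw [ch_norm]; norm_num
      have h4 : (1 / 4 : ℝ) ^ l * 2 ≤ 0.1 * α0 := by
        rw [div_pow, one_pow, div_mul_eq_mul_div, one_mul, div_le_iff₀ (by positivity)]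
        linarith
      calc _ ≤ (1 / 4 : ℝ) ^ l * 2 := by gcongr
        _ ≤ _ := by linarith
  have hlow := avg_lower A1 X T (bohr Γ (ρ' + κ')) hXpos hTpos hA1pos D hDstep l (1.1 * α) (0.1 * α)
    (fun z => (hnoinc z).le) (by
      intro w t ht hw
      have h1 := bohr_sub (hA1 hw) (bohr_add (hTsub ht) (hTsub ht))
      have e : w + 2 * t - (t + t) = w := by ring
      rw [e] at h1
      exact bohr_mono (by linarith) h1) (by
      intro b hb w t ht hw
      have h1 := bohr_add (bohr_sub (bohr_add hb hb) (hA1 hw)) (bohr_add (hTsub ht) (hTsub ht))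
      have e : b + b - (2 * b - w + 2 * t) + (t + t) = w := by ring
      rw [e] at h1
      refine bohr_mono ?_ h1
      linarith) hτ
  have hUA : ((bohr Γ (ρ' + κ')).card : ℝ) / A1.card ≤ 1.001 / (0.89 * α) := by
    rw [div_le_div_iff₀ hA1pos' (by positivity)]
    calc ((bohr Γ (ρ' + κ')).card : ℝ) * (0.89 * α) ≤ ((1 + c0) * (bohr Γ ρ').card) * (0.89 * α) := by gcongr
      _ = (1 + c0) * (0.89 * α * (bohr Γ ρ').card) := by ring
      _ ≤ 1.001 * A1.card := by
        apply mul_le_mul (by linarith) hd1 (by positivity) (by norm_num)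
  have hlow2 : ∀ b ∈ A2, 0.73 * α ≤ (avg X)^[l] (psi A1) b := by
    intro b hb
    have h1 := hlow b (by simp only [D]; simpa using hA2 hb)
    have h2 : (1.1 * α) ^ 2 * ((bohr Γ (ρ' + κ')).card / A1.card) ≤
      (1.1 * α) ^ 2 * (1.001 / (0.89 * α)) := by gcongr
    have h3 : (1.1 * α) ^ 2 * (1.001 / (0.89 * α)) = (1.1 ^ 2 * 1.001 / 0.89) * α := by
      field_simp
    have h4 : (1.1 ^ 2 * 1.001 / 0.89) * α ≤ 1.37 * α := by
      gcongr; norm_num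
    linarith
  have hsumlow : 0.73 * α * A2.card ≤ ∑ b ∈ A2, (avg X)^[l] (psi A1) b := by
    have := Finset.sum_le_sum hlow2
    rw [Finset.sum_const, nsmul_eq_mul] at this
    linarith
  have herr : (l : ℝ) * (4 * η * (D l).card) ≤ 0.03 * α * A2.card := by
    have h1 : (l : ℝ) * (4 * η * (D l).card) = α0 ^ 2 / 55 * (D l).card := by
      rw [hηd]; field_simp; ring
    rw [h1]
    have h2 : α0 ^ 2 ≤ α * α := by
      rw [sq]; exact mul_le_mul hα hα hα0.le hαpos.le
    calc α0 ^ 2 / 55 * ((D l).card : ℝ) ≤ α * α / 55 * (1.001 * (bohr Γ ρ'').card) := by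
          have : ((D l).card : ℝ) ≤ 1.001 * (bohr Γ ρ'').card :=
            hDcard.trans (by gcongr; linarith)
          gcongr
      _ = (1.001 / (55 * 0.89)) * α * (0.89 * α * (bohr Γ ρ'').card) := by ring
      _ ≤ (1.001 / (55 * 0.89)) * α * A2.card := by gcongr
      _ ≤ _ := by gcongr; norm_num
  have hpw := pow_bound l hl
  rw [← hε] at hpw
  have hin : 0 ≤ ∑ b ∈ A2, psi A1 b + α * A2.card + l * (4 * η * (D l).card) := by
    have : 0 ≤ ∑ b ∈ A2, psi A1 b := Finset.sum_nonneg (fun b _ => psi_nonneg _ _)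
    positivity
  have hup2 : (1 + 3 * ε) ^ l * (∑ b ∈ A2, psi A1 b + α * A2.card + l * (4 * η * (D l).card)) ≤
      1.05 * (α / 4 * A2.card + α * A2.card + 0.03 * α * A2.card) := by
    refine (mul_le_mul_of_nonneg_right hpw hin).trans ?_
    gcongr
  have : 0 < α * A2.card := by positivity
  linarith

end
end Roth

namespace Roth

open Finset

section
variable {p : ℕ} [Fact p.Prime]

/-- number of solutions -/
noncomputable def N3 (A : Finset (ZMod p)) : ℝ :=
  ∑ b ∈ A, ∑ a ∈ A, (if 2 * b - a ∈ A then (1 : ℝ) else 0)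

/-- state of the iteration -/
def St (A : Finset (ZMod p)) (c : ℝ) (d : ℕ) (κ α : ℝ) : Prop :=
  ∃ (Γ : Finset (ZMod p)) (ρ : ℝ) (x : ZMod p), Γ.card ≤ d ∧ 0 < ρ ∧
    ((bohr Γ (ρ + κ)).card : ℝ) ≤ (1 + c) * (bohr Γ ρ).card ∧
    α * (bohr Γ ρ).card ≤ ((bohr Γ ρ).filter (fun b => x + b ∈ A)).card

lemma N3_lower (A A1 A2 : Finset (ZMod p)) (y : ZMod p) (h1 : ∀ a ∈ A1, y + a ∈ A)
    (h2 : ∀ a ∈ A2, y + a ∈ A) (hA1 : 0 < A1.card) :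
    A1.card * ∑ b ∈ A2, psi A1 b ≤ N3 A := by
  have hA1' : (0 : ℝ) < A1.card := by exact_mod_cast hA1
  have e : (A1.card : ℝ) * ∑ b ∈ A2, psi A1 b =
      ∑ b ∈ A2, ∑ a ∈ A1, (if 2 * b - a ∈ A1 then (1 : ℝ) else 0) := by
    rw [Finset.mul_sum]
    apply Finset.sum_congr rfl; intro b _
    unfold psi; rw [mul_div_cancel₀ _ hA1'.ne']
  rw [e]
  have hinj : Function.Injective (fun a : ZMod p => y + a) := add_right_injective y
  have s1 : ∑ b ∈ A2.image (fun a => y + a), ∑ a ∈ A1.image (fun a => y + a),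
      (if 2 * b - a ∈ A then (1 : ℝ) else 0) ≤ N3 A := by
    unfold N3
    have i2 : A2.image (fun a => y + a) ⊆ A := by
      intro x hx; obtain ⟨a, ha, rfl⟩ := Finset.mem_image.mp hx; exact h2 a ha
    have i1 : A1.image (fun a => y + a) ⊆ A := by
      intro x hx; obtain ⟨a, ha, rfl⟩ := Finset.mem_image.mp hx; exact h1 a ha
    refine (Finset.sum_le_sum (fun b _ => Finset.sum_le_sum_of_subset_of_nonneg i1 ?_)).trans
      (Finset.sum_le_sum_of_subset_of_nonneg i2 ?_)
    · intro a _ _; split_ifs <;> norm_num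
    · intro b _ _; positivity
  refine le_trans ?_ s1
  rw [Finset.sum_image (fun a _ b _ h => hinj h)]
  apply Finset.sum_le_sum; intro b _
  rw [Finset.sum_image (fun a _ b _ h => hinj h)]
  apply Finset.sum_le_sum; intro a _
  by_cases h : 2 * b - a ∈ A1
  · have e : 2 * (y + b) - (y + a) = y + (2 * b - a) := by ring
    rw [if_pos h, if_pos (by rw [e]; exact h1 _ h)]
  · rw [if_neg h]; split_ifs <;> norm_num

lemma step (hp2 : (2 : ZMod p) ≠ 0) (A : Finset (ZMod p)) (α0 c0 α : ℝ) (l k m n d : ℕ)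
    (κ κ5 : ℝ) (hα0 : 0 < α0) (hα : α0 ≤ α) (hc0 : c0 = α0 / 1000)
    (hl : 0 < l) (hk : 0 < k) (hm0 : 0 < m) (hn0 : 0 < n) (h4l : 20 ≤ α0 * 4 ^ l)
    (hη : 4 * Real.exp (-(k * (1 / (64 * (l : ℝ))) ^ 2 * α0)) ≤ α0 ^ 2 / (220 * l))
    (hm : 4 / ((1 / 2) * (α0 / 4) ^ k) < Real.exp (m / 32))
    (hκ0 : 0 < κ) (hκ1 : κ ≤ 1)
    (hκ5 : κ5 = κ * c0 / (2048 * l * m ^ 2 * n ^ 5))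
    (hbig : (16 / κ5) ^ (d + m) < (1 + c0) ^ n)
    (hst : St A c0 d κ α) :
    St A c0 (d + m) κ5 (1.1 * α) ∨ α0 ^ 3 / 8 * ((κ5 / 8) ^ d * p) ^ 2 ≤ N3 A := by
  obtain ⟨Γ, ρ, x, hΓ, hρ, hreg, hdens⟩ := hst
  have hl' : (1 : ℝ) ≤ l := by exact_mod_cast hl
  have hm' : (1 : ℝ) ≤ m := by exact_mod_cast hm0
  have hn' : (1 : ℝ) ≤ n := by exact_mod_cast hn0
  have hαpos : 0 < α := by linarith
  have hBpos : (0 : ℝ) < (bohr Γ ρ).card := bohr_card_pos hρ.le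
  have hα1 : α ≤ 1 := by
    have : (((bohr Γ ρ).filter (fun b => x + b ∈ A)).card : ℝ) ≤ (bohr Γ ρ).card := by
      exact_mod_cast Finset.card_filter_le _ _
    refine le_of_mul_le_mul_right ?_ hBpos
    linarith
  have hc0pos : 0 < c0 := by rw [hc0]; positivity
  have hc01 : c0 ≤ 1 / 1000 := by rw [hc0]; linarith
  set r' := κ / 2 with hr'
  set κ' := r' / (2 * n) with hκ'
  set r'' := κ' / 8 with hr''
  set κ'' := r'' / (2 * n) with hκ''
  have hr'pos : 0 < r' := by rw [hr']; positivity
  have hκ'pos : 0 < κ' := by rw [hκ']; positivity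
  have hr''pos : 0 < r'' := by rw [hr'']; positivity
  have hκ''pos : 0 < κ'' := by rw [hκ'']; positivity
  have e5 : κ5 = κ'' * c0 / (32 * l * m ^ 2 * n ^ 3) := by
    rw [hκ5, hκ'', hr'', hκ', hr']; field_simp; norm_num
  have hκ5pos : 0 < κ5 := by rw [e5]; positivity
  have i1 : κ' ≤ r' / 2 := by
    rw [hκ']; apply div_le_div_of_nonneg_left hr'pos.le (by norm_num); linarith
  have i2 : κ'' ≤ r'' / 2 := by
    rw [hκ'']; apply div_le_div_of_nonneg_left hr''pos.le (by norm_num); linarith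
  have i3 : κ5 ≤ κ'' := by
    have hD : (1 : ℝ) ≤ 32 * l * m ^ 2 * n ^ 3 := by
      have h1 : (1 : ℝ) ≤ (m : ℝ) ^ 2 := one_le_pow₀ hm'
      have h2 : (1 : ℝ) ≤ (n : ℝ) ^ 3 := one_le_pow₀ hn'
      have h3 : (1 : ℝ) ≤ 32 * l := by linarith
      exact one_le_mul_of_one_le_of_one_le (one_le_mul_of_one_le_of_one_le h3 h1) h2
    rw [e5, div_le_iff₀ (by positivity)]
    apply mul_le_mul_of_nonneg_left _ hκ''pos.le
    linarith
  obtain ⟨ρ', hρ'1, hρ'2, hreg'⟩ := reg_of Γ r' c0 κ5 hκ5pos (by linarith) (by linarith) hc0pos d n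
    (d + m) hn0 hΓ (by omega) hbig
  rw [← hκ'] at hreg'
  obtain ⟨ρ'', hρ''1, hρ''2, hreg''⟩ := reg_of Γ r'' c0 κ5 hκ5pos (by linarith) (by linarith) hc0pos d n
    (d + m) hn0 hΓ (by omega) hbig
  rw [← hκ''] at hreg''
  have hρ'pos : 0 < ρ' := by linarith
  have hρ''pos : 0 < ρ'' := by linarith
  by_contra hcon
  push Not at hcon
  obtain ⟨hnoinc, hN3⟩ := hcon
  have hB'pos : (0 : ℝ) < (bohr Γ ρ').card := bohr_card_pos hρ'pos.le
  have hB''pos : (0 : ℝ) < (bohr Γ ρ'').card := bohr_card_pos hρ''pos.le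
  have hd' : ∀ y, (((bohr Γ ρ').filter (fun b => y + b ∈ A)).card : ℝ) < 1.1 * α * (bohr Γ ρ').card := by
    intro y
    by_contra h
    push Not at h
    refine hnoinc ⟨Γ, ρ', y, by omega, hρ'pos, le_trans ?_ hreg', h⟩
    exact_mod_cast Finset.card_le_card (bohr_mono (by linarith))
  have hd'' : ∀ y, (((bohr Γ ρ'').filter (fun b => y + b ∈ A)).card : ℝ) < 1.1 * α * (bohr Γ ρ'').card := by
    intro y
    by_contra h
    push Not at h
    refine hnoinc ⟨Γ, ρ'', y, by omega, hρ''pos, le_trans ?_ hreg'', h⟩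
    exact_mod_cast Finset.card_le_card (bohr_mono (by linarith))
  have s1 := shift_dens A Γ (bohr Γ ρ') ρ κ c0 hκ0.le hreg (bohr_mono (by linarith)) x
  have s2 := shift_dens A Γ (bohr Γ ρ'') ρ κ c0 hκ0.le hreg (bohr_mono (by linarith)) x
  obtain ⟨b, hb, hbd⟩ : ∃ b ∈ bohr Γ ρ, 2 * (α - c0) ≤
      (((bohr Γ ρ').filter (fun t => x + b + t ∈ A)).card : ℝ) / (bohr Γ ρ').card +
      (((bohr Γ ρ'').filter (fun t => x + b + t ∈ A)).card : ℝ) / (bohr Γ ρ'').card := by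
    apply Finset.exists_le_of_sum_le (f := fun _ => 2 * (α - c0)) ⟨0, bohr_zero hρ.le⟩
    rw [Finset.sum_add_distrib, ← Finset.sum_div, ← Finset.sum_div, Finset.sum_const, nsmul_eq_mul]
    have t1 : (α - c0) * (bohr Γ ρ).card ≤ (∑ b ∈ bohr Γ ρ,
      (((bohr Γ ρ').filter (fun t => x + b + t ∈ A)).card : ℝ)) / (bohr Γ ρ').card := by
      rw [le_div_iff₀ hB'pos]
      refine le_trans ?_ s1
      rw [mul_comm]
      apply mul_le_mul_of_nonneg_left _ hB'pos.le
      linarith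
    have t2 : (α - c0) * (bohr Γ ρ).card ≤ (∑ b ∈ bohr Γ ρ,
      (((bohr Γ ρ'').filter (fun t => x + b + t ∈ A)).card : ℝ)) / (bohr Γ ρ'').card := by
      rw [le_div_iff₀ hB''pos]
      refine le_trans ?_ s2
      rw [mul_comm]
      apply mul_le_mul_of_nonneg_left _ hB''pos.le
      linarith
    linarith
  set y := x + b with hy
  set A1 := (bohr Γ ρ').filter (fun t => y + t ∈ A) with hA1
  set A2 := (bohr Γ ρ'').filter (fun t => y + t ∈ A) with hA2
  have q1 : (A1.card : ℝ) / (bohr Γ ρ').card ≤ 1.1 * α := by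
    rw [div_le_iff₀ hB'pos]; exact (hd' y).le
  have q2 : (A2.card : ℝ) / (bohr Γ ρ'').card ≤ 1.1 * α := by
    rw [div_le_iff₀ hB''pos]; exact (hd'' y).le
  have q3 : 0.89 * α * (bohr Γ ρ').card ≤ A1.card := by
    rw [← le_div_iff₀ hB'pos]; linarith
  have q4 : 0.89 * α * (bohr Γ ρ'').card ≤ A2.card := by
    rw [← le_div_iff₀ hB''pos]; linarith
  have hA1pos' : (0 : ℝ) < A1.card := lt_of_lt_of_le (by positivity) q3
  have hA1pos : 0 < A1.card := by exact_mod_cast hA1pos'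
  have hA2pos' : (0 : ℝ) < A2.card := lt_of_lt_of_le (by positivity) q4
  by_cases hψ : ∑ b ∈ A2, psi A1 b ≤ α / 4 * A2.card
  · obtain ⟨Γ', ρ5, z, hΓ', hρ5, hρ51, hreg5, hinc⟩ := core A1 A2 Γ α0 c0 α l k m n d ρ' κ' ρ'' κ'' κ5 hα0 hα hα1
      hc0 hl hk hm0 hn0 h4l hη hm hΓ (Finset.filter_subset _ _) (Finset.filter_subset _ _) hreg' hreg''
      hρ'pos hρ''pos hκ''pos (by linarith) (by linarith) (by linarith) q3 q4 hψ e5 hbig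
    apply hnoinc
    refine ⟨Γ'.image (fun γ => γ / 2), ρ5, y + z, Finset.card_image_le.trans hΓ', by linarith, ?_, ?_⟩
    · rw [bohr_half_card hp2, bohr_half_card hp2]; exact hreg5
    · rw [bohr_half_card hp2]
      refine hinc.trans ?_
      have : ((bohr Γ' ρ5).filter (fun t => z + 2 * t ∈ A1)).card ≤
        ((bohr (Γ'.image (fun γ => γ / 2)) ρ5).filter (fun b => y + z + b ∈ A)).card := by
        apply Finset.card_le_card_of_injOn (fun t => 2 * t)
        · intro t ht
          have ht' := Finset.mem_filter.mp (Finset.mem_coe.mp ht)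
          apply Finset.mem_coe.mpr
          apply Finset.mem_filter.mpr
          refine ⟨?_, ?_⟩
          · rw [bohr_half hp2]; exact Finset.mem_image_of_mem _ ht'.1
          · have := (Finset.mem_filter.mp ht'.2).2
            rwa [← add_assoc] at this
        · intro a _ b _ h
          exact mul_left_cancel₀ hp2 h
      exact_mod_cast this
  · push Not at hψ
    have hl := N3_lower A A1 A2 y (fun a ha => (Finset.mem_filter.mp ha).2)
      (fun a ha => (Finset.mem_filter.mp ha).2) hA1pos
    have hp : (0 : ℝ) < p := by exact_mod_cast (Fact.out : p.Prime).pos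
    set V := (κ5 / 8) ^ d * (p : ℝ) with hV
    have hVpos : 0 < V := by rw [hV]; positivity
    have c1 : V ≤ (bohr Γ ρ').card := by
      refine le_trans ?_ (bohr_card Γ ρ' hρ'pos (by linarith) d hΓ)
      rw [hV]; gcongr; linarith
    have c2 : V ≤ (bohr Γ ρ'').card := by
      refine le_trans ?_ (bohr_card Γ ρ'' hρ''pos (by linarith) d hΓ)
      rw [hV]; gcongr; linarith
    have a1 : 0.89 * α0 * V ≤ A1.card := le_trans (by gcongr) q3
    have a2 : 0.89 * α0 * V ≤ A2.card := le_trans (by gcongr) q4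
    have : α0 ^ 3 / 8 * V ^ 2 ≤ N3 A := by
      calc α0 ^ 3 / 8 * V ^ 2 ≤ (0.89 * α0 * V) * (α0 / 4 * (0.89 * α0 * V)) := by
            have : 0 ≤ α0 ^ 3 * V ^ 2 := by positivity
            linarith
        _ ≤ A1.card * (α / 4 * A2.card) := by gcongr
        _ ≤ A1.card * ∑ b ∈ A2, psi A1 b := by gcongr
        _ ≤ _ := hl
    linarith

end
end Roth

namespace Roth

open Finset

section
variable {p : ℕ} [Fact p.Prime]

lemma St_le_one (A : Finset (ZMod p)) (c : ℝ) (d : ℕ) (κ α : ℝ) (h : St A c d κ α) : α ≤ 1 := by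
  obtain ⟨Γ, ρ, x, _, h0, _, h2⟩ := h
  have hp := bohr_card_pos (Γ := Γ) h0.le
  have : (((bohr Γ ρ).filter (fun b => x + b ∈ A)).card : ℝ) ≤ (bohr Γ ρ).card := by
    exact_mod_cast Finset.card_filter_le _ _
  by_contra hc
  push Not at hc
  have := mul_lt_mul_of_pos_right hc hp
  linarith

lemma St_start (A : Finset (ZMod p)) (c α : ℝ) (hc : 0 ≤ c) (h : α * p ≤ A.card) :
    St A c 0 1 α := by
  have hb : ∀ ρ : ℝ, bohr (∅ : Finset (ZMod p)) ρ = univ := by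
    intro ρ; ext x; simp [mem_bohr]
  refine ⟨∅, 1, 0, by simp, one_pos, ?_, ?_⟩
  · rw [hb, hb]
    have : (0 : ℝ) ≤ c * (univ : Finset (ZMod p)).card := by positivity
    linarith
  · rw [hb]
    have e : (univ.filter (fun b : ZMod p => 0 + b ∈ A)) = A := by ext x; simp
    rw [e]
    simpa [ZMod.card] using h

lemma iterate (hp2 : (2 : ZMod p) ≠ 0) (A : Finset (ZMod p)) (α0 c0 ϑ : ℝ) (l k m n J : ℕ)
    (hα0 : 0 < α0) (hc0 : c0 = α0 / 1000)
    (hl : 0 < l) (hk : 0 < k) (hm0 : 0 < m) (hn0 : 0 < n) (h4l : 20 ≤ α0 * 4 ^ l)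
    (hη : 4 * Real.exp (-(k * (1 / (64 * (l : ℝ))) ^ 2 * α0)) ≤ α0 ^ 2 / (220 * l))
    (hm : 4 / ((1 / 2) * (α0 / 4) ^ k) < Real.exp (m / 32))
    (hϑ : ϑ = c0 / (2048 * l * m ^ 2 * n ^ 5)) (hϑ1 : ϑ ≤ 1)
    (hbig : (16 / ϑ ^ J) ^ (J * m) < (1 + c0) ^ n)
    (hJ : 1 < 1.1 ^ J * α0)
    (hA : α0 * p ≤ A.card) :
    α0 ^ 3 / 8 * ((ϑ ^ J / 8) ^ (J * m) * p) ^ 2 ≤ N3 A := by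
  by_contra hcon
  have hc0' : 0 < c0 := by rw [hc0]; positivity
  have hϑ0 : 0 < ϑ := by rw [hϑ]; positivity
  have key : ∀ j : ℕ, j ≤ J → St A c0 (j * m) (ϑ ^ j) (1.1 ^ j * α0) := by
    intro j
    induction j with
    | zero => intro _; simpa using St_start A c0 α0 hc0'.le hA
    | succ j ih =>
      intro hj
      have hs := ih (by omega)
      have hpow : ϑ ^ J ≤ ϑ ^ (j + 1) := pow_le_pow_of_le_one hϑ0.le hϑ1 hj
      have hJp : 0 < ϑ ^ J := pow_pos hϑ0 J
      have hjp : 0 < ϑ ^ (j+1) := pow_pos hϑ0 _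
      have hj1 : ϑ ^ (j+1) ≤ 1 := pow_le_one₀ hϑ0.le hϑ1
      have h1 : (1 : ℝ) ≤ 1.1 ^ j := one_le_pow₀ (by norm_num)
      have hst := step hp2 A α0 c0 (1.1 ^ j * α0) l k m n (j * m) (ϑ ^ j) (ϑ ^ (j + 1)) hα0
        (by nlinarith) hc0 hl hk hm0 hn0 h4l hη hm (pow_pos hϑ0 _) (pow_le_one₀ hϑ0.le hϑ1)
        (by rw [pow_succ, hϑ]; ring)
        (by
          refine lt_of_le_of_lt ?_ hbig
          have e : j * m + m = (j + 1) * m := by ring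
          rw [e]
          have hle : (j + 1) * m ≤ J * m := Nat.mul_le_mul_right _ hj
          have b1 : (1 : ℝ) ≤ 16 / ϑ ^ (j + 1) := by
            rw [le_div_iff₀ hjp]; linarith
          calc (16 / ϑ ^ (j + 1)) ^ ((j + 1) * m) ≤ (16 / ϑ ^ (j + 1)) ^ (J * m) :=
                pow_le_pow_right₀ b1 hle
            _ ≤ (16 / ϑ ^ J) ^ (J * m) := by gcongr)
        hs
      rcases hst with h | h
      · have e1 : (j + 1) * m = j * m + m := by ring
        have e2 : (1.1 : ℝ) ^ (j + 1) * α0 = 1.1 * (1.1 ^ j * α0) := by ring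
        rw [e1, e2]; exact h
      · exfalso; apply hcon
        refine le_trans ?_ h
        have hle : j * m ≤ J * m := Nat.mul_le_mul_right _ (by omega)
        have b2 : (ϑ ^ J / 8) ^ (J * m) ≤ (ϑ ^ (j + 1) / 8) ^ (j * m) := by
          calc (ϑ ^ J / 8) ^ (J * m) ≤ (ϑ ^ (j + 1) / 8) ^ (J * m) := by gcongr
            _ ≤ (ϑ ^ (j + 1) / 8) ^ (j * m) :=
              pow_le_pow_of_le_one (by positivity) (by linarith) hle
        gcongr
  have := St_le_one _ _ _ _ _ (key J le_rfl)
  linarith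

set_option maxHeartbeats 2000000 in
lemma params (s y : ℝ) (hs : 10 ^ 6 ≤ s) (hy : y = Real.exp (s / 3)) (hsy : 10 ^ 10 * s ^ 10 ≤ y) :
    ∃ (l k m n J : ℕ) (ϑ : ℝ), 0 < l ∧ 0 < k ∧ 0 < m ∧ 0 < n ∧ 20 ≤ (1 / y ^ 2) * 4 ^ l ∧
      4 * Real.exp (-(k * (1 / (64 * (l : ℝ))) ^ 2 * (1 / y ^ 2))) ≤ (1 / y ^ 2) ^ 2 / (220 * l) ∧
      4 / ((1 / 2) * ((1 / y ^ 2) / 4) ^ k) < Real.exp (m / 32) ∧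
      ϑ = (1 / y ^ 2 / 1000) / (2048 * l * m ^ 2 * n ^ 5) ∧ ϑ ≤ 1 ∧
      (16 / ϑ ^ J) ^ (J * m) < (1 + 1 / y ^ 2 / 1000) ^ n ∧
      1 < 1.1 ^ J * (1 / y ^ 2) ∧
      Real.exp (1.9 * y ^ 3) ≤ (1 / y ^ 2) ^ 3 / 8 * ((ϑ ^ J / 8) ^ (J * m) * Real.exp (y ^ 3)) ^ 2 := by
  have hs0 : 0 < s := by linarith
  have hs1 : 1 ≤ s := by linarith
  have hy0 : 0 < y := by rw [hy]; positivity
  have p1 : s ≤ s ^ 10 := le_self_pow₀ hs1 (by norm_num)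
  have p7 : s ^ 7 ≤ s ^ 10 := pow_le_pow_right₀ hs1 (by norm_num)
  have p6 : s ^ 6 ≤ s ^ 10 := pow_le_pow_right₀ hs1 (by norm_num)
  have p9 : s ^ 9 ≤ s ^ 10 := pow_le_pow_right₀ hs1 (by norm_num)
  have p4 : s ^ 4 ≤ s ^ 10 := pow_le_pow_right₀ hs1 (by norm_num)
  have hy1 : 10 ^ 16 ≤ y := by linarith
  have hy1' : 1 ≤ y := by linarith
  have hyk : ∀ k : ℕ, y ^ k = Real.exp (k * (s / 3)) := by
    intro k; rw [hy, ← Real.exp_nat_mul]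
  have hlogy : Real.log y = s / 3 := by rw [hy, Real.log_exp]
  set l := ⌈s⌉₊ with hl
  have l1 : s ≤ l := Nat.le_ceil s
  have l2 : (l : ℝ) ≤ 2 * s := by have := (Nat.ceil_lt_add_one hs0.le).le; linarith
  set k := ⌈y ^ 2 * s ^ 4⌉₊ with hk
  have k0 : 1 ≤ y ^ 2 * s ^ 4 := one_le_mul_of_one_le_of_one_le (one_le_pow₀ hy1') (one_le_pow₀ hs1)
  have k1 : y ^ 2 * s ^ 4 ≤ k := Nat.le_ceil _
  have k2 : (k : ℝ) ≤ 2 * (y ^ 2 * s ^ 4) := by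
    have := (Nat.ceil_lt_add_one (le_trans zero_le_one k0)).le; linarith
  set m := ⌈y ^ 2 * s ^ 6⌉₊ with hm
  have m0 : 1 ≤ y ^ 2 * s ^ 6 := one_le_mul_of_one_le_of_one_le (one_le_pow₀ hy1') (one_le_pow₀ hs1)
  have m1 : y ^ 2 * s ^ 6 ≤ m := Nat.le_ceil _
  have m2 : (m : ℝ) ≤ 2 * (y ^ 2 * s ^ 6) := by
    have := (Nat.ceil_lt_add_one (le_trans zero_le_one m0)).le; linarith
  set n := ⌈y ^ 12⌉₊ with hn
  have n0 : 1 ≤ y ^ 12 := one_le_pow₀ hy1'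
  have n1 : y ^ 12 ≤ n := Nat.le_ceil _
  have n2 : (n : ℝ) ≤ 2 * y ^ 12 := by
    have := (Nat.ceil_lt_add_one (le_trans zero_le_one n0)).le; linarith
  set ϑ := (1 / y ^ 2 / 1000) / (2048 * l * m ^ 2 * n ^ 5) with hϑ
  have ly : (l : ℝ) ≤ y := by linarith
  have my : (m : ℝ) ≤ y ^ 3 := by
    have : y ^ 2 * (2 * s ^ 6) ≤ y ^ 2 * y := by
      apply mul_le_mul_of_nonneg_left _ (by positivity); linarith
    linarith
  have ny : (n : ℝ) ≤ y ^ 13 := by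
    have : y ^ 12 * 2 ≤ y ^ 12 * y := by
      apply mul_le_mul_of_nonneg_left _ (by positivity); linarith
    linarith
  have lpos : (0 : ℝ) < l := by linarith
  have lpos1 : (1 : ℝ) ≤ l := by linarith
  have kpos : (0 : ℝ) < k := by linarith
  have mpos : (0 : ℝ) < m := by linarith
  have mpos1 : (1 : ℝ) ≤ m := by linarith
  have npos : (0 : ℝ) < n := by linarith
  have npos1 : (1 : ℝ) ≤ n := by linarith
  have ϑ0 : 0 < ϑ := by positivity
  have ϑlow : Real.exp (-(25 * s)) ≤ ϑ := by
    have e : Real.exp (-(25 * s)) = 1 / y ^ 75 := by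
      rw [hyk, Real.exp_neg, one_div]; congr 2; push_cast; ring
    rw [e, hϑ, div_div, div_div]
    apply one_div_le_one_div_of_le (by positivity)
    calc y ^ 2 * (1000 * (2048 * (l:ℝ) * m ^ 2 * n ^ 5))
        ≤ y ^ 2 * (1000 * (2048 * y * (y ^ 3) ^ 2 * (y ^ 13) ^ 5)) := by gcongr
      _ = y ^ 74 * 2048000 := by ring
      _ ≤ y ^ 74 * y := by apply mul_le_mul_of_nonneg_left _ (by positivity); linarith
      _ = y ^ 75 := by ring
  have ϑ1 : ϑ ≤ 1 := by
    rw [hϑ, div_div, div_div, div_le_one (by positivity)]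
    have : (1:ℝ) ≤ 2048 * l * m ^ 2 * n ^ 5 := by
      have := one_le_pow₀ mpos1 (n := 2)
      have := one_le_pow₀ npos1 (n := 5)
      apply one_le_mul_of_one_le_of_one_le _ this
      apply one_le_mul_of_one_le_of_one_le _ (by assumption)
      linarith
    apply one_le_mul_of_one_le_of_one_le (one_le_pow₀ hy1')
    linarith
  set J := 11 * l with hJ
  have hJr : (J : ℝ) = 11 * l := by rw [hJ]; push_cast; ring
  have ϑJ : Real.exp (-(550 * s ^ 2)) ≤ ϑ ^ J := by
    calc Real.exp (-(550 * s ^ 2)) ≤ Real.exp (J * (-(25 * s))) := by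
          apply Real.exp_le_exp.mpr
          rw [hJr]
          have := mul_le_mul_of_nonneg_right l2 hs0.le
          linarith
      _ = (Real.exp (-(25 * s))) ^ J := by rw [Real.exp_nat_mul]
      _ ≤ ϑ ^ J := by gcongr
  have ϑJ0 : 0 < ϑ ^ J := by positivity
  have s2b : 10 ^ 6 * s ≤ s ^ 2 := by rw [sq]; exact mul_le_mul_of_nonneg_right hs hs0.le
  have s2big : 3 ≤ s ^ 2 := by linarith
  have h16 : (16 : ℝ) ≤ Real.exp (s ^ 2) := by
    have := Real.add_one_le_exp (s ^ 2); linarith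
  have hx16 : 16 / ϑ ^ J ≤ Real.exp (551 * s ^ 2) := by
    rw [div_le_iff₀ ϑJ0]
    calc (16 : ℝ) ≤ Real.exp (s ^ 2) := h16
      _ = Real.exp (551 * s ^ 2) * Real.exp (-(550 * s ^ 2)) := by rw [← Real.exp_add]; ring_nf
      _ ≤ _ := by gcongr
  have hx8 : Real.exp (-(551 * s ^ 2)) ≤ ϑ ^ J / 8 := by
    rw [le_div_iff₀ (by norm_num)]
    calc Real.exp (-(551 * s ^ 2)) * 8 ≤ Real.exp (-(551 * s ^ 2)) * Real.exp (s ^ 2) := by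
          gcongr; linarith
      _ = Real.exp (-(550 * s ^ 2)) := by rw [← Real.exp_add]; ring_nf
      _ ≤ _ := ϑJ
  have hJm : ((J * m : ℕ) : ℝ) * (551 * s ^ 2) ≤ y ^ 3 / 10 ^ 5 := by
    push_cast
    rw [hJr]
    calc 11 * (l:ℝ) * m * (551 * s ^ 2) ≤ 11 * (2 * s) * (2 * (y ^ 2 * s ^ 6)) * (551 * s ^ 2) := by
          gcongr
      _ = y ^ 2 * (24244 * s ^ 9) := by ring
      _ ≤ y ^ 2 * (y / 10 ^ 5) := by
          apply mul_le_mul_of_nonneg_left _ (by positivity); linarith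
      _ = y ^ 3 / 10 ^ 5 := by ring
  have expl : Real.exp s = y ^ 3 := by rw [hyk]; congr 1; push_cast; ring
  have e1 : Real.exp 1 < 2.7182818286 := Real.exp_one_lt_d9
  have y3l : y ^ 3 ≤ (Real.exp 1) ^ l := by
    rw [← expl, ← Real.exp_nat_mul]; apply Real.exp_le_exp.mpr; linarith
  have y23 : y ^ 3 = y ^ 2 * y := by ring
  have hy2pos : 0 < y ^ 2 := by positivity
  refine ⟨l, k, m, n, J, ϑ, by exact_mod_cast lpos, by exact_mod_cast kpos, by exact_mod_cast mpos,
    by exact_mod_cast npos, ?_, ?_, ?_, rfl, ϑ1, ?_, ?_, ?_⟩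
  · have : (Real.exp 1) ^ l ≤ 4 ^ l := pow_le_pow_left₀ (Real.exp_pos 1).le (by linarith) l
    rw [one_div, inv_mul_eq_div, le_div_iff₀ hy2pos]
    have := mul_le_mul_of_nonneg_left hy1 hy2pos.le
    linarith
  · have hE : 3 * s ≤ k * (1 / (64 * (l : ℝ))) ^ 2 * (1 / y ^ 2) := by
      have : s ^ 4 ≤ k * (1 / y ^ 2) := by
        rw [mul_one_div, le_div_iff₀ hy2pos]; linarith
      calc 3 * s ≤ s ^ 2 / 16384 := by
            rw [le_div_iff₀ (by norm_num)]; linarith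
        _ = s ^ 4 * (1 / (64 * (2 * s))) ^ 2 := by field_simp; norm_num
        _ ≤ (k * (1 / y ^ 2)) * (1 / (64 * (l:ℝ))) ^ 2 := by gcongr
        _ = _ := by ring
    calc 4 * Real.exp (-(k * (1 / (64 * (l : ℝ))) ^ 2 * (1 / y ^ 2))) ≤ 4 * Real.exp (-(3 * s)) := by
          gcongr
      _ = 4 / y ^ 9 := by
          rw [hyk, Real.exp_neg, div_eq_mul_inv]; congr 3; push_cast; ring
      _ ≤ (1 / y ^ 2) ^ 2 / (220 * y) := by
          rw [div_pow, div_div, div_le_div_iff₀ (by positivity) (by positivity)]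
          have : y ^ 5 * 880 ≤ y ^ 5 * y ^ 4 := by
            apply mul_le_mul_of_nonneg_left _ (by positivity)
            have : y ≤ y ^ 4 := le_self_pow₀ hy1' (by norm_num)
            linarith
          linarith
      _ ≤ _ := by gcongr
  · have h4 : (4 : ℝ) ≤ y := by linarith
    have b : 4 / ((1 / 2) * ((1 / y ^ 2) / 4) ^ k) = 8 * (4 * y ^ 2) ^ k := by
      have e5 : (1 / y ^ 2) / 4 = (4 * y ^ 2)⁻¹ := by rw [div_div, one_div, mul_comm]
      have hpp : 0 < (4 * y ^ 2) ^ k := by positivity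
      rw [e5, inv_pow]
      generalize (4 * y ^ 2) ^ k = w at hpp
      field_simp; norm_num
    rw [b]
    have c1 : (8 : ℝ) ≤ Real.exp s := by rw [expl]; have := le_self_pow₀ hy1' (show 3 ≠ 0 by norm_num); linarith
    calc 8 * (4 * y ^ 2) ^ k ≤ Real.exp s * (Real.exp s) ^ k := by
          gcongr
          rw [expl]; have := mul_le_mul_of_nonneg_right h4 hy2pos.le; linarith
      _ = Real.exp (s + k * s) := by rw [← Real.exp_nat_mul, ← Real.exp_add]
      _ < Real.exp (m / 32) := by
          apply Real.exp_lt_exp.mpr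
          rw [lt_div_iff₀ (by norm_num)]
          have q1 : (k:ℝ) * s ≤ 2 * (y ^ 2 * s ^ 4) * s := by gcongr
          have q2 : s ≤ (y ^ 2 * s ^ 4) * s := le_mul_of_one_le_left hs0.le k0
          have q3 : (y ^ 2 * s ^ 5) * 97 ≤ (y ^ 2 * s ^ 5) * s := by
            apply mul_le_mul_of_nonneg_left _ (by positivity); linarith
          have q4 : 0 < y ^ 2 * s ^ 5 := by positivity
          linarith
  · calc (16 / ϑ ^ J) ^ (J * m) ≤ (Real.exp (551 * s ^ 2)) ^ (J * m) := by gcongr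
      _ = Real.exp (((J * m : ℕ) : ℝ) * (551 * s ^ 2)) := by rw [← Real.exp_nat_mul]
      _ ≤ Real.exp (y ^ 3 / 10 ^ 5) := Real.exp_le_exp.mpr hJm
      _ < Real.exp (n * (1 / y ^ 2 / 2000)) := by
          apply Real.exp_lt_exp.mpr
          have : y ^ 10 ≤ n * (1 / y ^ 2) := by
            rw [mul_one_div, le_div_iff₀ hy2pos]; linarith
          have : y ^ 3 < y ^ 10 := pow_lt_pow_right₀ (by linarith) (by norm_num)
          have : 0 < y ^ 3 := by positivity
          have : (n:ℝ) * (1 / y ^ 2 / 2000) = n * (1 / y ^ 2) / 2000 := by ring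
          have : y ^ 3 / 10 ^ 5 < y ^ 10 / 2000 := by linarith
          linarith
      _ = (Real.exp (1 / y ^ 2 / 2000)) ^ n := by rw [← Real.exp_nat_mul]
      _ ≤ (1 + 1 / y ^ 2 / 1000) ^ n := by
          gcongr
          set z := 1 / y ^ 2 / 2000 with hz
          have z0 : 0 ≤ z := by positivity
          have z1 : z ≤ 1 / 2 := by
            rw [hz, div_div, div_le_iff₀ (by positivity)]
            have := one_le_pow₀ hy1' (n := 2)
            linarith
          have e2 : 1 / y ^ 2 / 1000 = 2 * z := by rw [hz]; ring
          rw [e2]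
          have := Real.one_sub_le_exp_neg z
          rw [Real.exp_neg] at this
          have hp : 0 < 1 - z := by linarith
          have h3 : Real.exp z ≤ (1 - z)⁻¹ := by
            rw [le_inv_comm₀ (Real.exp_pos _) hp]; exact this
          refine h3.trans ?_
          rw [inv_le_iff_one_le_mul₀ hp]
          have := mul_nonneg z0 (sub_nonneg.mpr z1)
          linarith
  · have : (Real.exp 1) ^ l ≤ (1.1 ^ 11) ^ l := pow_le_pow_left₀ (Real.exp_pos 1).le
      (le_trans e1.le (by norm_num)) l
    rw [hJ, pow_mul, mul_one_div, lt_div_iff₀ hy2pos]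
    have := mul_le_mul_of_nonneg_left hy1 hy2pos.le
    linarith
  · have g1 : Real.exp (-(y ^ 3 / 10 ^ 5)) ≤ (ϑ ^ J / 8) ^ (J * m) := by
      calc Real.exp (-(y ^ 3 / 10 ^ 5)) ≤ Real.exp (((J * m : ℕ) : ℝ) * (-(551 * s ^ 2))) := by
            apply Real.exp_le_exp.mpr; linarith
        _ = (Real.exp (-(551 * s ^ 2))) ^ (J * m) := by rw [← Real.exp_nat_mul]
        _ ≤ _ := by gcongr
    have g2 : Real.exp (-(3 * s)) ≤ (1 / y ^ 2) ^ 3 / 8 := by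
      have e : Real.exp (-(3 * s)) = 1 / y ^ 9 := by
        rw [hyk, Real.exp_neg, one_div]; congr 2; push_cast; ring
      have e6 : (1 / y ^ 2) ^ 3 / 8 = 1 / (y ^ 6 * 8) := by
        rw [div_pow, ← pow_mul, one_pow, div_div]
      rw [e, e6]
      apply one_div_le_one_div_of_le (by positivity)
      have : y ^ 6 * 8 ≤ y ^ 6 * y ^ 3 := by
        apply mul_le_mul_of_nonneg_left _ (by positivity)
        have : y ≤ y ^ 3 := le_self_pow₀ hy1' (by norm_num)
        linarith
      linarith
    calc Real.exp (1.9 * y ^ 3)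
        ≤ Real.exp (-(3 * s)) * (Real.exp (-(y ^ 3 / 10 ^ 5)) * Real.exp (y ^ 3)) ^ 2 := by
          rw [← Real.exp_add, ← Real.exp_nat_mul, ← Real.exp_add]
          apply Real.exp_le_exp.mpr
          have : y ≤ y ^ 3 := le_self_pow₀ hy1' (by norm_num)
          push_cast
          linarith
      _ ≤ _ := by gcongr

lemma evl : ∃ L0 : ℝ, 2 ≤ L0 ∧ ∀ L : ℝ, L0 ≤ L → 10 ^ 6 ≤ Real.log L ∧
    10 ^ 10 * (Real.log L) ^ 10 ≤ Real.exp (Real.log L / 3) := by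
  have h1 : ∀ᶠ s : ℝ in Filter.atTop, 10 ^ 10 * s ^ 10 ≤ Real.exp (s / 3) := by
    have := (isLittleO_pow_exp_pos_mul_atTop (k := 10) (b := 1/3) (by norm_num)).bound
      (c := 1 / 10 ^ 10) (by norm_num)
    filter_upwards [this, Filter.eventually_ge_atTop 0] with s h h0
    rw [Real.norm_of_nonneg (by positivity), Real.norm_of_nonneg (by positivity)] at h
    have e : s / 3 = 1 / 3 * s := by ring
    rw [e]; linarith
  have h2 := Real.tendsto_log_atTop.eventually (h1.and (Filter.eventually_ge_atTop (10 ^ 6 : ℝ)))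
  obtain ⟨L0, hL0⟩ := Filter.eventually_atTop.mp h2
  exact ⟨max 2 L0, le_max_left _ _, fun L hL => ⟨(hL0 L (le_trans (le_max_right _ _) hL)).2,
    (hL0 L (le_trans (le_max_right _ _) hL)).1⟩⟩

end

/-- counting form of the Roth theorem -/
theorem roth_count : ∃ P0 : ℝ, 2 ≤ P0 ∧ ∀ (p : ℕ) [Fact p.Prime], Odd p → P0 ≤ Real.log p →
    ∀ Z : Finset (ZMod p), (Real.log p) ^ (-(2:ℝ)/3) * p ≤ Z.card →
      Real.exp (1.9 * Real.log p) ≤ N3 Z := by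
  obtain ⟨L0, h2, hL⟩ := evl
  refine ⟨L0, h2, ?_⟩
  intro p _ hodd hp Z hZ
  obtain ⟨a, b⟩ := hL _ hp
  set L := Real.log p with hLdef
  have hLpos : 0 < L := by linarith
  have hp0 : (0:ℝ) < p := by
    have := (Fact.out : p.Prime).pos; exact_mod_cast this
  have hp2 : (2 : ZMod p) ≠ 0 := by
    intro h
    have : ((2 : ℕ) : ZMod p) = 0 := by exact_mod_cast h
    rw [ZMod.natCast_eq_zero_iff] at this
    have h3 := (Nat.prime_dvd_prime_iff_eq Fact.out Nat.prime_two).mp this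
    rw [h3] at hodd; exact absurd hodd (by decide)
  obtain ⟨l, k, m, n, J, ϑ, hl, hk, hm0, hn, h4, hη, hm, hϑ, hϑ1, hbig, hJ, hfin⟩ :=
    params (Real.log L) (Real.exp (Real.log L / 3)) a rfl b
  set y := Real.exp (Real.log L / 3) with hy
  have y3 : y ^ 3 = L := by
    rw [hy, ← Real.exp_nat_mul]
    push_cast
    rw [mul_div_cancel₀ _ (by norm_num), Real.exp_log hLpos]
  have y2 : L ^ (-(2:ℝ)/3) = 1 / y ^ 2 := by
    rw [Real.rpow_def_of_pos hLpos, hy, ← Real.exp_nat_mul, one_div, ← Real.exp_neg]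
    congr 1; push_cast; ring
  rw [y2] at hZ
  have := iterate hp2 Z (1 / y ^ 2) (1 / y ^ 2 / 1000) ϑ l k m n J (by positivity) rfl hl hk hm0 hn h4
    hη hm hϑ hϑ1 hbig hJ hZ
  rw [y3, hLdef, Real.exp_log hp0] at hfin
  exact hfin.trans this

end Roth

namespace Roth

open Finset

section
variable {ι : Type*} [Fintype ι] [DecidableEq ι]

/-- random sign -/
noncomputable def sg (b : Bool) : ℝ := if b then 1 else -1

lemma sg_sq (b : Bool) : sg b * sg b = 1 := by cases b <;> simp [sg]
lemma sg_abs (b : Bool) : |sg b| = 1 := by cases b <;> simp [sg]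
lemma sg_not (b : Bool) : sg (!b) = - sg b := by cases b <;> simp [sg]

lemma rad_base (i j : ι) : ∑ x : ι → Bool, sg (x i) * sg (x j) =
    if i = j then (2 : ℝ) ^ Fintype.card ι else 0 := by
  split_ifs with h
  · subst h
    simp [sg_sq]
  · have hinv : Function.Involutive (fun x : ι → Bool => Function.update x i (!(x i))) := by
      intro x; funext k
      by_cases hk : k = i
      · subst hk; simp
      · simp [hk]
    have e : ∑ x : ι → Bool, sg (Function.update x i (!(x i)) i) *
        sg (Function.update x i (!(x i)) j) = ∑ x : ι → Bool, sg (x i) * sg (x j) :=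
      Equiv.sum_comp (hinv.toPerm (fun x : ι → Bool => Function.update x i (!(x i))))
        (fun x : ι → Bool => sg (x i) * sg (x j))
    have e2 : ∀ x : ι → Bool, sg (Function.update x i (!(x i)) i) *
        sg (Function.update x i (!(x i)) j) = - (sg (x i) * sg (x j)) := by
      intro x
      rw [Function.update_self, Function.update_of_ne (Ne.symm h), sg_not]; ring
    simp only [e2, Finset.sum_neg_distrib] at e
    linarith

lemma rad_quad (Q : ι → ι → ℝ) : ∑ x : ι → Bool, ∑ i, ∑ j, Q i j * sg (x i) * sg (x j) =
    (2 : ℝ) ^ Fintype.card ι * ∑ i, Q i i := by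
  rw [Finset.sum_comm, Finset.mul_sum]
  apply Finset.sum_congr rfl; intro i _
  rw [Finset.sum_comm]
  simp_rw [mul_assoc, ← Finset.mul_sum, rad_base]
  simp [mul_comm]

lemma rad_orth (a b : ι → ℝ) : ∑ x : ι → Bool, (∑ i, a i * sg (x i)) * (∑ i, b i * sg (x i)) =
    (2 : ℝ) ^ Fintype.card ι * ∑ i, a i * b i := by
  rw [← rad_quad (fun i j => a i * b j)]
  apply Finset.sum_congr rfl; intro x _
  rw [Finset.sum_mul_sum]
  apply Finset.sum_congr rfl; intro i _
  apply Finset.sum_congr rfl; intro j _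
  ring

lemma rad_mgf (a : ι → ℝ) (C l : ℝ) (ha : ∀ i, |a i| ≤ C) :
    ∑ x : ι → Bool, Real.exp (l * ∑ i, a i * sg (x i)) ≤
      (2 : ℝ) ^ Fintype.card ι * Real.exp (Fintype.card ι * (l ^ 2 * C ^ 2 / 2)) := by
  have e : ∀ x : ι → Bool, Real.exp (l * ∑ i, a i * sg (x i)) =
      ∏ i, Real.exp (l * (a i * sg (x i))) := by
    intro x; rw [Finset.mul_sum, Real.exp_sum]
  simp_rw [e]
  have e2 := (Finset.prod_univ_sum (fun _ : ι => (Finset.univ : Finset Bool))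
    (fun i b => Real.exp (l * (a i * sg b))))
  rw [Fintype.piFinset_univ] at e2
  rw [← e2]
  have e3 : (2 : ℝ) ^ Fintype.card ι * Real.exp (Fintype.card ι * (l ^ 2 * C ^ 2 / 2)) =
      ∏ i : ι, (2 * Real.exp (l ^ 2 * C ^ 2 / 2)) := by
    rw [Finset.prod_const, Finset.card_univ, mul_pow, ← Real.exp_nat_mul]
  rw [e3]
  apply Finset.prod_le_prod
  · intro i _; positivity
  · intro i _
    have h1 : ∑ b : Bool, Real.exp (l * (a i * sg b)) = 2 * Real.cosh (l * a i) := by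
      simp [sg, Real.cosh_eq]; ring
    rw [h1]
    have h2 := Real.cosh_le_exp_half_sq (l * a i)
    have h3 : (l * a i) ^ 2 ≤ l ^ 2 * C ^ 2 := by
      rw [mul_pow]
      apply mul_le_mul_of_nonneg_left _ (sq_nonneg l)
      exact sq_le_sq' (by linarith [neg_le_of_abs_le (ha i)]) (le_of_abs_le (ha i))
    have h4 : Real.exp ((l * a i) ^ 2 / 2) ≤ Real.exp (l ^ 2 * C ^ 2 / 2) :=
      Real.exp_le_exp.mpr (by linarith)
    linarith

lemma rad_tail (a : ι → ℝ) (C M : ℝ) (hC : 0 < C) (hM : 0 < M) (hN : 0 < Fintype.card ι)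
    (ha : ∀ i, |a i| ≤ C) :
    ∑ x : ι → Bool, (if M < |∑ i, a i * sg (x i)| then (1 : ℝ) else 0) ≤
      (2 : ℝ) ^ Fintype.card ι * (2 * Real.exp (-(M ^ 2 / (2 * C ^ 2 * Fintype.card ι)))) := by
  have hN' : (0 : ℝ) < Fintype.card ι := by exact_mod_cast hN
  set N : ℝ := (Fintype.card ι : ℝ) with hNd
  set l : ℝ := M / (C ^ 2 * N) with hl
  have hl0 : 0 < l := by positivity
  have key : ∀ a : ι → ℝ, (∀ i, |a i| ≤ C) →
      ∑ x : ι → Bool, (if M < ∑ i, a i * sg (x i) then (1 : ℝ) else 0) ≤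
      (2 : ℝ) ^ Fintype.card ι * Real.exp (-(M ^ 2 / (2 * C ^ 2 * N))) := by
    intro a ha
    have h1 : ∑ x : ι → Bool, (if M < ∑ i, a i * sg (x i) then (1 : ℝ) else 0) ≤
        ∑ x : ι → Bool, Real.exp (-(l * M)) * Real.exp (l * ∑ i, a i * sg (x i)) := by
      apply Finset.sum_le_sum; intro x _
      rw [← Real.exp_add]
      split_ifs with h
      · apply Real.one_le_exp
        have := mul_le_mul_of_nonneg_left h.le hl0.le
        linarith
      · positivity
    refine h1.trans ?_
    rw [← Finset.mul_sum]
    have h2 := mul_le_mul_of_nonneg_left (rad_mgf a C l ha) (Real.exp_pos (-(l * M))).le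
    refine h2.trans (le_of_eq ?_)
    rw [mul_left_comm, ← Real.exp_add]
    congr 2
    rw [← hNd, hl]; field_simp; ring
  have k1 := key a ha
  have k2 := key (fun i => - a i) (fun i => by rw [abs_neg]; exact ha i)
  have : ∑ x : ι → Bool, (if M < |∑ i, a i * sg (x i)| then (1 : ℝ) else 0) ≤
      ∑ x : ι → Bool, ((if M < ∑ i, a i * sg (x i) then (1 : ℝ) else 0) +
        (if M < ∑ i, (-a i) * sg (x i) then (1 : ℝ) else 0)) := by
    apply Finset.sum_le_sum; intro x _
    have e : ∑ i, (-a i) * sg (x i) = - ∑ i, a i * sg (x i) := by simp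
    rw [e]
    by_cases h : M < |∑ i, a i * sg (x i)|
    · rw [if_pos h]
      rcases lt_abs.mp h with h | h
      · rw [if_pos h]; split_ifs <;> norm_num
      · rw [if_pos h]; split_ifs <;> norm_num
    · rw [if_neg h]; split_ifs <;> norm_num
  refine this.trans ?_
  rw [Finset.sum_add_distrib]
  linarith

lemma abs_sum_sg_le (a : ι → ℝ) (C : ℝ) (h : ∑ i, |a i| ≤ C) (x : ι → Bool) :
    |∑ i, a i * sg (x i)| ≤ C := by
  refine (Finset.abs_sum_le_sum_abs _ _).trans (le_trans (le_of_eq ?_) h)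
  apply Finset.sum_congr rfl; intro i _; rw [abs_mul, sg_abs, mul_one]

/-- the tensor inequality -/
lemma tensor (τ : ι → ι → ι → ℝ) (Q : ι → ι → ℝ) (C δ M : ℝ) (hC : 0 < C) (hδ : 0 < δ)
    (hM : 1 ≤ M) (hN : 0 < Fintype.card ι)
    (hQ : ∀ i j, |Q i j| ≤ C) (h3 : ∀ i j, ∑ k, |τ i j k| ≤ C) (h2 : ∀ i k, ∑ j, |τ i j k| ≤ C)
    (hpos : ∀ x : ι → ℝ, 0 ≤ ∑ i, ∑ j, Q i j * x i * x j)
    (H : ∀ x y z : ι → ℝ, (∀ i, |x i| ≤ δ) → (∀ i, |y i| ≤ δ) → (∀ i, |z i| ≤ δ) →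
      24 * (∑ i, ∑ j, ∑ k, τ i j k * x i * y j * z k) ≤ 8 * (∑ i, ∑ j, Q i j * z i * z j) +
        4 * (∑ i, ∑ j, Q i j * x i * x j) + 4 * (∑ i, ∑ j, Q i j * y i * y j)) :
    3 * ∑ i, ∑ j, ∑ k, τ i j k ^ 2 ≤ C ^ 3 * (Fintype.card ι : ℝ) ^ 2 / (δ * M) +
      C * Fintype.card ι * M / δ + 6 * C ^ 2 * (Fintype.card ι : ℝ) ^ 4 *
        Real.exp (-(M ^ 2 / (2 * C ^ 2 * Fintype.card ι))) := by
  have hM0 : 0 < M := by linarith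
  set N : ℝ := (Fintype.card ι : ℝ) with hNd
  have hN0 : 0 < N := by rw [hNd]; exact_mod_cast hN
  set W : ℝ := (2 : ℝ) ^ Fintype.card ι with hW
  have hW0 : 0 < W := by positivity
  let A : (ι → Bool) → ι → ι → ℝ := fun x' i k => ∑ j, τ i j k * sg (x' j)
  let q : (ι → Bool) → (ι → Bool) → ι → ℝ := fun x x' k => ∑ i, A x' i k * sg (x i)
  let PP : (ι → ℝ) → ℝ := fun x => ∑ i, ∑ j, Q i j * x i * x j
  have hA : ∀ x' i k, |A x' i k| ≤ C := fun x' i k => abs_sum_sg_le _ _ (h2 i k) x'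
  have hq : ∀ x x' k, |q x x' k| ≤ C * N := by
    intro x x' k
    apply abs_sum_sg_le
    calc ∑ i, |A x' i k| ≤ ∑ _i : ι, C := Finset.sum_le_sum (fun i _ => hA x' i k)
      _ = C * N := by simp [hNd]; ring
  have qq : ∀ x x', ∑ i, ∑ j, ∑ k, τ i j k * sg (x i) * sg (x' j) * q x x' k =
      ∑ k, q x x' k ^ 2 := by
    intro x x'
    have e : ∀ k, q x x' k ^ 2 = ∑ i, ∑ j, τ i j k * sg (x i) * sg (x' j) * q x x' k := by
      intro k
      rw [sq]
      nth_rewrite 1 [show q x x' k = ∑ i, A x' i k * sg (x i) from rfl]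
      rw [Finset.sum_mul]
      apply Finset.sum_congr rfl; intro i _
      rw [show A x' i k = ∑ j, τ i j k * sg (x' j) from rfl, Finset.sum_mul, Finset.sum_mul]
      apply Finset.sum_congr rfl; intro j _
      ring
    simp_rw [e]
    rw [Finset.sum_comm]
    rw [Finset.sum_comm]
    have : ∀ i, ∑ j, ∑ k, τ i j k * sg (x i) * sg (x' j) * q x x' k =
        ∑ k, ∑ j, τ i j k * sg (x i) * sg (x' j) * q x x' k := fun i => Finset.sum_comm
    simp_rw [this]
    exact Finset.sum_comm
  have good : ∀ x x', (∀ k, |q x x' k| ≤ M) →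
      3 * ∑ k, q x x' k ^ 2 ≤ PP (q x x') / (δ * M) +
        M / (2 * δ) * (PP (fun i => sg (x i)) + PP (fun i => sg (x' i))) := by
    intro x x' hg
    have h := H (fun i => δ * sg (x i)) (fun i => δ * sg (x' i)) (fun k => δ / M * q x x' k)
      (fun i => by rw [abs_mul, sg_abs, abs_of_pos hδ, mul_one])
      (fun i => by rw [abs_mul, sg_abs, abs_of_pos hδ, mul_one])
      (fun i => by
        rw [abs_mul, abs_of_pos (by positivity : 0 < δ / M), div_mul_eq_mul_div, div_le_iff₀ hM0]
        exact mul_le_mul_of_nonneg_left (hg i) hδ.le)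
    have s1 : ∀ (c : ℝ) (y : ι → ℝ), ∑ i, ∑ j, Q i j * (c * y i) * (c * y j) = c ^ 2 * PP y := by
      intro c y
      simp only [PP, Finset.mul_sum]
      apply Finset.sum_congr rfl; intro i _
      apply Finset.sum_congr rfl; intro j _
      ring
    have s2 : ∑ i, ∑ j, ∑ k, τ i j k * (δ * sg (x i)) * (δ * sg (x' j)) * (δ / M * q x x' k) =
        δ ^ 3 / M * ∑ k, q x x' k ^ 2 := by
      rw [← qq]
      simp only [Finset.mul_sum]
      apply Finset.sum_congr rfl; intro i _
      apply Finset.sum_congr rfl; intro j _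
      apply Finset.sum_congr rfl; intro k _
      ring
    rw [s1 (δ / M) (q x x'), s1 δ (fun i => sg (x i)), s1 δ (fun i => sg (x' i)), s2] at h
    have hc : 0 < M / (8 * δ ^ 3) := by positivity
    have h' := mul_le_mul_of_nonneg_left h hc.le
    have e1 : M / (8 * δ ^ 3) * (24 * (δ ^ 3 / M * ∑ k, q x x' k ^ 2)) = 3 * ∑ k, q x x' k ^ 2 := by
      field_simp; ring
    have e2 : ∀ a b c : ℝ, M / (8 * δ ^ 3) * (8 * ((δ / M) ^ 2 * a) + 4 * (δ ^ 2 * b) + 4 * (δ ^ 2 * c)) =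
        a / (δ * M) + M / (2 * δ) * (b + c) := by
      intro a b c; field_simp; ring
    rw [e1, e2] at h'
    exact h'
  have all : ∀ x x', 3 * ∑ k, q x x' k ^ 2 ≤ PP (q x x') / (δ * M) +
        M / (2 * δ) * (PP (fun i => sg (x i)) + PP (fun i => sg (x' i))) +
        3 * C ^ 2 * N ^ 3 * ∑ k, (if M < |q x x' k| then (1 : ℝ) else 0) := by
    intro x x'
    by_cases hg : ∀ k, |q x x' k| ≤ M
    · have := good x x' hg
      have : 0 ≤ 3 * C ^ 2 * N ^ 3 * ∑ k, (if M < |q x x' k| then (1 : ℝ) else 0) := by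
        apply mul_nonneg (by positivity)
        apply Finset.sum_nonneg; intro k _; split_ifs <;> norm_num
      linarith
    · push Not at hg
      obtain ⟨k0, hk0⟩ := hg
      have h1 : (1 : ℝ) ≤ ∑ k, (if M < |q x x' k| then (1 : ℝ) else 0) := by
        have := Finset.single_le_sum (f := fun k => (if M < |q x x' k| then (1 : ℝ) else 0))
          (fun k _ => by split_ifs <;> norm_num) (Finset.mem_univ k0)
        simp only [if_pos hk0] at this
        exact this
      have h4 : ∑ k, q x x' k ^ 2 ≤ N * (C * N) ^ 2 := by
        calc ∑ k, q x x' k ^ 2 ≤ ∑ _k : ι, (C * N) ^ 2 := by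
              apply Finset.sum_le_sum; intro k _
              have := hq x x' k
              rw [← sq_abs]; gcongr
          _ = _ := by simp [hNd]
      have p1 : 0 ≤ PP (q x x') / (δ * M) := div_nonneg (hpos _) (by positivity)
      have p2 : 0 ≤ M / (2 * δ) * (PP (fun i => sg (x i)) + PP (fun i => sg (x' i))) :=
        mul_nonneg (by positivity) (add_nonneg (hpos _) (hpos _))
      have := mul_le_mul_of_nonneg_left h1 (by positivity : 0 ≤ 3 * C ^ 2 * N ^ 3)
      nlinarith
  -- averages
  have E1 : ∀ k k', ∑ x, ∑ x', q x x' k * q x x' k' = W * W * ∑ i, ∑ j, τ i j k * τ i j k' := by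
    intro k k'
    rw [Finset.sum_comm]
    have : ∀ x', ∑ x, q x x' k * q x x' k' = W * ∑ i, A x' i k * A x' i k' := by
      intro x'; exact rad_orth (fun i => A x' i k) (fun i => A x' i k')
    simp_rw [this]
    rw [← Finset.mul_sum, Finset.sum_comm, mul_assoc]
    refine congrArg (fun t => W * t) ?_
    rw [Finset.mul_sum]
    apply Finset.sum_congr rfl; intro i _
    exact rad_orth (fun j => τ i j k) (fun j => τ i j k')
  have E2 : ∑ x, ∑ x', ∑ k, q x x' k ^ 2 = W * W * ∑ i, ∑ j, ∑ k, τ i j k ^ 2 := by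
    have : ∀ x, ∑ x', ∑ k, q x x' k ^ 2 = ∑ k, ∑ x', q x x' k * q x x' k := by
      intro x; rw [Finset.sum_comm]; simp_rw [sq]
    simp_rw [this]
    rw [Finset.sum_comm]
    simp_rw [E1]
    rw [← Finset.mul_sum]
    congr 1
    rw [Finset.sum_comm]
    apply Finset.sum_congr rfl; intro i _
    rw [Finset.sum_comm]
    simp_rw [sq]
  have E3 : ∑ x, ∑ x', PP (q x x') ≤ W * W * (C ^ 3 * N ^ 2) := by
    have e : ∑ x, ∑ x', PP (q x x') = ∑ k, ∑ k', Q k k' * ∑ x, ∑ x', q x x' k * q x x' k' := by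
      have : ∀ x, ∑ x', PP (q x x') = ∑ k, ∑ k', Q k k' * ∑ x', q x x' k * q x x' k' := by
        intro x
        simp only [PP]
        rw [Finset.sum_comm]
        apply Finset.sum_congr rfl; intro k _
        rw [Finset.sum_comm]
        apply Finset.sum_congr rfl; intro k' _
        rw [Finset.mul_sum]
        apply Finset.sum_congr rfl; intro x' _
        ring
      simp_rw [this]
      rw [Finset.sum_comm]
      apply Finset.sum_congr rfl; intro k _
      rw [Finset.sum_comm]
      apply Finset.sum_congr rfl; intro k' _
      rw [Finset.mul_sum]
    rw [e]
    simp_rw [E1]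
    have e4 : ∑ k, ∑ k', Q k k' * (W * W * ∑ i, ∑ j, τ i j k * τ i j k') =
        W * W * ∑ i, ∑ j, ∑ k, ∑ k', Q k k' * (τ i j k * τ i j k') := by
      have : ∀ k, ∑ k', Q k k' * (W * W * ∑ i, ∑ j, τ i j k * τ i j k') =
          ∑ i, ∑ j, W * W * ∑ k', Q k k' * (τ i j k * τ i j k') := by
        intro k
        simp only [Finset.mul_sum]
        rw [Finset.sum_comm]
        apply Finset.sum_congr rfl; intro i _
        rw [Finset.sum_comm]
        apply Finset.sum_congr rfl; intro j _
        apply Finset.sum_congr rfl; intro k' _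
        ring
      simp_rw [this]
      rw [Finset.sum_comm, Finset.mul_sum]
      apply Finset.sum_congr rfl; intro i _
      rw [Finset.sum_comm, Finset.mul_sum]
      apply Finset.sum_congr rfl; intro j _
      rw [Finset.mul_sum]
    rw [e4]
    apply mul_le_mul_of_nonneg_left _ (by positivity)
    calc ∑ i, ∑ j, ∑ k, ∑ k', Q k k' * (τ i j k * τ i j k')
        ≤ ∑ _i : ι, ∑ _j : ι, C * C ^ 2 := by
          apply Finset.sum_le_sum; intro i _
          apply Finset.sum_le_sum; intro j _
          calc ∑ k, ∑ k', Q k k' * (τ i j k * τ i j k')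
              ≤ ∑ k, ∑ k', C * (|τ i j k| * |τ i j k'|) := by
                apply Finset.sum_le_sum; intro k _
                apply Finset.sum_le_sum; intro k' _
                refine (le_abs_self _).trans ?_
                rw [abs_mul, abs_mul]
                exact mul_le_mul_of_nonneg_right (hQ k k') (by positivity)
            _ = C * ((∑ k, |τ i j k|) * ∑ k, |τ i j k|) := by
                rw [Finset.sum_mul_sum]; simp only [Finset.mul_sum]
            _ ≤ C * C ^ 2 := by
                have h0 : 0 ≤ ∑ k, |τ i j k| := Finset.sum_nonneg (fun _ _ => abs_nonneg _)
                rw [sq]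
                exact mul_le_mul_of_nonneg_left (mul_le_mul (h3 i j) (h3 i j) h0 hC.le) hC.le
      _ = C ^ 3 * N ^ 2 := by simp [hNd]; ring
  have E4 : ∑ x : ι → Bool, PP (fun i => sg (x i)) ≤ W * (C * N) := by
    have : ∑ x : ι → Bool, PP (fun i => sg (x i)) = W * ∑ i, Q i i := rad_quad Q
    rw [this]
    apply mul_le_mul_of_nonneg_left _ hW0.le
    calc ∑ i, Q i i ≤ ∑ _i : ι, C := Finset.sum_le_sum (fun i _ => (le_abs_self _).trans (hQ i i))
      _ = C * N := by simp [hNd]; ring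
  have E5 : ∑ x, ∑ x', ∑ k, (if M < |q x x' k| then (1 : ℝ) else 0) ≤
      W * W * (2 * N * Real.exp (-(M ^ 2 / (2 * C ^ 2 * N)))) := by
    rw [Finset.sum_comm]
    calc ∑ x', ∑ x, ∑ k, (if M < |q x x' k| then (1 : ℝ) else 0)
        = ∑ x', ∑ k, ∑ x, (if M < |q x x' k| then (1 : ℝ) else 0) := by
          apply Finset.sum_congr rfl; intro x' _; exact Finset.sum_comm
      _ ≤ ∑ _x' : ι → Bool, ∑ _k : ι, W * (2 * Real.exp (-(M ^ 2 / (2 * C ^ 2 * N)))) := by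
          apply Finset.sum_le_sum; intro x' _
          apply Finset.sum_le_sum; intro k _
          exact rad_tail (fun i => A x' i k) C M hC hM0 hN (fun i => hA x' i k)
      _ = _ := by
          simp [hNd, hW]; ring
  have cardW : ∀ c : ℝ, ∑ _x : ι → Bool, c = W * c := by
    intro c; simp [hW]
  have tot := Finset.sum_le_sum (fun x (_ : x ∈ (univ : Finset (ι → Bool))) =>
    Finset.sum_le_sum (fun x' (_ : x' ∈ (univ : Finset (ι → Bool))) => all x x'))
  simp only [Finset.sum_add_distrib, ← Finset.mul_sum, ← Finset.sum_div, cardW] at tot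
  rw [E2] at tot
  have hWW : 0 < W * W := by positivity
  have t1 : (∑ x, ∑ x', PP (q x x')) / (δ * M) ≤ W * W * (C ^ 3 * N ^ 2) / (δ * M) := by gcongr
  have t2 : M / (2 * δ) * (W * ∑ x : ι → Bool, PP (fun i => sg (x i)) + W * ∑ x : ι → Bool, PP (fun i => sg (x i)))
      ≤ M / (2 * δ) * (W * (W * (C * N)) + W * (W * (C * N))) := by gcongr
  have t3 := mul_le_mul_of_nonneg_left E5 (by positivity : 0 ≤ 3 * C ^ 2 * N ^ 3)
  have fin : W * W * (3 * ∑ i, ∑ j, ∑ k, τ i j k ^ 2) ≤ W * W * (C ^ 3 * N ^ 2 / (δ * M) +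
      C * N * M / δ + 6 * C ^ 2 * N ^ 4 * Real.exp (-(M ^ 2 / (2 * C ^ 2 * N)))) := by
    have e1 : M / (2 * δ) * (W * (W * (C * N)) + W * (W * (C * N))) = W * W * (C * N * M / δ) := by
      field_simp; ring
    have e2 : W * W * (C ^ 3 * N ^ 2) / (δ * M) = W * W * (C ^ 3 * N ^ 2 / (δ * M)) := by ring
    rw [e1] at t2
    rw [e2] at t1
    linarith
  exact le_of_mul_le_mul_left fin hWW

end

end Roth

namespace Roth

open Finset

section
variable {p : ℕ} [Fact p.Prime]

/-- basic trilinear form, first argument is the midpoint -/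
noncomputable def mu (a b c : ZMod p → ℝ) : ℝ := ∑ j, ∑ i, a j * b i * c (2 * j - i)

/-- symmetrised trilinear form -/
noncomputable def tt (x y z : ZMod p → ℝ) : ℝ := (mu x y z + mu y x z + mu z x y) / 3

lemma mu_comm (a b c : ZMod p → ℝ) : mu a b c = mu a c b := by
  unfold mu
  apply Finset.sum_congr rfl; intro j _
  rw [← Equiv.sum_comp (Equiv.subLeft (2 * j))]
  apply Finset.sum_congr rfl; intro i _
  simp only [Equiv.subLeft_apply, sub_sub_cancel]; ring

lemma mu_add1 (a a' b c : ZMod p → ℝ) : mu (a + a') b c = mu a b c + mu a' b c := by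
  unfold mu
  simp only [Pi.add_apply, add_mul, Finset.sum_add_distrib]

lemma mu_add2 (a b b' c : ZMod p → ℝ) : mu a (b + b') c = mu a b c + mu a b' c := by
  unfold mu
  simp only [Pi.add_apply, add_mul, mul_add, Finset.sum_add_distrib]

lemma mu_smul1 (s : ℝ) (a b c : ZMod p → ℝ) : mu (s • a) b c = s * mu a b c := by
  unfold mu
  simp only [Pi.smul_apply, smul_eq_mul, Finset.mul_sum, mul_assoc]

lemma mu_smul2 (s : ℝ) (a b c : ZMod p → ℝ) : mu a (s • b) c = s * mu a b c := by
  unfold mu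
  simp only [Pi.smul_apply, smul_eq_mul, Finset.mul_sum]
  apply Finset.sum_congr rfl; intro j _
  apply Finset.sum_congr rfl; intro i _
  ring

lemma tt_comm12 (x y z : ZMod p → ℝ) : tt x y z = tt y x z := by
  unfold tt; rw [mu_comm z x y]; ring

lemma tt_comm23 (x y z : ZMod p → ℝ) : tt x y z = tt x z y := by
  unfold tt; rw [mu_comm x y z]; ring

lemma tt_add1 (x x' y z : ZMod p → ℝ) : tt (x + x') y z = tt x y z + tt x' y z := by
  unfold tt; rw [mu_add1, mu_add2, mu_add2]; ring

lemma tt_smul1 (s : ℝ) (x y z : ZMod p → ℝ) : tt (s • x) y z = s * tt x y z := by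
  unfold tt; rw [mu_smul1, mu_smul2, mu_smul2]; ring

lemma tt_add2 (x y y' z : ZMod p → ℝ) : tt x (y + y') z = tt x y z + tt x y' z := by
  rw [tt_comm12, tt_add1, tt_comm12 y, tt_comm12 y']

lemma tt_smul2 (s : ℝ) (x y z : ZMod p → ℝ) : tt x (s • y) z = s * tt x y z := by
  rw [tt_comm12, tt_smul1, tt_comm12 y]

lemma tt_add3 (x y z z' : ZMod p → ℝ) : tt x y (z + z') = tt x y z + tt x y z' := by
  rw [tt_comm23, tt_add2, tt_comm23 x z, tt_comm23 x z']

lemma tt_smul3 (s : ℝ) (x y z : ZMod p → ℝ) : tt x y (s • z) = s * tt x y z := by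
  rw [tt_comm23, tt_smul2, tt_comm23 x z]

lemma tt_sub1 (x x' y z : ZMod p → ℝ) : tt (x - x') y z = tt x y z - tt x' y z := by
  have : x - x' = x + (-1 : ℝ) • x' := by ext i; simp; ring
  rw [this, tt_add1, tt_smul1]; ring

lemma tt_sub2 (x y y' z : ZMod p → ℝ) : tt x (y - y') z = tt x y z - tt x y' z := by
  rw [tt_comm12, tt_sub1, tt_comm12 y, tt_comm12 y']

lemma tt_sub3 (x y z z' : ZMod p → ℝ) : tt x y (z - z') = tt x y z - tt x y z' := by
  rw [tt_comm23, tt_sub2, tt_comm23 x z, tt_comm23 x z']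

noncomputable def ttl (y z : ZMod p → ℝ) : (ZMod p → ℝ) →ₗ[ℝ] ℝ where
  toFun x := tt x y z
  map_add' x x' := tt_add1 x x' y z
  map_smul' s x := by simp [tt_smul1]

lemma tt_sum1 {κ : Type*} (I : Finset κ) (c : κ → ℝ) (E : κ → ZMod p → ℝ) (y z : ZMod p → ℝ) :
    tt (∑ i ∈ I, c i • E i) y z = ∑ i ∈ I, c i * tt (E i) y z := by
  have := map_sum (ttl y z) (fun i => c i • E i) I
  simp only [map_smul, smul_eq_mul] at this
  exact this

lemma tt_sum2 {κ : Type*} (I : Finset κ) (c : κ → ℝ) (E : κ → ZMod p → ℝ) (x z : ZMod p → ℝ) :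
    tt x (∑ i ∈ I, c i • E i) z = ∑ i ∈ I, c i * tt x (E i) z := by
  rw [tt_comm12, tt_sum1]
  simp_rw [tt_comm12 x]

lemma tt_sum3 {κ : Type*} (I : Finset κ) (c : κ → ℝ) (E : κ → ZMod p → ℝ) (x y : ZMod p → ℝ) :
    tt x y (∑ i ∈ I, c i • E i) = ∑ i ∈ I, c i * tt x y (E i) := by
  rw [tt_comm23, tt_sum2]
  simp_rw [tt_comm23 x _ y]

lemma mu_bound_c (a b c : ZMod p → ℝ) (X : ℝ) (h : ∀ i, |c i| ≤ X) :
    |mu a b c| ≤ X * (∑ i, |a i|) * ∑ i, |b i| := by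
  unfold mu
  rw [mul_assoc, Finset.sum_mul_sum, Finset.mul_sum]
  refine (Finset.abs_sum_le_sum_abs _ _).trans (Finset.sum_le_sum fun j _ => ?_)
  rw [Finset.mul_sum]
  refine (Finset.abs_sum_le_sum_abs _ _).trans (Finset.sum_le_sum fun i _ => ?_)
  rw [abs_mul, abs_mul, mul_comm]
  exact mul_le_mul_of_nonneg_right (h _) (by positivity)

lemma mu_bound_a (hp2 : (2 : ZMod p) ≠ 0) (a b c : ZMod p → ℝ) (X : ℝ) (h : ∀ i, |a i| ≤ X) :
    |mu a b c| ≤ X * (∑ i, |b i|) * ∑ i, |c i| := by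
  unfold mu
  rw [Finset.sum_comm, mul_assoc, Finset.sum_mul, Finset.mul_sum]
  refine (Finset.abs_sum_le_sum_abs _ _).trans (Finset.sum_le_sum fun i _ => ?_)
  refine (Finset.abs_sum_le_sum_abs _ _).trans ?_
  have e : ∑ j, |c (2 * j - i)| = ∑ j, |c j| := by
    have := Equiv.sum_comp ((Equiv.mulLeft₀ (2 : ZMod p) hp2).trans (Equiv.subRight i))
      (fun j => |c j|)
    simpa using this
  rw [← e, Finset.mul_sum, Finset.mul_sum]
  apply Finset.sum_le_sum; intro j _
  rw [abs_mul, abs_mul, mul_assoc]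
  exact mul_le_mul_of_nonneg_right (h _) (by positivity)

lemma tt_bound (hp2 : (2 : ZMod p) ≠ 0) (x y z : ZMod p → ℝ) (X : ℝ) (h : ∀ i, |x i| ≤ X) :
    |tt x y z| ≤ X * (∑ i, |y i|) * ∑ i, |z i| := by
  unfold tt
  have h1 := mu_bound_a hp2 x y z X h
  have h2 := mu_bound_c y z x X h
  have h3 := mu_bound_c z y x X h
  rw [mu_comm] at h2 h3
  rw [abs_div, abs_of_pos (by norm_num : (0:ℝ) < 3), div_le_iff₀ (by norm_num)]
  have a1 := abs_add_le (mu x y z + mu y x z) (mu z x y)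
  have a2 := abs_add_le (mu x y z) (mu y x z)
  linarith

/-- the cubic form -/
noncomputable def TT (x : ZMod p → ℝ) : ℝ := tt x x x

lemma TT_eq (v : ZMod p → ℝ) : ∑ n, ∑ d, v n * v (n + d) * v (n + 2 * d) = TT v := by
  unfold TT tt
  have : ∑ n, ∑ d, v n * v (n + d) * v (n + 2 * d) = mu v v v := by
    unfold mu
    rw [Finset.sum_comm (f := fun j i => v j * v i * v (2 * j - i))]
    apply Finset.sum_congr rfl; intro n _
    rw [← Equiv.sum_comp (Equiv.addLeft n) (fun j => v j * v n * v (2 * j - n))]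
    apply Finset.sum_congr rfl; intro d _
    simp only [Equiv.coe_addLeft]
    have : 2 * (n + d) - n = n + 2 * d := by ring
    rw [this]; ring
  rw [this]; ring

lemma TT_add (x y : ZMod p → ℝ) :
    TT (x + y) = TT x + 3 * tt x x y + 3 * tt x y y + TT y := by
  unfold TT
  simp only [tt_add1, tt_add2, tt_add3]
  rw [tt_comm12 y x x, tt_comm23 x y x, tt_comm12 y x y, tt_comm23 y y x, tt_comm12 y x y]
  ring

lemma TT_smul (s : ℝ) (x : ZMod p → ℝ) : TT (s • x) = s ^ 3 * TT x := by
  unfold TT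
  rw [tt_smul1, tt_smul2, tt_smul3]; ring

/-- the quadratic form -/
noncomputable def PQ (r x : ZMod p → ℝ) : ℝ := 3 * tt r x x + ∑ i, x i ^ 2

lemma PQ_smul (r : ZMod p → ℝ) (s : ℝ) (x : ZMod p → ℝ) : PQ r (s • x) = s ^ 2 * PQ r x := by
  unfold PQ
  rw [tt_smul2, tt_smul3]
  simp only [Pi.smul_apply, smul_eq_mul, mul_pow, ← Finset.mul_sum]; ring

lemma PQ_par (r x y : ZMod p → ℝ) : PQ r (x + y) + PQ r (x - y) = 2 * PQ r x + 2 * PQ r y := by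
  unfold PQ
  simp only [tt_add2, tt_add3, tt_sub2, tt_sub3]
  have : ∑ i, (x + y) i ^ 2 + ∑ i, (x - y) i ^ 2 = 2 * ∑ i, x i ^ 2 + 2 * ∑ i, y i ^ 2 := by
    rw [Finset.mul_sum, Finset.mul_sum, ← Finset.sum_add_distrib, ← Finset.sum_add_distrib]
    apply Finset.sum_congr rfl; intro i _; simp; ring
  linarith

lemma polar (r : ZMod p → ℝ) (ε δ : ℝ) (hδ : 3 * δ ≤ ε) (D : Submodule ℝ (ZMod p → ℝ))
    (h : ∀ x ∈ D, (∀ i, |x i| ≤ ε) → |TT x| ≤ PQ r x)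
    (u v w : ZMod p → ℝ) (hu : u ∈ D) (hv : v ∈ D) (hw : w ∈ D)
    (hu' : ∀ i, |u i| ≤ δ) (hv' : ∀ i, |v i| ≤ δ) (hw' : ∀ i, |w i| ≤ δ) :
    24 * tt u v w ≤ 8 * PQ r w + 4 * PQ r u + 4 * PQ r v := by
  have key : ∀ x ∈ D, (∀ i, |x i| ≤ 2 * δ) → |6 * tt w x x| ≤ 4 * PQ r w + 2 * PQ r x := by
    intro x hx hx'
    have h1 := h (w + x) (D.add_mem hw hx) (fun i => by
      rw [Pi.add_apply]; have := abs_add_le (w i) (x i); linarith [hw' i, hx' i])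
    have h2 := h (w - x) (D.sub_mem hw hx) (fun i => by
      rw [Pi.sub_apply]; have := abs_sub (w i) (x i); linarith [hw' i, hx' i])
    have h3 := h w hw (fun i => by
      have := (abs_nonneg _).trans (hw' i); linarith [hw' i])
    have e1 := TT_add w x
    have e2 : TT (w - x) = TT w - 3 * tt w w x + 3 * tt w x x - TT x := by
      have : w - x = w + (-1 : ℝ) • x := by ext i; simp; ring
      rw [this, TT_add, TT_smul, tt_smul3, tt_smul2, tt_smul3]; ring
    have e3 := PQ_par r w x
    rw [abs_le] at h1 h2 h3 ⊢
    constructor <;> linarith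
  have k1 := key (u + v) (D.add_mem hu hv) (fun i => by
      rw [Pi.add_apply]; have := abs_add_le (u i) (v i); linarith [hu' i, hv' i])
  have k2 := key (u - v) (D.sub_mem hu hv) (fun i => by
      rw [Pi.sub_apply]; have := abs_sub (u i) (v i); linarith [hu' i, hv' i])
  have e : tt w (u + v) (u + v) - tt w (u - v) (u - v) = 4 * tt u v w := by
    simp only [tt_add2, tt_add3, tt_sub2, tt_sub3]
    rw [tt_comm23 w v u, tt_comm12 w u v, tt_comm23 u w v]
    ring
  have e3 := PQ_par r u v
  rw [abs_le] at k1 k2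
  linarith

end

end Roth

namespace Roth

open Finset

section
variable {p : ℕ} [Fact p.Prime]

/-- sum-zero functions supported on Z -/
def DZ (Z : Finset (ZMod p)) : Submodule ℝ (ZMod p → ℝ) where
  carrier := {x | (∀ i, i ∉ Z → x i = 0) ∧ ∑ i, x i = 0}
  add_mem' := by
    rintro x y ⟨h1, h2⟩ ⟨h3, h4⟩
    refine ⟨fun i hi => by simp [h1 i hi, h3 i hi], ?_⟩
    simp [Finset.sum_add_distrib, h2, h4]
  zero_mem' := ⟨fun i _ => rfl, by simp⟩
  smul_mem' := by
    rintro s x ⟨h1, h2⟩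
    refine ⟨fun i hi => by simp [h1 i hi], ?_⟩
    simp [← Finset.mul_sum, h2]

/-- normalised indicator -/
noncomputable def bZ (Z : Finset (ZMod p)) : ZMod p → ℝ := fun a => if a ∈ Z then 1 / (Z.card : ℝ) else 0

/-- projected basis vectors -/
noncomputable def EZ (Z : Finset (ZMod p)) (i : ZMod p) : ZMod p → ℝ :=
  if i ∈ Z then Pi.single i 1 - bZ Z else 0

lemma bZ_nonneg (Z : Finset (ZMod p)) (a : ZMod p) : 0 ≤ bZ Z a := by
  unfold bZ; split_ifs <;> positivity

lemma bZ_le (Z : Finset (ZMod p)) (a : ZMod p) : bZ Z a ≤ 1 / (Z.card : ℝ) := by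
  unfold bZ; split_ifs
  · exact le_rfl
  · positivity

lemma bZ_sum (Z : Finset (ZMod p)) (hZ : 0 < Z.card) : ∑ a, bZ Z a = 1 := by
  unfold bZ
  have : (Z.card : ℝ) ≠ 0 := by positivity
  rw [← Finset.sum_filter]; simp [this]

lemma bZ_l1 (Z : Finset (ZMod p)) (hZ : 0 < Z.card) : ∑ a, |bZ Z a| = 1 := by
  rw [← bZ_sum Z hZ]
  exact Finset.sum_congr rfl (fun a _ => abs_of_nonneg (bZ_nonneg Z a))

lemma single_l1 (i : ZMod p) : ∑ a, |(Pi.single i (1:ℝ) : ZMod p → ℝ) a| = 1 := by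
  rw [Finset.sum_eq_single i]
  · simp
  · intro b _ hb; simp [hb]
  · intro h; exact absurd (Finset.mem_univ i) h

lemma EZ_mem (Z : Finset (ZMod p)) (i : ZMod p) : EZ Z i ∈ DZ Z := by
  unfold EZ
  split_ifs with h
  · have hZ : 0 < Z.card := Finset.card_pos.mpr ⟨i, h⟩
    refine ⟨?_, ?_⟩
    · intro a ha
      have hne : a ≠ i := fun e => ha (e ▸ h)
      simp [bZ, ha, hne]
    · simp only [Pi.sub_apply, Finset.sum_sub_distrib, bZ_sum Z hZ]
      simp
  · exact (DZ Z).zero_mem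

lemma EZ_l1 (Z : Finset (ZMod p)) (i : ZMod p) : ∑ a, |EZ Z i a| ≤ 2 := by
  unfold EZ
  split_ifs with h
  · have hZ : 0 < Z.card := Finset.card_pos.mpr ⟨i, h⟩
    calc ∑ a, |((Pi.single i (1:ℝ) : ZMod p → ℝ) - bZ Z) a|
        ≤ ∑ a, (|(Pi.single i (1:ℝ) : ZMod p → ℝ) a| + |bZ Z a|) :=
          Finset.sum_le_sum (fun a _ => abs_sub _ _)
      _ = 2 := by rw [Finset.sum_add_distrib, single_l1, bZ_l1 Z hZ]; norm_num
  · simp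

lemma EZ_sup (Z : Finset (ZMod p)) (i a : ZMod p) : |EZ Z i a| ≤ 2 :=
  (Finset.single_le_sum (f := fun a => |EZ Z i a|) (fun _ _ => abs_nonneg _)
    (Finset.mem_univ a)).trans (EZ_l1 Z i)

/-- the projection -/
noncomputable def pr (Z : Finset (ZMod p)) (y : ZMod p → ℝ) : ZMod p → ℝ := ∑ i, y i • EZ Z i

lemma pr_mem (Z : Finset (ZMod p)) (y : ZMod p → ℝ) : pr Z y ∈ DZ Z :=
  (DZ Z).sum_mem (fun i _ => (DZ Z).smul_mem _ (EZ_mem Z i))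

lemma pr_sup (Z : Finset (ZMod p)) (y : ZMod p → ℝ) (Y : ℝ) (h : ∀ i, |y i| ≤ Y) (a : ZMod p) :
    |pr Z y a| ≤ 2 * Y := by
  have hY : 0 ≤ Y := (abs_nonneg _).trans (h 0)
  by_cases ha : a ∈ Z
  · have hZ : 0 < Z.card := Finset.card_pos.mpr ⟨a, ha⟩
    have hZ' : (0 : ℝ) < Z.card := by exact_mod_cast hZ
    have e : pr Z y a = y a - (∑ i ∈ Z, y i) / Z.card := by
      unfold pr
      rw [Finset.sum_apply]
      have : ∀ i, (y i • EZ Z i) a = if i ∈ Z then y i * ((Pi.single i (1:ℝ) : ZMod p → ℝ) a - 1 / Z.card) else 0 := by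
        intro i; unfold EZ bZ
        split_ifs <;> simp_all
      simp_rw [this]
      rw [← Finset.sum_filter]
      simp only [Finset.filter_mem_eq_inter, Finset.univ_inter, mul_sub, Finset.sum_sub_distrib]
      congr 1
      · rw [Finset.sum_eq_single a]
        · simp
        · intro b _ hb; simp [Ne.symm hb]
        · intro h; exact absurd ha h
      · rw [← Finset.sum_mul]; ring
    rw [e]
    have h1 := abs_sub (y a) ((∑ i ∈ Z, y i) / Z.card)
    have h2 : |(∑ i ∈ Z, y i) / (Z.card : ℝ)| ≤ Y := by
      rw [abs_div, abs_of_pos hZ', div_le_iff₀ hZ']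
      refine (Finset.abs_sum_le_sum_abs _ _).trans ?_
      refine (Finset.sum_le_sum (fun i _ => h i)).trans (le_of_eq ?_)
      simp; ring
    linarith [h a]
  · rw [(pr_mem Z y).1 a ha]; simp; exact hY

lemma tt_pr (Z : Finset (ZMod p)) (x y z : ZMod p → ℝ) : tt (pr Z x) (pr Z y) (pr Z z) =
    ∑ i, ∑ j, ∑ k, tt (EZ Z i) (EZ Z j) (EZ Z k) * x i * y j * z k := by
  unfold pr
  rw [tt_sum1]
  apply Finset.sum_congr rfl; intro i _
  rw [tt_sum2, Finset.mul_sum]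
  apply Finset.sum_congr rfl; intro j _
  rw [tt_sum3, Finset.mul_sum, Finset.mul_sum]
  apply Finset.sum_congr rfl; intro k _
  ring

/-- matrix of the quadratic form -/
noncomputable def QZ (Z : Finset (ZMod p)) (r : ZMod p → ℝ) (i j : ZMod p) : ℝ :=
  3 * tt r (EZ Z i) (EZ Z j) + ∑ a, EZ Z i a * EZ Z j a

lemma PQ_pr (Z : Finset (ZMod p)) (r x : ZMod p → ℝ) :
    PQ r (pr Z x) = ∑ i, ∑ j, QZ Z r i j * x i * x j := by
  unfold PQ QZ
  have e1 : tt r (pr Z x) (pr Z x) = ∑ i, ∑ j, tt r (EZ Z i) (EZ Z j) * x i * x j := by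
    unfold pr
    rw [tt_sum2]
    apply Finset.sum_congr rfl; intro i _
    rw [tt_sum3, Finset.mul_sum]
    apply Finset.sum_congr rfl; intro j _
    ring
  have e2 : ∑ a, pr Z x a ^ 2 = ∑ i, ∑ j, (∑ a, EZ Z i a * EZ Z j a) * x i * x j := by
    have : ∀ a, pr Z x a ^ 2 = ∑ i, ∑ j, EZ Z i a * EZ Z j a * x i * x j := by
      intro a
      unfold pr
      rw [Finset.sum_apply, sq, Finset.sum_mul_sum]
      apply Finset.sum_congr rfl; intro i _
      apply Finset.sum_congr rfl; intro j _
      simp; ring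
    simp_rw [this]
    rw [Finset.sum_comm]
    apply Finset.sum_congr rfl; intro i _
    rw [Finset.sum_comm]
    apply Finset.sum_congr rfl; intro j _
    rw [Finset.sum_mul, Finset.sum_mul]
  rw [e1, e2, Finset.mul_sum, ← Finset.sum_add_distrib]
  apply Finset.sum_congr rfl; intro i _
  rw [Finset.mul_sum, ← Finset.sum_add_distrib]
  apply Finset.sum_congr rfl; intro j _
  ring

lemma QZ_bound (hp2 : (2 : ZMod p) ≠ 0) (Z : Finset (ZMod p)) (r : ZMod p → ℝ)
    (hr : ∀ i, |r i| ≤ 1) (i j : ZMod p) : |QZ Z r i j| ≤ 16 := by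
  unfold QZ
  have h1 := tt_bound hp2 r (EZ Z i) (EZ Z j) 1 hr
  have l1 := EZ_l1 Z i
  have l2 := EZ_l1 Z j
  have h0 : 0 ≤ ∑ a, |EZ Z i a| := Finset.sum_nonneg (fun _ _ => abs_nonneg _)
  have h0' : 0 ≤ ∑ a, |EZ Z j a| := Finset.sum_nonneg (fun _ _ => abs_nonneg _)
  have h2 : |∑ a, EZ Z i a * EZ Z j a| ≤ 4 := by
    refine (Finset.abs_sum_le_sum_abs _ _).trans ?_
    calc ∑ a, |EZ Z i a * EZ Z j a| ≤ ∑ a, 2 * |EZ Z j a| := by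
          apply Finset.sum_le_sum; intro a _
          rw [abs_mul]; exact mul_le_mul_of_nonneg_right (EZ_sup Z i a) (abs_nonneg _)
      _ ≤ 4 := by rw [← Finset.mul_sum]; linarith
  have h3 : (∑ a, |EZ Z i a|) * ∑ a, |EZ Z j a| ≤ 2 * 2 := mul_le_mul l1 l2 h0' (by norm_num)
  rw [one_mul] at h1
  rw [abs_le] at h1 h2 ⊢
  constructor <;> linarith

lemma tau_sum (hp2 : (2 : ZMod p) ≠ 0) (Z : Finset (ZMod p)) (x y : ZMod p → ℝ)
    (hx : ∑ a, |x a| ≤ 2) (hy : ∑ a, |y a| ≤ 2) : ∑ k, |tt x y (EZ Z k)| ≤ 16 := by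
  let s : ZMod p → ℝ := fun k => if 0 ≤ tt x y (EZ Z k) then 1 else -1
  have hs : ∀ k, |s k| ≤ 1 := by intro k; simp only [s]; split_ifs <;> simp
  have e : ∑ k, |tt x y (EZ Z k)| = tt (pr Z s) x y := by
    rw [tt_comm12, tt_comm23]
    unfold pr
    rw [tt_sum3]
    apply Finset.sum_congr rfl; intro k _
    simp only [s]; split_ifs with h
    · rw [abs_of_nonneg h, one_mul]
    · rw [abs_of_neg (not_le.mp h)]; ring
  rw [e]
  refine (le_abs_self _).trans ((tt_bound hp2 _ _ _ 2 (fun i => ?_)).trans ?_)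
  · have := pr_sup Z s 1 hs i; linarith
  · have h0 : 0 ≤ ∑ a, |y a| := Finset.sum_nonneg (fun _ _ => abs_nonneg _)
    have := mul_le_mul hx hy h0 (by norm_num)
    linarith

lemma mu_nonneg (a b c : ZMod p → ℝ) (ha : ∀ i, 0 ≤ a i) (hb : ∀ i, 0 ≤ b i) (hc : ∀ i, 0 ≤ c i) :
    0 ≤ mu a b c :=
  Finset.sum_nonneg (fun j _ => Finset.sum_nonneg (fun i _ =>
    mul_nonneg (mul_nonneg (ha _) (hb _)) (hc _)))

lemma single_nonneg (i a : ZMod p) : 0 ≤ (Pi.single i (1:ℝ) : ZMod p → ℝ) a := by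
  by_cases h : a = i
  · subst h; simp
  · simp [h]

lemma mu_single (j i : ZMod p) (c : ZMod p → ℝ) :
    mu (Pi.single j 1) (Pi.single i 1) c = c (2 * j - i) := by
  unfold mu
  rw [Finset.sum_eq_single j]
  · rw [Finset.sum_eq_single i]
    · simp
    · intro b _ hb; simp [hb]
    · intro h; exact absurd (Finset.mem_univ i) h
  · intro b _ hb; simp [hb]
  · intro h; exact absurd (Finset.mem_univ j) h

lemma tau_lower (hp2 : (2 : ZMod p) ≠ 0) (Z : Finset (ZMod p)) (i j k : ZMod p) (hi : i ∈ Z)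
    (hj : j ∈ Z) (hk : k ∈ Z) (h : k = 2 * j - i) (hc : 0 < Z.card) :
    1 / 18 - 49 / (Z.card : ℝ) ^ 2 ≤ tt (EZ Z i) (EZ Z j) (EZ Z k) ^ 2 := by
  have hc' : (0 : ℝ) < Z.card := by exact_mod_cast hc
  set ei : ZMod p → ℝ := Pi.single i 1 with hei
  set ej : ZMod p → ℝ := Pi.single j 1 with hej
  set ek : ZMod p → ℝ := Pi.single k 1 with hek
  have Ei : EZ Z i = ei - bZ Z := by unfold EZ; rw [if_pos hi]
  have Ej : EZ Z j = ej - bZ Z := by unfold EZ; rw [if_pos hj]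
  have Ek : EZ Z k = ek - bZ Z := by unfold EZ; rw [if_pos hk]
  have e : tt (EZ Z i) (EZ Z j) (EZ Z k) = tt ei ej ek - tt (bZ Z) (EZ Z j) (EZ Z k)
      - tt (bZ Z) ei (EZ Z k) - tt (bZ Z) ei ej := by
    rw [tt_comm12 (bZ Z) ei (EZ Z k), tt_comm12 (bZ Z) ei ej, tt_comm23 ei (bZ Z) ej]
    rw [Ei, Ej, Ek]
    simp only [tt_sub1, tt_sub2, tt_sub3]
    ring
  have hb : ∀ a, |bZ Z a| ≤ 1 / (Z.card : ℝ) := fun a => by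
    rw [abs_of_nonneg (bZ_nonneg Z a)]; exact bZ_le Z a
  have b1 := tt_bound hp2 (bZ Z) (EZ Z j) (EZ Z k) _ hb
  have b2 := tt_bound hp2 (bZ Z) ei (EZ Z k) _ hb
  have b3 := tt_bound hp2 (bZ Z) ei ej _ hb
  rw [single_l1, mul_one] at b2 b3
  rw [single_l1, mul_one] at b3
  have lj := EZ_l1 Z j
  have lk := EZ_l1 Z k
  have h0 : 0 ≤ ∑ a, |EZ Z k a| := Finset.sum_nonneg (fun _ _ => abs_nonneg _)
  set η : ℝ := 1 / (Z.card : ℝ) with hη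
  have hη0 : 0 < η := by positivity
  have b1' : η * (∑ a, |EZ Z j a|) * ∑ a, |EZ Z k a| ≤ η * (2 * 2) := by
    rw [mul_assoc]; exact mul_le_mul_of_nonneg_left (mul_le_mul lj lk h0 (by norm_num)) hη0.le
  have b2' : η * ∑ a, |EZ Z k a| ≤ η * 2 := mul_le_mul_of_nonneg_left lk hη0.le
  have main : 1 / 3 ≤ tt ei ej ek := by
    unfold tt
    have m1 := mu_nonneg ei ej ek (single_nonneg i) (single_nonneg j) (single_nonneg k)
    have m2 := mu_nonneg ek ei ej (single_nonneg k) (single_nonneg i) (single_nonneg j)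
    have m3 : mu ej ei ek = 1 := by
      rw [hej, hei, mu_single, hek, h]; simp
    linarith
  set w := tt (EZ Z i) (EZ Z j) (EZ Z k) with hw
  set S := tt ei ej ek with hS
  have hd : |w - S| ≤ 7 * η := by
    rw [abs_le] at b1 b2 b3 ⊢
    constructor <;> linarith
  have hd2 : (w - S) ^ 2 ≤ (7 * η) ^ 2 := by
    rw [← sq_abs]; exact pow_le_pow_left₀ (abs_nonneg _) hd 2
  have e49 : 49 / (Z.card : ℝ) ^ 2 = (7 * η) ^ 2 := by rw [hη]; field_simp; norm_num
  rw [e49]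
  have : 1 / 9 ≤ S ^ 2 := by
    have := pow_le_pow_left₀ (by norm_num : (0:ℝ) ≤ 1 / 3) main 2
    norm_num at this ⊢; exact this
  have := sq_nonneg (2 * w - S)
  have e5 : (2 * w - S) ^ 2 = 4 * w ^ 2 - 4 * w * S + S ^ 2 := by ring
  have e6 : (w - S) ^ 2 = w ^ 2 - 2 * w * S + S ^ 2 := by ring
  linarith

lemma tau_total (hp2 : (2 : ZMod p) ≠ 0) (Z : Finset (ZMod p)) (hc : 0 < Z.card) :
    N3 Z / 18 - 49 ≤ ∑ i, ∑ j, ∑ k, tt (EZ Z i) (EZ Z j) (EZ Z k) ^ 2 := by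
  have hc' : (0 : ℝ) < Z.card := by exact_mod_cast hc
  have h1 : ∑ j ∈ Z, ∑ i ∈ Z, (if 2 * j - i ∈ Z then (1 / 18 - 49 / (Z.card : ℝ) ^ 2) else 0) ≤
      ∑ i, ∑ j, ∑ k, tt (EZ Z i) (EZ Z j) (EZ Z k) ^ 2 := by
    rw [Finset.sum_comm]
    refine le_trans ?_ (Finset.sum_le_sum_of_subset_of_nonneg (Finset.subset_univ Z)
      (fun i _ _ => Finset.sum_nonneg (fun j _ => Finset.sum_nonneg (fun k _ => sq_nonneg _))))
    apply Finset.sum_le_sum; intro i hi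
    refine le_trans ?_ (Finset.sum_le_sum_of_subset_of_nonneg (Finset.subset_univ Z)
      (fun j _ _ => Finset.sum_nonneg (fun k _ => sq_nonneg _)))
    apply Finset.sum_le_sum; intro j hj
    split_ifs with h
    · refine (tau_lower hp2 Z i j (2 * j - i) hi hj h rfl hc).trans ?_
      exact Finset.single_le_sum (f := fun k => tt (EZ Z i) (EZ Z j) (EZ Z k) ^ 2)
        (fun k _ => sq_nonneg _) (Finset.mem_univ _)
    · exact Finset.sum_nonneg (fun k _ => sq_nonneg _)
  refine le_trans ?_ h1
  have e : ∑ j ∈ Z, ∑ i ∈ Z, (if 2 * j - i ∈ Z then (1 / 18 - 49 / (Z.card : ℝ) ^ 2) else 0) =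
      N3 Z * (1 / 18 - 49 / (Z.card : ℝ) ^ 2) := by
    unfold N3
    rw [Finset.sum_mul]
    apply Finset.sum_congr rfl; intro j _
    rw [Finset.sum_mul]
    apply Finset.sum_congr rfl; intro i _
    split_ifs <;> simp
  rw [e]
  have hN : N3 Z ≤ (Z.card : ℝ) ^ 2 := by
    unfold N3
    calc ∑ b ∈ Z, ∑ a ∈ Z, (if 2 * b - a ∈ Z then (1 : ℝ) else 0) ≤ ∑ b ∈ Z, ∑ a ∈ Z, (1:ℝ) := by
          apply Finset.sum_le_sum; intro b _; apply Finset.sum_le_sum; intro a _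
          split_ifs <;> norm_num
      _ = _ := by simp; ring
  have : N3 Z * (49 / (Z.card : ℝ) ^ 2) ≤ 49 := by
    rw [mul_div_assoc', div_le_iff₀ (by positivity)]; linarith
  linarith

/-- combination of the tensor inequality with the counting bound -/
lemma count_bound (hp2 : (2 : ZMod p) ≠ 0) (Z : Finset (ZMod p)) (hc : 0 < Z.card)
    (r : ZMod p → ℝ) (hr : ∀ i, |r i| ≤ 1) (ε M : ℝ) (hε : 0 < ε) (hM : 1 ≤ M)
    (h : ∀ x ∈ DZ Z, (∀ i, |x i| ≤ ε) → |TT x| ≤ PQ r x) :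
    N3 Z / 6 ≤ 147 + 6 * 16 ^ 3 * (p : ℝ) ^ 2 / (ε * M) + 96 * p * M / ε +
      6 * 16 ^ 2 * (p : ℝ) ^ 4 * Real.exp (-(M ^ 2 / (2 * 16 ^ 2 * p))) := by
  have hpos : ∀ x ∈ DZ Z, 0 ≤ PQ r x := by
    intro x hx
    set B := ∑ i, |x i| with hB
    have hB0 : 0 ≤ B := Finset.sum_nonneg (fun _ _ => abs_nonneg _)
    have hs : 0 < ε / (B + 1) := by positivity
    have := h ((ε / (B + 1)) • x) ((DZ Z).smul_mem _ hx) (fun i => by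
      rw [Pi.smul_apply, smul_eq_mul, abs_mul, abs_of_pos hs, div_mul_eq_mul_div,
        div_le_iff₀ (by positivity)]
      have : |x i| ≤ B := Finset.single_le_sum (f := fun i => |x i|) (fun _ _ => abs_nonneg _)
        (Finset.mem_univ i)
      exact mul_le_mul_of_nonneg_left (by linarith) hε.le)
    rw [PQ_smul] at this
    have h2 := (abs_nonneg _).trans this
    by_contra hneg
    push Not at hneg
    have := mul_neg_of_pos_of_neg (pow_pos hs 2) hneg
    linarith
  have T := tensor (fun i j k => tt (EZ Z i) (EZ Z j) (EZ Z k)) (QZ Z r) 16 (ε / 6) M (by norm_num)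
    (by positivity) hM (Fintype.card_pos) (QZ_bound hp2 Z r hr)
    (fun i j => tau_sum hp2 Z _ _ (EZ_l1 Z i) (EZ_l1 Z j))
    (fun i k => by
      have := tau_sum hp2 Z _ _ (EZ_l1 Z i) (EZ_l1 Z k)
      simp_rw [tt_comm23 (EZ Z i) _ (EZ Z k)]; exact this)
    (fun x => by rw [← PQ_pr]; exact hpos _ (pr_mem Z x))
    (fun x y z hx hy hz => by
      rw [← PQ_pr, ← PQ_pr, ← PQ_pr, ← tt_pr]
      exact polar r ε (ε / 3) (by linarith) (DZ Z) h _ _ _ (pr_mem Z x) (pr_mem Z y) (pr_mem Z z)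
        (fun i => by have := pr_sup Z x _ hx i; linarith)
        (fun i => by have := pr_sup Z y _ hy i; linarith)
        (fun i => by have := pr_sup Z z _ hz i; linarith))
  have L := tau_total hp2 Z hc
  rw [ZMod.card] at T
  have e1 : (16:ℝ) ^ 3 * (p : ℝ) ^ 2 / (ε / 6 * M) = 6 * 16 ^ 3 * (p : ℝ) ^ 2 / (ε * M) := by
    field_simp
  have e2 : 16 * (p : ℝ) * M / (ε / 6) = 96 * p * M / ε := by field_simp; ring
  rw [e1, e2] at T
  linarith

end

end Roth

namespace Roth

open Finset

section
variable {p : ℕ} [Fact p.Prime]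

lemma lin_nonneg (a b c : ℝ) (h : ∀ τ : ℝ, 0 < τ → τ ≤ 1 → 0 ≤ a * τ + b * τ ^ 2 + c * τ ^ 3) :
    0 ≤ a := by
  have lim : Filter.Tendsto (fun τ : ℝ => a + b * τ + c * τ ^ 2) (nhdsWithin 0 (Set.Ioi 0)) (nhds a) := by
    have : Continuous (fun τ : ℝ => a + b * τ + c * τ ^ 2) := by fun_prop
    have h0 := this.tendsto 0
    simp only [mul_zero, add_zero, ne_eq, OfNat.ofNat_ne_zero, not_false_eq_true, zero_pow] at h0
    exact h0.mono_left nhdsWithin_le_nhds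
  refine ge_of_tendsto lim ?_
  filter_upwards [Ioo_mem_nhdsGT (show (0:ℝ) < 1 by norm_num)] with τ hτ
  have := h τ hτ.1 hτ.2.le
  have e : a * τ + b * τ ^ 2 + c * τ ^ 3 = τ * (a + b * τ + c * τ ^ 2) := by ring
  rw [e] at this
  exact nonneg_of_mul_nonneg_right this hτ.1

lemma minimizer (f : ZMod p → ℝ) (hf : ∀ n, f n ∈ Set.Icc (0:ℝ) 1) :
    ∃ r : ZMod p → ℝ, (∀ n, r n ∈ Set.Icc (0:ℝ) 1) ∧ ∑ n, r n = ∑ n, f n ∧ TT r ≤ TT f + p ∧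
      ∀ v : ZMod p → ℝ, (∀ n, r n + v n ∈ Set.Icc (0:ℝ) 1) → ∑ n, v n = 0 →
        0 ≤ (3 * tt r r v + 2 * ∑ n, r n * v n) + PQ r v + TT v := by
  let Φ : (ZMod p → ℝ) → ℝ := fun g => ∑ n, ∑ d, g n * g (n + d) * g (n + 2 * d) + ∑ n, g n ^ 2
  let S : Set (ZMod p → ℝ) := (Set.univ.pi (fun _ => Set.Icc (0:ℝ) 1)) ∩ {g | ∑ n, g n = ∑ n, f n}
  have hS : IsCompact S := by
    apply IsCompact.inter_right (isCompact_univ_pi (fun _ => isCompact_Icc))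
    exact isClosed_eq (by fun_prop) continuous_const
  have hne : S.Nonempty := ⟨f, fun n _ => hf n, rfl⟩
  have hc : Continuous Φ := by
    simp only [Φ]; fun_prop
  obtain ⟨r, hr, hmin⟩ := hS.exists_isMinOn hne hc.continuousOn
  have hΦ : ∀ g, Φ g = TT g + ∑ n, g n ^ 2 := fun g => by simp only [Φ]; rw [TT_eq]
  refine ⟨r, fun n => hr.1 n (Set.mem_univ n), hr.2, ?_, ?_⟩
  · have h1 : Φ r ≤ Φ f := hmin (show f ∈ S from ⟨fun n _ => hf n, rfl⟩)
    rw [hΦ, hΦ] at h1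
    have h2 : 0 ≤ ∑ n, r n ^ 2 := Finset.sum_nonneg (fun _ _ => sq_nonneg _)
    have h3 : ∑ n, f n ^ 2 ≤ p := by
      calc ∑ n, f n ^ 2 ≤ ∑ _n : ZMod p, (1:ℝ) :=
            Finset.sum_le_sum (fun n _ => pow_le_one₀ (hf n).1 (hf n).2)
        _ = p := by simp [ZMod.card]
    linarith
  · intro v hv hv0
    have hr2 : ∑ n, r n = ∑ n, f n := hr.2
    have h1 : Φ r ≤ Φ (r + v) := hmin (show r + v ∈ S from ⟨fun n _ => hv n, by
      simp only [Set.mem_setOf_eq, Pi.add_apply, Finset.sum_add_distrib, hv0, hr2, add_zero]⟩)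
    rw [hΦ, hΦ, TT_add] at h1
    have e : ∑ n, (r + v) n ^ 2 = ∑ n, r n ^ 2 + 2 * ∑ n, r n * v n + ∑ n, v n ^ 2 := by
      rw [Finset.mul_sum, ← Finset.sum_add_distrib, ← Finset.sum_add_distrib]
      apply Finset.sum_congr rfl; intro n _; simp; ring
    unfold PQ
    linarith

lemma grad (hp2 : (2 : ZMod p) ≠ 0) (r : ZMod p → ℝ) (n : ZMod p) :
    3 * tt r r (Pi.single n 1) = conv p r r (2 * n) + 2 * conv p r (fun m => r (-m / 2)) (-n) := by
  have h1 : mu (Pi.single n 1) r r = conv p r r (2 * n) := by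
    unfold mu conv
    rw [Finset.sum_eq_single n]
    · simp
    · intro b _ hb; simp [hb]
    · intro h; exact absurd (Finset.mem_univ n) h
  have h2 : mu r r (Pi.single n 1) = conv p r (fun m => r (-m / 2)) (-n) := by
    rw [mu_comm]
    unfold mu conv
    have e : ∀ j, ∑ i, r j * (Pi.single n (1:ℝ) : ZMod p → ℝ) i * r (2 * j - i) = r j * r (2 * j - n) := by
      intro j
      rw [Finset.sum_eq_single n]
      · simp
      · intro b _ hb; simp [hb]
      · intro h; exact absurd (Finset.mem_univ n) h
    simp_rw [e]
    rw [← Equiv.sum_comp ((Equiv.mulLeft₀ (2 : ZMod p) hp2).trans (Equiv.subRight n))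
      (fun k => r k * r (-(-n - k) / 2))]
    apply Finset.sum_congr rfl; intro j _
    change r j * r (2 * j - n) = r (2 * j - n) * r (-(-n - (2 * j - n)) / 2)
    have : -(-n - (2 * j - n)) / 2 = j := by field_simp; ring
    rw [this]; ring
  unfold tt
  rw [h1, h2]; ring

lemma swap (r : ZMod p → ℝ) (hr : ∀ n, r n ∈ Set.Icc (0:ℝ) 1)
    (hV : ∀ v : ZMod p → ℝ, (∀ n, r n + v n ∈ Set.Icc (0:ℝ) 1) → ∑ n, v n = 0 →
        0 ≤ (3 * tt r r v + 2 * ∑ n, r n * v n) + PQ r v + TT v) (x y : ZMod p) (h : r y < r x) :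
    3 * tt r r (Pi.single x 1) < 3 * tt r r (Pi.single y 1) := by
  have hxy : x ≠ y := by rintro rfl; exact lt_irrefl _ h
  set ex : ZMod p → ℝ := Pi.single x 1 with hex
  set ey : ZMod p → ℝ := Pi.single y 1 with hey
  set s := r x - r y with hs
  have hs0 : 0 < s := by linarith
  set w : ZMod p → ℝ := s • (ey - ex) with hw
  have sumsingle : ∀ (a : ZMod p) (g : ZMod p → ℝ), ∑ n, g n * (Pi.single a (1:ℝ) : ZMod p → ℝ) n = g a := by
    intro a g
    rw [Finset.sum_eq_single a]
    · simp
    · intro b _ hb; simp [hb]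
    · intro h; exact absurd (Finset.mem_univ a) h
  have sum1 : ∀ (a : ZMod p), ∑ n, (Pi.single a (1:ℝ) : ZMod p → ℝ) n = 1 := by
    intro a; have := sumsingle a (fun _ => 1); simpa using this
  have key := lin_nonneg (3 * tt r r w + 2 * ∑ n, r n * w n) (PQ r w) (TT w) (by
    intro τ h0 h1
    have hh := hV (τ • w) (by
      intro n
      have hrn := hr n
      have hrx := hr x
      have hry := hr y
      have hτs : 0 < τ * s := by positivity
      have hτs' : τ * s ≤ s := by nlinarith
      by_cases hnx : n = x
      · subst hnx
        have : (τ • w) n = - (τ * s) := by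
          simp [hw, hex, hey, Pi.single_eq_of_ne hxy]
        rw [this]
        exact ⟨by linarith [hry.1], by linarith [hrn.2]⟩
      · by_cases hny : n = y
        · subst hny
          have : (τ • w) n = τ * s := by
            simp [hw, hex, hey, Pi.single_eq_of_ne hnx]
          rw [this]
          exact ⟨by linarith [hrn.1], by linarith [hrx.2]⟩
        · have : (τ • w) n = 0 := by
            simp [hw, hex, hey, Pi.single_eq_of_ne hnx, Pi.single_eq_of_ne hny]
          rw [this, add_zero]; exact hrn) (by
      simp only [hw, Pi.smul_apply, Pi.sub_apply, smul_eq_mul, ← Finset.mul_sum,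
        Finset.sum_sub_distrib, hex, hey, sum1]
      ring)
    rw [tt_smul3, PQ_smul, TT_smul] at hh
    have e : ∑ n, r n * (τ • w) n = τ * ∑ n, r n * w n := by
      rw [Finset.mul_sum]; apply Finset.sum_congr rfl; intro n _; simp; ring
    rw [e] at hh
    linarith)
  have e1 : tt r r w = s * (tt r r ey - tt r r ex) := by rw [hw, tt_smul3, tt_sub3]
  have e2 : ∑ n, r n * w n = s * (r y - r x) := by
    have : ∀ n, r n * w n = s * (r n * ey n - r n * ex n) := by intro n; simp [hw]; ring
    simp_rw [this]
    rw [← Finset.mul_sum, Finset.sum_sub_distrib, hex, hey, sumsingle, sumsingle]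
  rw [e1, e2] at key
  have e3 : 3 * (s * (tt r r ey - tt r r ex)) + 2 * (s * (r y - r x)) =
      s * (3 * tt r r ey - 3 * tt r r ex - 2 * s) := by rw [hs]; ring
  rw [e3] at key
  have := nonneg_of_mul_nonneg_right key hs0
  linarith

lemma second_order (r : ZMod p → ℝ)
    (hV : ∀ v : ZMod p → ℝ, (∀ n, r n + v n ∈ Set.Icc (0:ℝ) 1) → ∑ n, v n = 0 →
        0 ≤ (3 * tt r r v + 2 * ∑ n, r n * v n) + PQ r v + TT v) (hr : ∀ n, r n ∈ Set.Icc (0:ℝ) 1)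
    (ε : ℝ) (Z : Finset (ZMod p))
    (hZ : ∀ n ∈ Z, ε ≤ r n ∧ r n ≤ 1 - ε) (x : ZMod p → ℝ) (hx : x ∈ DZ Z) (hxε : ∀ i, |x i| ≤ ε) :
    |TT x| ≤ PQ r x := by
  set a := 3 * tt r r x + 2 * ∑ n, r n * x n with ha
  have gen : ∀ τ : ℝ, |τ| ≤ 1 → 0 ≤ a * τ + PQ r x * τ ^ 2 + TT x * τ ^ 3 := by
    intro τ hτ
    have hh := hV (τ • x) (by
      intro n
      by_cases hn : n ∈ Z
      · have h1 := hZ n hn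
        have h2 : |τ * x n| ≤ ε := by
          rw [abs_mul]
          have := mul_le_mul hτ (hxε n) (abs_nonneg _) (by norm_num)
          linarith
        rw [abs_le] at h2
        simp only [Pi.smul_apply, smul_eq_mul]
        exact ⟨by linarith, by linarith⟩
      · simp only [Pi.smul_apply, smul_eq_mul, hx.1 n hn, mul_zero, add_zero]
        exact hr n) (by
      simp only [Pi.smul_apply, smul_eq_mul, ← Finset.mul_sum, hx.2, mul_zero])
    rw [tt_smul3, PQ_smul, TT_smul] at hh
    have e : ∑ n, r n * (τ • x) n = τ * ∑ n, r n * x n := by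
      rw [Finset.mul_sum]; apply Finset.sum_congr rfl; intro n _; simp; ring
    rw [e] at hh
    rw [ha]; linarith
  have a0 : 0 ≤ a := lin_nonneg a (PQ r x) (TT x) (fun τ h0 h1 => gen τ (by rw [abs_of_pos h0]; exact h1))
  have a1 : 0 ≤ -a := lin_nonneg (-a) (PQ r x) (-TT x) (fun τ h0 h1 => by
    have := gen (-τ) (by rw [abs_neg, abs_of_pos h0]; exact h1)
    have e : a * -τ + PQ r x * (-τ) ^ 2 + TT x * (-τ) ^ 3 = -a * τ + PQ r x * τ ^ 2 + -TT x * τ ^ 3 := by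
      ring
    rw [e] at this; exact this)
  have g1 := gen 1 (by simp)
  have g2 := gen (-1) (by simp)
  rw [abs_le]
  constructor <;> linarith

lemma final_num : ∃ P1 : ℝ, 3 ≤ P1 ∧ ∀ L : ℝ, P1 ≤ L →
    147 + 6 * 16 ^ 3 * (Real.exp L) ^ 2 / (L ^ (-(2:ℝ)/3) * Real.exp (0.7 * L)) +
      96 * Real.exp L * Real.exp (0.7 * L) / L ^ (-(2:ℝ)/3) +
      6 * 16 ^ 2 * (Real.exp L) ^ 4 *
        Real.exp (-((Real.exp (0.7 * L)) ^ 2 / (2 * 16 ^ 2 * Real.exp L))) <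
    Real.exp (1.9 * L) / 6 := by
  have h1 : ∀ᶠ L : ℝ in Filter.atTop, 10 ^ 6 * L ≤ Real.exp (0.1 * L) := by
    have := (isLittleO_pow_exp_pos_mul_atTop (k := 1) (b := 0.1) (by norm_num)).bound
      (c := 1 / 10 ^ 6) (by norm_num)
    filter_upwards [this, Filter.eventually_ge_atTop 0] with s h h0
    rw [Real.norm_of_nonneg (by positivity), Real.norm_of_nonneg (by positivity), pow_one] at h
    linarith
  obtain ⟨L0, hL0⟩ := Filter.eventually_atTop.mp h1
  refine ⟨max 3 L0, le_max_left _ _, fun L hL => ?_⟩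
  have hL3 : 3 ≤ L := (le_max_left _ _).trans hL
  have hb := hL0 L ((le_max_right _ _).trans hL)
  have hLp : 0 < L := by linarith
  set e := L ^ (-(2:ℝ)/3) with he
  have he0 : 0 < e := Real.rpow_pos_of_pos hLp _
  have hinv : 1 / e ≤ L := by
    rw [div_le_iff₀ he0, he, ← Real.rpow_one_add' hLp.le (by norm_num)]
    apply Real.one_le_rpow (by linarith) (by norm_num)
  set t := Real.exp (0.1 * L) with ht
  have ek : ∀ (k : ℕ) (c : ℝ), c = k * 0.1 → Real.exp (c * L) = t ^ k := by
    intro k c hc; rw [ht, ← Real.exp_nat_mul, hc]; ring_nf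
  have t0 : 0 < t := Real.exp_pos _
  have t1 : 10 ^ 6 ≤ t := by linarith
  have t1' : 1 ≤ t := by linarith
  have e7 := ek 7 0.7 (by norm_num)
  have e19 := ek 19 1.9 (by norm_num)
  have e10 : Real.exp L = t ^ 10 := by rw [← ek 10 1 (by norm_num), one_mul]
  rw [e7, e19, e10]
  have A1 : 6 * 16 ^ 3 * (t ^ 10) ^ 2 / (e * t ^ 7) ≤ t ^ 19 / 100 := by
    have : 6 * 16 ^ 3 * (t ^ 10) ^ 2 / (e * t ^ 7) = 24576 * t ^ 13 * (1 / e) := by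
      field_simp; norm_num
    rw [this]
    calc 24576 * t ^ 13 * (1 / e) ≤ 24576 * t ^ 13 * L := by gcongr
      _ = t ^ 13 * (24576 * L) := by ring
      _ ≤ t ^ 13 * (t / 10) := by
          apply mul_le_mul_of_nonneg_left _ (by positivity); linarith
      _ = t ^ 14 / 10 := by ring
      _ ≤ t ^ 15 / 100 := by
          have : t ^ 14 * 10 ≤ t ^ 14 * t := by
            apply mul_le_mul_of_nonneg_left _ (by positivity); linarith
          have : t ^ 15 = t ^ 14 * t := by ring
          linarith
      _ ≤ t ^ 19 / 100 := by
          have : t ^ 15 ≤ t ^ 19 := pow_le_pow_right₀ t1' (by norm_num)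
          linarith
  have A2 : 96 * t ^ 10 * t ^ 7 / e ≤ t ^ 19 / 100 := by
    have : 96 * t ^ 10 * t ^ 7 / e = 96 * t ^ 17 * (1 / e) := by ring
    rw [this]
    calc 96 * t ^ 17 * (1 / e) ≤ 96 * t ^ 17 * L := by gcongr
      _ = t ^ 17 * (96 * L) := by ring
      _ ≤ t ^ 17 * (t / 100) := by
          apply mul_le_mul_of_nonneg_left _ (by positivity); linarith
      _ = t ^ 18 / 100 := by ring
      _ ≤ t ^ 19 / 100 := by
          have : t ^ 18 ≤ t ^ 19 := pow_le_pow_right₀ t1' (by norm_num)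
          linarith
  have A3 : 6 * 16 ^ 2 * (t ^ 10) ^ 4 * Real.exp (-((t ^ 7) ^ 2 / (2 * 16 ^ 2 * t ^ 10))) ≤ 1536 := by
    have e1 : (t ^ 7) ^ 2 / (2 * 16 ^ 2 * t ^ 10) = t ^ 4 / 512 := by
      field_simp; norm_num
    have e2 : (t ^ 10) ^ 4 = Real.exp (4 * L) := by
      rw [← pow_mul]; exact (ek 40 4 (by norm_num)).symm
    rw [e1, e2, mul_assoc, ← Real.exp_add]
    have : t ≤ t ^ 4 := le_self_pow₀ t1' (by norm_num)
    have : Real.exp (4 * L + -(t ^ 4 / 512)) ≤ 1 := by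
      rw [Real.exp_le_one_iff]; linarith
    linarith
  have A4 : t ≤ t ^ 19 := le_self_pow₀ t1' (by norm_num)
  linarith

end

end Roth

open Roth in
theorem stmt_2 :
    ∃ K : ℝ, 0 < K ∧
      ∀ (p : ℕ) [Fact p.Prime], Odd p →
        ∀ θ : ℝ, θ ∈ Set.Ioc (0 : ℝ) 1 →
          ∀ f : ZMod p → ℝ, (∀ n, f n ∈ Set.Icc (0 : ℝ) 1) →
            Ex p f ≥ θ →
            (∀ h : ZMod p → ℝ, (∀ n, h n ∈ Set.Icc (0 : ℝ) 1) → Ex p h ≥ θ →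
              Lam p f ≤ Lam p h) →
            ∃ (r : ZMod p → ℝ) (L : ℝ),
              (∀ n, r n ∈ Set.Icc (0 : ℝ) 1) ∧
              Ex p r = Ex p f ∧
              Lam p r ≤ Lam p f + K / p ∧
              (let g : ZMod p → ℝ := fun n => r (-n / 2)
               ∑ n : ZMod p,
                 |r n - (if conv p r r (2 * n) + 2 * conv p r g (-n) ≤ L
                   then (1 : ℝ) else 0)| ≤ K * p * (Real.log p) ^ (-(2 : ℝ)/3)) := by
  obtain ⟨P0, hP0, hroth⟩ := roth_count
  obtain ⟨P1, hP1, hnum⟩ := final_num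
  set P := max P0 P1 with hP
  have hP3 : 3 ≤ P := hP1.trans (le_max_right _ _)
  refine ⟨2 + P, by linarith, ?_⟩
  intro p _ hodd θ _ f hf _ _
  have hpr : p.Prime := Fact.out
  have hp0 : (0 : ℝ) < p := by exact_mod_cast hpr.pos
  have hp1 : (1 : ℝ) < p := by exact_mod_cast hpr.one_lt
  have hp2 : (2 : ZMod p) ≠ 0 := by
    intro h
    have : ((2 : ℕ) : ZMod p) = 0 := by exact_mod_cast h
    rw [ZMod.natCast_eq_zero_iff] at this
    have h3 := (Nat.prime_dvd_prime_iff_eq hpr Nat.prime_two).mp this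
    rw [h3] at hodd; exact absurd hodd (by decide)
  obtain ⟨r, hr, hsum, hT, hV⟩ := minimizer f hf
  set lp := Real.log p with hlp
  have hlp0 : 0 < lp := Real.log_pos hp1
  set ε := lp ^ (-(2:ℝ)/3) with hε
  have hε0 : 0 < ε := Real.rpow_pos_of_pos hlp0 _
  have hLam : Lam p r ≤ Lam p f + (2 + P) / p := by
    unfold Lam
    rw [TT_eq, TT_eq]
    have h1 : ((p:ℝ) ^ 2)⁻¹ * TT r ≤ ((p:ℝ) ^ 2)⁻¹ * (TT f + p) :=
      mul_le_mul_of_nonneg_left hT (by positivity)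
    have h2 : ((p:ℝ) ^ 2)⁻¹ * (TT f + p) = ((p:ℝ) ^ 2)⁻¹ * TT f + 1 / p := by
      field_simp
    have h3 : 1 / (p:ℝ) ≤ (2 + P) / p := by gcongr; linarith
    linarith
  have hEx : Ex p r = Ex p f := by unfold Ex; rw [hsum]
  have err1 : ∀ (Q : Prop) [Decidable Q] (n : ZMod p), |r n - (if Q then (1:ℝ) else 0)| ≤ 1 := by
    intro Q _ n
    have := hr n
    rw [abs_le]
    split_ifs
    · exact ⟨by linarith [this.1], by linarith [this.2]⟩
    · exact ⟨by linarith [this.1], by linarith [this.2]⟩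
  by_cases hbig : P ≤ lp
  swap
  · refine ⟨r, 0, hr, hEx, hLam, ?_⟩
    intro g
    have h1 : ∑ n : ZMod p, |r n - (if conv p r r (2 * n) + 2 * conv p r g (-n) ≤ 0
                   then (1 : ℝ) else 0)| ≤ ∑ _n : ZMod p, (1:ℝ) :=
      Finset.sum_le_sum (fun n _ => err1 _ n)
    refine h1.trans ?_
    have e : ∑ _n : ZMod p, (1:ℝ) = p := by simp [ZMod.card]
    rw [e]
    push Not at hbig
    have h2 : 1 ≤ (2 + P) * ε := by
      have h3 : P ^ (-(2:ℝ)/3) ≤ ε :=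
        Real.rpow_le_rpow_of_nonpos hlp0 hbig.le (by norm_num)
      have h4 : 1 ≤ P * P ^ (-(2:ℝ)/3) := by
        rw [← Real.rpow_one_add' (by linarith) (by norm_num)]
        exact Real.one_le_rpow (by linarith) (by norm_num)
      have h5 : P * P ^ (-(2:ℝ)/3) ≤ P * ε := mul_le_mul_of_nonneg_left h3 (by linarith)
      linarith
    have := mul_le_mul_of_nonneg_left h2 hp0.le
    linarith
  have hε2 : ε ≤ 1 / 2 := by
    have h3 : ε ≤ (3:ℝ) ^ (-(2:ℝ)/3) :=
      Real.rpow_le_rpow_of_nonpos (by norm_num) (by linarith) (by norm_num)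
    refine h3.trans ?_
    have h4 : ((3:ℝ) ^ (-(2:ℝ)/3)) ^ 3 ≤ (1/2) ^ 3 := by
      rw [← Real.rpow_natCast, ← Real.rpow_mul (by norm_num)]
      norm_num
    exact le_of_pow_le_pow_left₀ (by norm_num) (by norm_num) h4
  set Z : Finset (ZMod p) := Finset.univ.filter (fun n => ε ≤ r n ∧ r n ≤ 1 - ε) with hZ
  have hZcard : (Z.card : ℝ) ≤ ε * p := by
    by_contra hcon
    push Not at hcon
    have hN := hroth p hodd ((le_max_left _ _).trans hbig) Z hcon.le
    have hZ0 : 0 < Z.card := by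
      have : (0:ℝ) < Z.card := lt_trans (by positivity) hcon
      exact_mod_cast this
    have hB := count_bound hp2 Z hZ0 r (fun i => abs_le.mpr ⟨by linarith [(hr i).1], (hr i).2⟩) ε
      (Real.exp (0.7 * lp)) hε0 (Real.one_le_exp (by positivity))
      (second_order r hV hr ε Z (fun n hn => (Finset.mem_filter.mp hn).2))
    have hn := hnum lp ((le_max_right _ _).trans hbig)
    have ep : Real.exp lp = p := Real.exp_log hp0
    rw [ep] at hn
    simp only [← hε] at hn
    simp only [← hlp] at hN
    linarith
  have hF : ∀ x y, r y < r x → conv p r r (2 * x) + 2 * conv p r (fun m => r (-m / 2)) (-x) <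
      conv p r r (2 * y) + 2 * conv p r (fun m => r (-m / 2)) (-y) := by
    intro x y h
    have := swap r hr hV x y h
    rw [grad hp2, grad hp2] at this
    exact this
  set F : ZMod p → ℝ := fun n => conv p r r (2 * n) + 2 * conv p r (fun m => r (-m / 2)) (-n) with hFd
  have hL : ∃ L : ℝ, (∀ n, 1 - ε < r n → F n ≤ L) ∧ (∀ n, r n < ε → L < F n) := by
    by_cases hhi : (Finset.univ.filter (fun n => 1 - ε < r n)).Nonempty
    · obtain ⟨x0, hx0, hmax⟩ := Finset.exists_max_image _ F hhi
      refine ⟨F x0, fun n hn => hmax n (by simp [hn]), fun n hn => hF x0 n ?_⟩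
      have := (Finset.mem_filter.mp hx0).2
      linarith
    · obtain ⟨y0, _, hmin⟩ := Finset.exists_min_image Finset.univ F ⟨0, Finset.mem_univ 0⟩
      refine ⟨F y0 - 1, fun n hn => ?_, fun n _ => by linarith [hmin n (Finset.mem_univ n)]⟩
      exact absurd ⟨n, by simp [hn]⟩ hhi
  obtain ⟨L, hL1, hL2⟩ := hL
  refine ⟨r, L, hr, hEx, hLam, ?_⟩
  intro g
  have bound : ∀ n, |r n - (if conv p r r (2 * n) + 2 * conv p r g (-n) ≤ L
                   then (1 : ℝ) else 0)| ≤ ε + (if n ∈ Z then 1 else 0) := by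
    intro n
    by_cases hn : n ∈ Z
    · rw [if_pos hn]
      have := err1 (conv p r r (2 * n) + 2 * conv p r g (-n) ≤ L) n
      linarith
    · rw [if_neg hn, add_zero]
      have hn' : ¬ (ε ≤ r n ∧ r n ≤ 1 - ε) := fun h => hn (by rw [hZ]; simp [h])
      by_cases h1 : ε ≤ r n
      · have h2 : 1 - ε < r n := by
          by_contra h; exact hn' ⟨h1, not_lt.mp h⟩
        have h3 : conv p r r (2 * n) + 2 * conv p r g (-n) ≤ L := hL1 n h2
        rw [if_pos h3, abs_le]
        exact ⟨by linarith, by linarith [(hr n).2]⟩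
      · have h2 : r n < ε := not_le.mp h1
        have h3 : L < conv p r r (2 * n) + 2 * conv p r g (-n) := hL2 n h2
        rw [if_neg (not_le.mpr h3), abs_le]
        exact ⟨by linarith [(hr n).1], by linarith⟩
  refine (Finset.sum_le_sum (fun n _ => bound n)).trans ?_
  rw [Finset.sum_add_distrib]
  have e1 : ∑ _n : ZMod p, ε = p * ε := by simp [ZMod.card]
  have e2 : ∑ n : ZMod p, (if n ∈ Z then (1:ℝ) else 0) = Z.card := by simp
  rw [e1, e2]
  have h0 : 0 ≤ P * (p * ε) := by positivity
  have e3 : (2 + P) * p * ε = 2 * (p * ε) + P * (p * ε) := by ring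
  rw [e3]
  linarith
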